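/- For each n ∈ ℕ and every countable model M of BΣ_{n+2}, there is a proper Σ_{n+2}-elementary end extension M ≼_{e,Σ_{n+2}} K such that K ⊨ BΣ_{n+1}. (This answers the Kaufmann–Clote question affirmatively.) -/

import Mathlib

namespace PaperArith

/-! ## Syntax of (two-sorted) first-order arithmetic

Terms and formulas of arithmetic in the language `{0, 1, +, ·, <}`,
with number variables and (monadic second-order) set variables both indexed
by natural numbers.  Bounded quantifiers are taken as primitives, so that the
class `Δ₀` of bounded formulas is a purely syntactic class. -/

/-- Terms of first-order arithmetic in the language `{0, 1, +, ·, <}`. -/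
inductive Term : Type
  | var : ℕ → Term
  | zero : Term
  | one : Term
  | add : Term → Term → Term
  | mul : Term → Term → Term

/-- Formulas of (two-sorted) arithmetic.  `mem t i` is the atomic formula
`t ∈ Xᵢ`; `ball x t φ` is `∀ x < t, φ` and `bex x t φ` is `∃ x < t, φ`;
`sall i φ` and `sex i φ` quantify over the set variable `Xᵢ`.
Purely first-order formulas are those avoiding `mem`, `sall`, `sex`. -/
inductive Fml : Type
  | eq : Term → Term → Fml
  | lt : Term → Term → Fml
  | mem : Term → ℕ → Fml
  | not : Fml → Fml
  | and : Fml → Fml → Fml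
  | or : Fml → Fml → Fml
  | imp : Fml → Fml → Fml
  | all : ℕ → Fml → Fml
  | ex : ℕ → Fml → Fml
  | ball : ℕ → Term → Fml → Fml
  | bex : ℕ → Term → Fml → Fml
  | sall : ℕ → Fml → Fml
  | sex : ℕ → Fml → Fml

/-- A structure for the first-order language of arithmetic. -/
structure Str : Type 1 where
  M : Type
  zero : M
  one : M
  add : M → M → M
  mul : M → M → M
  lt : M → M → Prop

/-- Value of a term under a valuation of the number variables. -/
def tval (S : Str) (v : ℕ → S.M) : Term → S.M
  | .var i => v i
  | .zero => S.zero
  | .one => S.one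
  | .add t u => S.add (tval S v t) (tval S v u)
  | .mul t u => S.mul (tval S v t) (tval S v u)

/-- Update a valuation at one variable. -/
def upd {α : Type} (v : ℕ → α) (x : ℕ) (a : α) : ℕ → α :=
  fun i => if i = x then a else v i

/-- Tarskian satisfaction over the structure `S`, with second-order universe
`X` (set quantifiers range over `X`); `v` is the valuation of number
variables, `w` the valuation of set variables. -/
def Sat (S : Str) (X : Set (Set S.M)) : (ℕ → S.M) → (ℕ → Set S.M) → Fml → Prop
  | v, _, .eq t u => tval S v t = tval S v u
  | v, _, .lt t u => S.lt (tval S v t) (tval S v u)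
  | v, w, .mem t i => tval S v t ∈ w i
  | v, w, .not φ => ¬ Sat S X v w φ
  | v, w, .and φ ψ => Sat S X v w φ ∧ Sat S X v w ψ
  | v, w, .or φ ψ => Sat S X v w φ ∨ Sat S X v w ψ
  | v, w, .imp φ ψ => Sat S X v w φ → Sat S X v w ψ
  | v, w, .all x φ => ∀ m : S.M, Sat S X (upd v x m) w φ
  | v, w, .ex x φ => ∃ m : S.M, Sat S X (upd v x m) w φ
  | v, w, .ball x t φ => ∀ m : S.M, S.lt m (tval S v t) → Sat S X (upd v x m) w φ
  | v, w, .bex x t φ => ∃ m : S.M, S.lt m (tval S v t) ∧ Sat S X (upd v x m) w φ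
  | v, w, .sall i φ => ∀ A : Set S.M, A ∈ X → Sat S X v (upd w i A) φ
  | v, w, .sex i φ => ∃ A : Set S.M, A ∈ X ∧ Sat S X v (upd w i A) φ

/-- First-order satisfaction (for purely first-order formulas the second-order
data is irrelevant). -/
def Sat0 (S : Str) (v : ℕ → S.M) (φ : Fml) : Prop :=
  Sat S ∅ v (fun _ => ∅) φ

/-! ## The arithmetic hierarchy -/

/-- `Δ₀` formulas: purely first-order, only bounded quantifiers. -/
inductive Delta0 : Fml → Prop
  | eq (t u : Term) : Delta0 (.eq t u)
  | lt (t u : Term) : Delta0 (.lt t u)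
  | not {φ : Fml} : Delta0 φ → Delta0 (.not φ)
  | and {φ ψ : Fml} : Delta0 φ → Delta0 ψ → Delta0 (.and φ ψ)
  | or {φ ψ : Fml} : Delta0 φ → Delta0 ψ → Delta0 (.or φ ψ)
  | imp {φ ψ : Fml} : Delta0 φ → Delta0 ψ → Delta0 (.imp φ ψ)
  | ball (x : ℕ) (t : Term) {φ : Fml} : Delta0 φ → Delta0 (.ball x t φ)
  | bex (x : ℕ) (t : Term) {φ : Fml} : Delta0 φ → Delta0 (.bex x t φ)

mutual
  /-- `Σₙ` formulas of the first-order arithmetic hierarchy. -/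
  inductive IsSigma : ℕ → Fml → Prop
    | delta0 {n : ℕ} {φ : Fml} : Delta0 φ → IsSigma n φ
    | ofPi {n : ℕ} {φ : Fml} : IsPi n φ → IsSigma (n + 1) φ
    | ex (x : ℕ) {n : ℕ} {φ : Fml} : IsSigma (n + 1) φ → IsSigma (n + 1) (.ex x φ)
  /-- `Πₙ` formulas of the first-order arithmetic hierarchy. -/
  inductive IsPi : ℕ → Fml → Prop
    | delta0 {n : ℕ} {φ : Fml} : Delta0 φ → IsPi n φ
    | ofSigma {n : ℕ} {φ : Fml} : IsSigma n φ → IsPi (n + 1) φ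
    | all (x : ℕ) {n : ℕ} {φ : Fml} : IsPi (n + 1) φ → IsPi (n + 1) (.all x φ)
end

/-- `Σ₀(Σₙ)`: the closure of `Σₙ` under Boolean operations and bounded
quantification. -/
inductive Sigma0Sigma (n : ℕ) : Fml → Prop
  | ofSigma {φ : Fml} : IsSigma n φ → Sigma0Sigma n φ
  | not {φ : Fml} : Sigma0Sigma n φ → Sigma0Sigma n (.not φ)
  | and {φ ψ : Fml} : Sigma0Sigma n φ → Sigma0Sigma n ψ → Sigma0Sigma n (.and φ ψ)
  | or {φ ψ : Fml} : Sigma0Sigma n φ → Sigma0Sigma n ψ → Sigma0Sigma n (.or φ ψ)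
  | imp {φ ψ : Fml} : Sigma0Sigma n φ → Sigma0Sigma n ψ → Sigma0Sigma n (.imp φ ψ)
  | ball (x : ℕ) (t : Term) {φ : Fml} : Sigma0Sigma n φ → Sigma0Sigma n (.ball x t φ)
  | bex (x : ℕ) (t : Term) {φ : Fml} : Sigma0Sigma n φ → Sigma0Sigma n (.bex x t φ)

/-- The class `Σₙ ∧ Πₙ` of conjunctions of a `Σₙ` and a `Πₙ` formula. -/
def SigmaAndPi (n : ℕ) (φ : Fml) : Prop :=
  ∃ ψ χ : Fml, IsSigma n ψ ∧ IsPi n χ ∧ φ = Fml.and ψ χ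

/-- The class `Σₙ ∨ Πₙ` of disjunctions of a `Σₙ` and a `Πₙ` formula. -/
def SigmaOrPi (n : ℕ) (φ : Fml) : Prop :=
  ∃ ψ χ : Fml, IsSigma n ψ ∧ IsPi n χ ∧ φ = Fml.or ψ χ

/-- `Δ₀⁰` formulas of second-order arithmetic: only bounded first-order
quantifiers; free set variables (set parameters) are allowed. -/
inductive Delta0SO : Fml → Prop
  | eq (t u : Term) : Delta0SO (.eq t u)
  | lt (t u : Term) : Delta0SO (.lt t u)
  | mem (t : Term) (i : ℕ) : Delta0SO (.mem t i)
  | not {φ : Fml} : Delta0SO φ → Delta0SO (.not φ)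
  | and {φ ψ : Fml} : Delta0SO φ → Delta0SO ψ → Delta0SO (.and φ ψ)
  | or {φ ψ : Fml} : Delta0SO φ → Delta0SO ψ → Delta0SO (.or φ ψ)
  | imp {φ ψ : Fml} : Delta0SO φ → Delta0SO ψ → Delta0SO (.imp φ ψ)
  | ball (x : ℕ) (t : Term) {φ : Fml} : Delta0SO φ → Delta0SO (.ball x t φ)
  | bex (x : ℕ) (t : Term) {φ : Fml} : Delta0SO φ → Delta0SO (.bex x t φ)

mutual
  /-- `Σₙ⁰` formulas of the second-order arithmetic hierarchy
  (set parameters allowed, no set quantifiers). -/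
  inductive SigmaSO : ℕ → Fml → Prop
    | delta0 {n : ℕ} {φ : Fml} : Delta0SO φ → SigmaSO n φ
    | ofPi {n : ℕ} {φ : Fml} : PiSO n φ → SigmaSO (n + 1) φ
    | ex (x : ℕ) {n : ℕ} {φ : Fml} : SigmaSO (n + 1) φ → SigmaSO (n + 1) (.ex x φ)
  /-- `Πₙ⁰` formulas of the second-order arithmetic hierarchy. -/
  inductive PiSO : ℕ → Fml → Prop
    | delta0 {n : ℕ} {φ : Fml} : Delta0SO φ → PiSO n φ
    | ofSigma {n : ℕ} {φ : Fml} : SigmaSO n φ → PiSO (n + 1) φ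
    | all (x : ℕ) {n : ℕ} {φ : Fml} : PiSO (n + 1) φ → PiSO (n + 1) (.all x φ)
end

/-! ## First-order theories -/

/-- `PA⁻`: the theory of non-negative parts of discretely ordered rings. -/
structure PAminus (S : Str) : Prop where
  add_assoc : ∀ a b c, S.add (S.add a b) c = S.add a (S.add b c)
  add_comm : ∀ a b, S.add a b = S.add b a
  mul_assoc : ∀ a b c, S.mul (S.mul a b) c = S.mul a (S.mul b c)
  mul_comm : ∀ a b, S.mul a b = S.mul b a
  distrib : ∀ a b c, S.mul a (S.add b c) = S.add (S.mul a b) (S.mul a c)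
  add_zero : ∀ a, S.add a S.zero = a
  mul_zero : ∀ a, S.mul a S.zero = S.zero
  mul_one : ∀ a, S.mul a S.one = a
  lt_irrefl : ∀ a, ¬ S.lt a a
  lt_trans : ∀ a b c, S.lt a b → S.lt b c → S.lt a c
  lt_total : ∀ a b, S.lt a b ∨ a = b ∨ S.lt b a
  add_lt_add : ∀ a b c, S.lt a b → S.lt (S.add a c) (S.add b c)
  mul_lt_mul : ∀ a b c, S.lt a b → S.lt S.zero c → S.lt (S.mul a c) (S.mul b c)
  zero_lt_one : S.lt S.zero S.one
  zero_le : ∀ a, a = S.zero ∨ S.lt S.zero a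
  discrete : ∀ a b, S.lt a b → S.add a S.one = b ∨ S.lt (S.add a S.one) b
  pred : ∀ a, S.lt S.zero a → ∃ b, S.add b S.one = a
  sub : ∀ a b, S.lt a b → ∃ c, S.add a c = b

/-- The induction scheme for the class `Γ` of formulas
(parameters are allowed via the ambient valuation `v`). -/
def IndFor (S : Str) (Γ : Fml → Prop) : Prop :=
  ∀ φ : Fml, Γ φ → ∀ (v : ℕ → S.M) (x : ℕ),
    Sat0 S (upd v x S.zero) φ →
    (∀ m, Sat0 S (upd v x m) φ → Sat0 S (upd v x (S.add m S.one)) φ) →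
    ∀ m, Sat0 S (upd v x m) φ

/-- The collection scheme for the class `Γ`:
`(∀ x < a ∃ y φ) → (∃ b ∀ x < a ∃ y < b φ)`. -/
def CollFor (S : Str) (Γ : Fml → Prop) : Prop :=
  ∀ φ : Fml, Γ φ → ∀ (v : ℕ → S.M) (x y : ℕ), x ≠ y → ∀ a : S.M,
    (∀ m, S.lt m a → ∃ k, Sat0 S (upd (upd v x m) y k) φ) →
    ∃ b, ∀ m, S.lt m a → ∃ k, S.lt k b ∧ Sat0 S (upd (upd v x m) y k) φ

/-- `IΔ₀` (over `PA⁻`). -/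
def IDelta0 (S : Str) : Prop := PAminus S ∧ IndFor S Delta0

/-- `IΣₙ` (over `PA⁻`; note `Δ₀ ⊆ Σₙ`, so this includes `IΔ₀`). -/
def ISigma (S : Str) (n : ℕ) : Prop := PAminus S ∧ IndFor S (IsSigma n)

/-- `BΣₙ`: the `Σₙ`-collection scheme, including `IΔ₀` (over `PA⁻`). -/
def BSigma (S : Str) (n : ℕ) : Prop := IDelta0 S ∧ CollFor S (IsSigma n)

/-- The weak regularity principle `WRφ` for all `φ` in the class `Γ`:
the universal closure of `(∀ x ∃ y < a φ(x,y)) → (∃ y < a ∀ b ∃ x > b φ(x,y))`.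
Here `x, y` are the two displayed variables and all other free variables of
`φ` are parameters, interpreted by the ambient valuation `v`. -/
def WRFor (S : Str) (Γ : Fml → Prop) : Prop :=
  ∀ φ : Fml, Γ φ → ∀ (v : ℕ → S.M) (x y : ℕ), x ≠ y → ∀ a : S.M,
    (∀ m, ∃ k, S.lt k a ∧ Sat0 S (upd (upd v x m) y k) φ) →
    ∃ k, S.lt k a ∧ ∀ b, ∃ m, S.lt b m ∧ Sat0 S (upd (upd v x m) y k) φ

/-! ## Second-order theories -/

/-- Second-order induction scheme for the class `Γ`, with set parameters
from the second-order universe `X`. -/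
def IndForSO (S : Str) (X : Set (Set S.M)) (Γ : Fml → Prop) : Prop :=
  ∀ φ : Fml, Γ φ → ∀ (v : ℕ → S.M) (w : ℕ → Set S.M), (∀ i, w i ∈ X) → ∀ x : ℕ,
    Sat S X (upd v x S.zero) w φ →
    (∀ m, Sat S X (upd v x m) w φ → Sat S X (upd v x (S.add m S.one)) w φ) →
    ∀ m, Sat S X (upd v x m) w φ

/-- Second-order collection scheme for the class `Γ`. -/
def CollForSO (S : Str) (X : Set (Set S.M)) (Γ : Fml → Prop) : Prop :=
  ∀ φ : Fml, Γ φ → ∀ (v : ℕ → S.M) (w : ℕ → Set S.M), (∀ i, w i ∈ X) →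
    ∀ (x y : ℕ), x ≠ y → ∀ a : S.M,
    (∀ m, S.lt m a → ∃ k, Sat S X (upd (upd v x m) y k) w φ) →
    ∃ b, ∀ m, S.lt m a → ∃ k, S.lt k b ∧ Sat S X (upd (upd v x m) y k) w φ

/-- `Δ₁⁰`-comprehension. -/
def Delta1CA (S : Str) (X : Set (Set S.M)) : Prop :=
  ∀ φ ψ : Fml, SigmaSO 1 φ → PiSO 1 ψ →
    ∀ (v : ℕ → S.M) (w : ℕ → Set S.M), (∀ i, w i ∈ X) → ∀ x : ℕ,
    (∀ m, Sat S X (upd v x m) w φ ↔ Sat S X (upd v x m) w ψ) →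
    ∃ A ∈ X, ∀ m, m ∈ A ↔ Sat S X (upd v x m) w φ

/-- `Σₙ`-comprehension for first-order formulas with parameters from `M`. -/
def SigmaCA (S : Str) (X : Set (Set S.M)) (n : ℕ) : Prop :=
  ∀ φ : Fml, IsSigma n φ → ∀ (v : ℕ → S.M) (x : ℕ),
    ∃ A ∈ X, ∀ m, m ∈ A ↔ Sat0 S (upd v x m) φ

/-- `RCA₀`. -/
def RCA0 (S : Str) (X : Set (Set S.M)) : Prop :=
  PAminus S ∧ IndForSO S X (SigmaSO 1) ∧ Delta1CA S X

/-- `Σ₁⁰`-separation; over `RCA₀` this is equivalent to weak Kőnig's lemma. -/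
def Sigma1Sep (S : Str) (X : Set (Set S.M)) : Prop :=
  ∀ φ ψ : Fml, SigmaSO 1 φ → SigmaSO 1 ψ →
    ∀ (v : ℕ → S.M) (w : ℕ → Set S.M), (∀ i, w i ∈ X) → ∀ x : ℕ,
    (∀ m, ¬ (Sat S X (upd v x m) w φ ∧ Sat S X (upd v x m) w ψ)) →
    ∃ A ∈ X, ∀ m, (Sat S X (upd v x m) w φ → m ∈ A) ∧ (m ∈ A → ¬ Sat S X (upd v x m) w ψ)

/-- `WKL₀`, rendered as `RCA₀` plus `Σ₁⁰`-separation (which is equivalent,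
over `RCA₀`, to weak Kőnig's lemma). -/
def WKL0 (S : Str) (X : Set (Set S.M)) : Prop := RCA0 S X ∧ Sigma1Sep S X

/-- `BΣₙ⁰`: the second-order `Σₙ⁰`-collection scheme (including `IΔ₀⁰`,
over `PA⁻`). -/
def BSigmaSO (S : Str) (X : Set (Set S.M)) (n : ℕ) : Prop :=
  PAminus S ∧ IndForSO S X Delta0SO ∧ CollForSO S X (SigmaSO n)

/-- `IΣₙ⁰`: the second-order `Σₙ⁰`-induction scheme, over `RCA₀`. -/
def ISigmaSO (S : Str) (X : Set (Set S.M)) (n : ℕ) : Prop :=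
  RCA0 S X ∧ IndForSO S X (SigmaSO n)

/-! ## Exponentiation and binary digits -/

/-- Satisfaction of a three-variable formula `E(x₀, x₁, x₂)` at `(a, b, c)`. -/
def ExpAt (S : Str) (E : Fml) (a b c : S.M) : Prop :=
  Sat0 S (fun i => if i = 0 then a else if i = 1 then b else c) E

/-- `E(x₀,x₁,x₂)` is a `Δ₀` definition of the (total) exponentiation function
`x₀ ^ x₁ = x₂`.  The existence of such an `E` expresses `exp`
(the totality of exponentiation). -/
structure IsExpDef (S : Str) (E : Fml) : Prop where
  delta0 : Delta0 E
  base : ∀ a, ExpAt S E a S.zero S.one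
  total : ∀ a b, ∃ c, ExpAt S E a b c
  unique : ∀ a b c c', ExpAt S E a b c → ExpAt S E a b c' → c = c'
  step : ∀ a b c, ExpAt S E a b c → ExpAt S E a (S.add b S.one) (S.mul c a)

/-- `exp`: the totality of exponentiation (via a `Δ₀` definition of its
graph). -/
def SatExp (S : Str) : Prop := ∃ E : Fml, IsExpDef S E

/-! ## Embeddings, end extensions and elementarity -/

/-- An embedding of arithmetic structures. -/
structure Emb (S K : Str) where
  j : S.M → K.M
  inj : Function.Injective j
  zero : j S.zero = K.zero
  one : j S.one = K.one
  add : ∀ a b, j (S.add a b) = K.add (j a) (j b)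
  mul : ∀ a b, j (S.mul a b) = K.mul (j a) (j b)
  lt_iff : ∀ a b, S.lt a b ↔ K.lt (j a) (j b)

/-- The extension along `e` is an end extension: every element of `K` not in
the image of `M` exceeds every element of `M`. -/
def IsEndExt {S K : Str} (e : Emb S K) : Prop :=
  ∀ b : K.M, b ∉ Set.range e.j → ∀ a : S.M, K.lt (e.j a) b

/-- The extension along `e` is proper. -/
def IsProper {S K : Str} (e : Emb S K) : Prop := ¬ Function.Surjective e.j

/-- The extension along `e` is `Σₙ`-elementary: all `Σₙ` formulas with
parameters from `M` are absolute between `M` and `K`. -/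
def SigmaElem {S K : Str} (e : Emb S K) (n : ℕ) : Prop :=
  ∀ φ : Fml, IsSigma n φ → ∀ v : ℕ → S.M,
    (Sat0 S v φ ↔ Sat0 K (fun i => e.j (v i)) φ)

/-- `K ⊨ M‑IΣₙ` (for an extension `e : M → K`): induction up to any `a ∈ M`
for `Σₙ` formulas with parameters from `K`. -/
def MISigma {S K : Str} (e : Emb S K) (n : ℕ) : Prop :=
  ∀ φ : Fml, IsSigma n φ → ∀ (v : ℕ → K.M) (x : ℕ) (a : S.M),
    Sat0 K (upd v x K.zero) φ →
    (∀ m, K.lt m (e.j a) → (Sat0 K (upd v x m) φ → Sat0 K (upd v x (K.add m K.one)) φ)) →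
    ∀ m, K.lt m (e.j a) → Sat0 K (upd v x m) φ

/-- The `x`-th binary digit of `c ∈ K` is `1`, computed via a `Δ₀` definition
`E` of exponentiation on the ground model `S` (here `x` lies under the image
of `S`): there are `x', p ∈ M` with `j x' = x`, `p = 2 ^ x'`, and `u, v ∈ K`
with `c = u·(2p) + p + v` and `v < p`. -/
def BitVia {S K : Str} (e : Emb S K) (E : Fml) (x c : K.M) : Prop :=
  ∃ x' p : S.M, e.j x' = x ∧ ExpAt S E (S.add S.one S.one) x' p ∧
    ∃ u v : K.M, K.lt v (e.j p) ∧
      c = K.add (K.add (K.mul u (K.add (e.j p) (e.j p))) (e.j p)) v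

/-! ## The second-order restricted ultrapower -/

/-- `A` is cofinal (unbounded) in `S`. -/
def Cofinal (S : Str) (A : Set S.M) : Prop := ∀ b : S.M, ∃ x ∈ A, S.lt b x

/-- The pairing term `⟨x, y⟩ = (x + y)·(x + y) + x`. -/
def pairS (S : Str) (x y : S.M) : S.M := S.add (S.mul (S.add x y) (S.add x y)) x

/-- The graph of `f : M → M`, coded as a subset of `M` via pairing. -/
def graphOf (S : Str) (f : S.M → S.M) : Set S.M := {m | ∃ x, m = pairS S x (f x)}

/-- `f` is a total function `M → M` lying in the second-order universe `X`
(its coded graph belongs to `X`).  The collection of such `f` is the class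
`ℱ` of the restricted ultrapower. -/
def FuncIn (S : Str) (X : Set (Set S.M)) (f : S.M → S.M) : Prop := graphOf S f ∈ X

/-- `U` is an ultrafilter on the Boolean algebra `X`, all of whose elements
are cofinal in `M`. -/
structure UltraOn (S : Str) (X U : Set (Set S.M)) : Prop where
  subset : U ⊆ X
  univ_mem : Set.univ ∈ U
  empty_not_mem : ∅ ∉ U
  inter_mem : ∀ A ∈ U, ∀ B ∈ U, A ∩ B ∈ U
  superset_mem : ∀ A ∈ U, ∀ B ∈ X, A ⊆ B → B ∈ U
  ultra : ∀ A ∈ X, A ∈ U ∨ Aᶜ ∈ U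
  cofinal : ∀ A ∈ U, Cofinal S A

/-- A realization of the second-order restricted ultrapower `ℱ/𝒰` of `S`
with respect to the second-order universe `X` and the ultrafilter `U`:
a structure `K` whose elements are exactly the classes `cls f hf = [f]` of
total functions `f ∈ ℱ`, where `[f] = [g]` iff `f = g` on a set in `U`, with
pointwise arithmetic operations, order decided by `U`, and the inherited
second-order membership relation `memK` serving as the second-order expansion. -/
structure RUP (S : Str) (X U : Set (Set S.M)) : Type 1 where
  K : Str
  cls : (f : S.M → S.M) → FuncIn S X f → K.M
  memK : K.M → Set S.M → Prop
  const_in : ∀ a : S.M, FuncIn S X (fun _ => a)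
  surj : ∀ b : K.M, ∃ (f : S.M → S.M) (hf : FuncIn S X f), cls f hf = b
  eq_iff : ∀ (f : S.M → S.M) (hf : FuncIn S X f) (g : S.M → S.M) (hg : FuncIn S X g),
      (cls f hf = cls g hg) ↔ {i : S.M | f i = g i} ∈ U
  lt_iff : ∀ (f : S.M → S.M) (hf : FuncIn S X f) (g : S.M → S.M) (hg : FuncIn S X g),
      K.lt (cls f hf) (cls g hg) ↔ {i : S.M | S.lt (f i) (g i)} ∈ U
  zero_eq : K.zero = cls (fun _ => S.zero) (const_in S.zero)
  one_eq : K.one = cls (fun _ => S.one) (const_in S.one)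
  add_eq : ∀ (f : S.M → S.M) (hf : FuncIn S X f) (g : S.M → S.M) (hg : FuncIn S X g)
      (h : S.M → S.M) (hh : FuncIn S X h), (∀ i, h i = S.add (f i) (g i)) →
      K.add (cls f hf) (cls g hg) = cls h hh
  mul_eq : ∀ (f : S.M → S.M) (hf : FuncIn S X f) (g : S.M → S.M) (hg : FuncIn S X g)
      (h : S.M → S.M) (hh : FuncIn S X h), (∀ i, h i = S.mul (f i) (g i)) →
      K.mul (cls f hf) (cls g hg) = cls h hh
  mem_iff : ∀ (f : S.M → S.M) (hf : FuncIn S X f) (A : Set S.M), A ∈ X →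
      (memK (cls f hf) A ↔ {i : S.M | f i ∈ A} ∈ U)

/-- The canonical embedding `M → ℱ/𝒰` via constant functions. -/
def RUP.emb {S : Str} {X U : Set (Set S.M)} (R : RUP S X U) (a : S.M) : R.K.M :=
  R.cls (fun _ => a) (R.const_in a)

/-- The subset of `ℱ/𝒰` induced by `A ⊆ M`. -/
def RUP.setImg {S : Str} {X U : Set (Set S.M)} (R : RUP S X U) (A : Set S.M) :
    Set R.K.M := {b | R.memK b A}

/-- The second-order part of the expanded ultrapower `(ℱ/𝒰, 𝒳)`:
the (injected) copy of `X`. -/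
def RUP.X2 {S : Str} {X U : Set (Set S.M)} (R : RUP S X U) : Set (Set R.K.M) :=
  (fun A => R.setImg A) '' X

end PaperArith

namespace PaperArith

set_option linter.unusedSectionVars false
set_option linter.unusedVariables false

/-- Discretely ordered semirings, bundled as a class. -/
class Arith (M : Type) extends CommSemiring M, LinearOrder M, IsStrictOrderedRing M,
    CanonicallyOrderedAdd M where
  succ_le : ∀ {a b : M}, a < b → a + 1 ≤ b

section Arith
variable {M : Type} [Arith M]

theorem lt_succ {a b : M} : a < b + 1 ↔ a ≤ b := by
  constructor
  · intro h
    by_contra hc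
    have := Arith.succ_le (not_le.1 hc)
    exact absurd h (not_lt.2 this)
  · intro h
    exact lt_of_le_of_lt h (lt_add_one b)

theorem succ_le_iff' {a b : M} : a + 1 ≤ b ↔ a < b :=
  ⟨fun h => lt_of_lt_of_le (lt_add_one a) h, Arith.succ_le⟩

theorem eq_zero_or_succ (a : M) : a = 0 ∨ ∃ b, a = b + 1 := by
  rcases eq_or_ne a 0 with h | h
  · exact Or.inl h
  · have h1 : (0:M) < a := pos_iff_ne_zero.2 h
    have h2 := Arith.succ_le h1
    obtain ⟨c, hc⟩ := exists_add_of_le h2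
    exact Or.inr ⟨c, by rw [hc]; ring⟩

/-- The pairing function. -/
def pr (x y : M) : M := (x + y) * (x + y) + x

theorem le_mul_self (a : M) : a ≤ a * a := by
  rcases eq_zero_or_succ a with h | ⟨b, rfl⟩
  · simp [h]
  · have : b + 1 ≤ (b+1) + (b * b + b) := le_self_add
    calc b + 1 ≤ (b+1) + (b * b + b) := this
      _ = (b+1)*(b+1) := by ring

theorem add_le_pr (x y : M) : x + y ≤ pr x y := le_trans (le_mul_self _) le_self_add
theorem left_le_pr (x y : M) : x ≤ pr x y := le_trans le_self_add (add_le_pr x y)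
theorem right_le_pr (x y : M) : y ≤ pr x y := le_trans le_add_self (add_le_pr x y)

theorem pr_mono {x y x' y' : M} (h : x ≤ x') (h' : y ≤ y') : pr x y ≤ pr x' y' := by
  unfold pr; gcongr

theorem pr_lt_of_add_lt {x y x' y' : M} (h : x + y < x' + y') : pr x y < pr x' y' := by
  have h1 := Arith.succ_le h
  have h2 : (x + y + 1) * (x + y + 1) ≤ (x'+y')*(x'+y') := by gcongr
  have h3 : pr x y < (x + y + 1) * (x + y + 1) := by
    unfold pr
    have : (x + y + 1) * (x + y + 1) = ((x+y)*(x+y) + x) + (x + y + y + 1) := by ring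
    rw [this]
    have : (0:M) < x + y + y + 1 := by positivity
    exact lt_add_of_pos_right _ this
  exact lt_of_lt_of_le h3 (le_trans h2 le_self_add)

theorem pr_inj {x y x' y' : M} : pr x y = pr x' y' ↔ x = x' ∧ y = y' := by
  constructor
  · intro h
    rcases lt_trichotomy (x+y) (x'+y') with h1 | h1 | h1
    · exact absurd h (ne_of_lt (pr_lt_of_add_lt h1))
    · have h2 : x = x' := by
        unfold pr at h; rw [h1] at h
        exact add_left_cancel h
      subst h2
      exact ⟨rfl, add_left_cancel h1⟩
    · exact absurd h.symm (ne_of_lt (pr_lt_of_add_lt h1))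
  · rintro ⟨rfl, rfl⟩; rfl

open Classical in
/-- First projection of the pairing function. -/
noncomputable def fs (z : M) : M := if h : ∃ x y, z = pr x y then h.choose else 0
open Classical in
/-- Second projection of the pairing function. -/
noncomputable def sn (z : M) : M := if h : ∃ x y, z = pr x y then h.choose_spec.choose else 0

@[simp] theorem fs_pr (x y : M) : fs (pr x y) = x := by
  unfold fs
  have h : ∃ x' y' : M, pr x y = pr x' y' := ⟨x, y, rfl⟩
  rw [dif_pos h]
  exact (pr_inj.1 h.choose_spec.choose_spec).1.symm

@[simp] theorem sn_pr (x y : M) : sn (pr x y) = y := by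
  unfold sn
  have h : ∃ x' y' : M, pr x y = pr x' y' := ⟨x, y, rfl⟩
  rw [dif_pos h]
  exact (pr_inj.1 h.choose_spec.choose_spec).2.symm

theorem fs_le (z : M) : fs z ≤ z := by
  by_cases h : ∃ x y, z = pr x y
  · obtain ⟨x, y, rfl⟩ := h; simpa using left_le_pr x y
  · unfold fs; rw [dif_neg h]; exact zero_le

theorem sn_le (z : M) : sn z ≤ z := by
  by_cases h : ∃ x y, z = pr x y
  · obtain ⟨x, y, rfl⟩ := h; simpa using right_le_pr x y
  · unfold sn; rw [dif_neg h]; exact zero_le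

theorem fs_graph (z x : M) : fs z = x ↔
    (∃ y < z + 1, z = pr x y) ∨ (x = 0 ∧ ∀ x' < z + 1, ∀ y < z + 1, ¬ z = pr x' y) := by
  by_cases h : ∃ x y, z = pr x y
  · obtain ⟨x', y, rfl⟩ := h
    rw [fs_pr]
    constructor
    · rintro rfl
      exact Or.inl ⟨y, lt_succ.2 (right_le_pr _ _), rfl⟩
    · rintro (⟨y', -, hy⟩ | ⟨-, h⟩)
      · exact (pr_inj.1 hy).1
      · exact absurd rfl (h x' (lt_succ.2 (left_le_pr _ _)) y (lt_succ.2 (right_le_pr _ _)))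
  · have h0 : fs z = 0 := by unfold fs; rw [dif_neg h]
    push Not at h
    rw [h0]
    constructor
    · rintro rfl
      exact Or.inr ⟨rfl, fun x' _ y _ => h x' y⟩
    · rintro (⟨y', -, hy⟩ | ⟨h, -⟩)
      · exact absurd hy (h _ _)
      · exact h.symm

theorem sn_graph (z x : M) : sn z = x ↔
    (∃ y < z + 1, z = pr y x) ∨ (x = 0 ∧ ∀ x' < z + 1, ∀ y < z + 1, ¬ z = pr x' y) := by
  by_cases h : ∃ x y, z = pr x y
  · obtain ⟨x', y, rfl⟩ := h
    rw [sn_pr]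
    constructor
    · rintro rfl
      exact Or.inl ⟨x', lt_succ.2 (left_le_pr _ _), rfl⟩
    · rintro (⟨y', -, hy⟩ | ⟨-, h⟩)
      · exact (pr_inj.1 hy).2
      · exact absurd rfl (h x' (lt_succ.2 (left_le_pr _ _)) y (lt_succ.2 (right_le_pr _ _)))
  · have h0 : sn z = 0 := by unfold sn; rw [dif_neg h]
    push Not at h
    rw [h0]
    constructor
    · rintro rfl
      exact Or.inr ⟨rfl, fun x' _ y _ => h x' y⟩
    · rintro (⟨y', -, hy⟩ | ⟨h, -⟩)
      · exact absurd hy (h _ _)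
      · exact h.symm

end Arith

/-- Prepend an element to a valuation. -/
def vc {M : Type} (m : M) (v : ℕ → M) : ℕ → M
  | 0 => m
  | k + 1 => v k

/-- Drop the first element of a valuation. -/
def tl {M : Type} (v : ℕ → M) : ℕ → M := fun i => v (i + 1)

@[simp] theorem vc_zero {M : Type} (m : M) (v : ℕ → M) : vc m v 0 = m := rfl
@[simp] theorem vc_succ {M : Type} (m : M) (v : ℕ → M) (k : ℕ) : vc m v (k + 1) = v k := rfl
@[simp] theorem vc_one {M : Type} (m : M) (v : ℕ → M) : vc m v 1 = v 0 := rfl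
@[simp] theorem vc_two {M : Type} (m : M) (v : ℕ → M) : vc m v 2 = v 1 := rfl
@[simp] theorem vc_three {M : Type} (m : M) (v : ℕ → M) : vc m v 3 = v 2 := rfl
@[simp] theorem tl_vc {M : Type} (m : M) (v : ℕ → M) : tl (vc m v) = v := rfl
@[simp] theorem vc_head_tl {M : Type} (v : ℕ → M) : vc (v 0) (tl v) = v := by
  funext i; cases i <;> rfl

/-- An abstract class of `Σ₁`-like relations over `M`, with the amount of collection enjoyed by
the `Σ₁` relations of a model of `BΣ₂`. -/
structure SClass (M : Type) [Arith M] where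
  mem : ((ℕ → M) → Prop) → Prop
  sub : ∀ {Q} (ρ : ℕ → ℕ ⊕ M), mem Q → mem fun v => Q fun i => Sum.elim v id (ρ i)
  add_mem : mem fun v => v 0 + v 1 = v 2
  mul_mem : mem fun v => v 0 * v 1 = v 2
  lt_mem : mem fun v => v 0 < v 1
  and_mem : ∀ {P Q}, mem P → mem Q → mem fun v => P v ∧ Q v
  or_mem : ∀ {P Q}, mem P → mem Q → mem fun v => P v ∨ Q v
  ex_mem : ∀ {Q}, mem Q → mem fun v => ∃ m, Q (vc m v)
  ball_mem : ∀ {Q}, mem Q → mem fun v => ∀ m, m < v 0 → Q (vc m v)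
  nf : ∀ {Q}, mem Q → ∃ R, mem R ∧ mem (fun v => ¬ R v) ∧ ∀ v, Q v ↔ ∃ m, R (vc m v)
  lnp : ∀ {R}, mem R → mem (fun v => ¬ R v) → ∀ v m, R (vc m v) →
    ∃ m, R (vc m v) ∧ ∀ k < m, ¬ R (vc k v)
  b2 : ∀ {Q}, mem Q → ∀ v a, (∀ i < a, ∃ b, ¬ Q (vc b (vc i v))) →
    ∃ B, ∀ i < a, ∃ b < B, ¬ Q (vc b (vc i v))

section
variable {M : Type} [Arith M]

class Sig (C : SClass M) (P : (ℕ → M) → Prop) : Prop where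
  out : C.mem P

class Rec (C : SClass M) (P : (ℕ → M) → Prop) : Prop where
  pos : C.mem P
  neg : C.mem fun v => ¬ P v

class Fn (C : SClass M) (f : (ℕ → M) → M) : Prop where
  out : C.mem fun v => f (tl v) = v 0

/-- Maps between valuations that only rearrange variables. -/
class VMap (h : (ℕ → M) → (ℕ → M)) : Prop where
  out : ∃ ρ : ℕ → ℕ ⊕ M, ∀ v i, h v i = Sum.elim v id (ρ i)

class Fn1 (C : SClass M) (f : M → M) : Prop where
  out : Fn C fun v => f (v 0)
class Fn2 (C : SClass M) (f : M → M → M) : Prop where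
  out : Fn C fun v => f (v 0) (v 1)
class Sig1 (C : SClass M) (P : M → Prop) : Prop where
  out : Sig C fun v => P (v 0)
class Sig2 (C : SClass M) (P : M → M → Prop) : Prop where
  out : Sig C fun v => P (v 0) (v 1)
class Sig3 (C : SClass M) (P : M → M → M → Prop) : Prop where
  out : Sig C fun v => P (v 0) (v 1) (v 2)
class Rec1 (C : SClass M) (P : M → Prop) : Prop where
  out : Rec C fun v => P (v 0)
class Rec2 (C : SClass M) (P : M → M → Prop) : Prop where
  out : Rec C fun v => P (v 0) (v 1)
class Rec3 (C : SClass M) (P : M → M → M → Prop) : Prop where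
  out : Rec C fun v => P (v 0) (v 1) (v 2)

variable {C : SClass M}

theorem SClass.mem_congr {P Q : (ℕ → M) → Prop} (h : C.mem P) (e : ∀ v, P v ↔ Q v) : C.mem Q := by
  have : P = Q := funext fun v => propext (e v)
  exact this ▸ h

theorem Sig.congr {P Q : (ℕ → M) → Prop} (h : Sig C P) (e : ∀ v, P v ↔ Q v) : Sig C Q :=
  ⟨SClass.mem_congr h.out e⟩

theorem Rec.congr {P Q : (ℕ → M) → Prop} (h : Rec C P) (e : ∀ v, P v ↔ Q v) : Rec C Q :=
  ⟨SClass.mem_congr h.pos e, SClass.mem_congr h.neg fun v => not_congr (e v)⟩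

theorem Rec.mk' {P : (ℕ → M) → Prop} (h : Sig C P) (h' : Sig C fun v => ¬ P v) : Rec C P :=
  ⟨h.out, h'.out⟩

/-! Maps of valuations. -/
instance VMap.id' : VMap (fun v : ℕ → M => v) := ⟨Sum.inl, fun _ _ => rfl⟩

theorem VMap.vc_aux {g : (ℕ → M) → M} {h : (ℕ → M) → (ℕ → M)} (r : ℕ ⊕ M)
    (hg : ∀ v, g v = Sum.elim v id r) (hh : VMap h) : VMap fun v => vc (g v) (h v) := by
  obtain ⟨ρ, hρ⟩ := hh.out
  refine ⟨fun i => Nat.casesOn i r ρ, fun v i => ?_⟩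
  cases i with
  | zero => exact hg v
  | succ k => exact hρ v k

instance VMap.tl' {h : (ℕ → M) → (ℕ → M)} [hh : VMap h] : VMap fun v => tl (h v) := by
  obtain ⟨ρ, hρ⟩ := hh.out
  exact ⟨fun i => ρ (i + 1), fun v i => hρ v (i + 1)⟩

instance VMap.tl0 : VMap (tl : (ℕ → M) → (ℕ → M)) := ⟨fun i => Sum.inl (i + 1), fun _ _ => rfl⟩

instance (priority := 60) VMap.comp_tl {h : (ℕ → M) → (ℕ → M)} [hh : VMap h] :
    VMap fun v => h (tl v) := by
  obtain ⟨ρ, hρ⟩ := hh.out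
  refine ⟨fun i => (ρ i).elim (fun k => Sum.inl (k + 1)) Sum.inr, fun v i => ?_⟩
  rw [hρ]
  cases h' : ρ i <;> simp [h', tl]

instance (priority := 90) VMap.const (w : ℕ → M) : VMap fun _ => w :=
  ⟨fun i => Sum.inr (w i), fun _ _ => rfl⟩

instance VMap.vc_const {h : (ℕ → M) → (ℕ → M)} [hh : VMap h] (a : M) :
    VMap fun v => vc a (h v) := VMap.vc_aux (Sum.inr a) (fun _ => rfl) hh

instance VMap.vc_var {h g : (ℕ → M) → (ℕ → M)} [hh : VMap h] [hg : VMap g] (i : ℕ) :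
    VMap fun v => vc (g v i) (h v) := by
  obtain ⟨ρ, hρ⟩ := hg.out
  exact VMap.vc_aux (ρ i) (fun v => hρ v i) hh

theorem SClass.comp {P : (ℕ → M) → Prop} (hP : C.mem P) (h : (ℕ → M) → (ℕ → M)) [hh : VMap h] :
    C.mem fun v => P (h v) := by
  obtain ⟨ρ, hρ⟩ := hh.out
  refine SClass.mem_congr (C.sub ρ hP) fun v => ?_
  have : h v = fun i => Sum.elim v id (ρ i) := funext (hρ v)
  rw [this]

instance (priority := 50) Sig.comp {P : (ℕ → M) → Prop} {h : (ℕ → M) → (ℕ → M)} [hP : Sig C P]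
    [VMap h] : Sig C fun v => P (h v) := ⟨SClass.comp hP.out h⟩
instance (priority := 50) Rec.comp {P : (ℕ → M) → Prop} {h : (ℕ → M) → (ℕ → M)} [hP : Rec C P]
    [VMap h] : Rec C fun v => P (h v) := ⟨SClass.comp hP.pos h, SClass.comp hP.neg h⟩
instance (priority := 50) Fn.comp {f : (ℕ → M) → M} {h : (ℕ → M) → (ℕ → M)} [hf : Fn C f]
    [VMap h] : Fn C fun v => f (h v) := by
  constructor
  exact SClass.mem_congr (SClass.comp hf.out fun v => vc (v 0) (h (tl v))) fun v => Iff.rfl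

/-! Connectives. -/
instance Sig.and {P Q : (ℕ → M) → Prop} [hP : Sig C P] [hQ : Sig C Q] :
    Sig C fun v => P v ∧ Q v := ⟨C.and_mem hP.out hQ.out⟩
instance Sig.or {P Q : (ℕ → M) → Prop} [hP : Sig C P] [hQ : Sig C Q] :
    Sig C fun v => P v ∨ Q v := ⟨C.or_mem hP.out hQ.out⟩
instance Sig.ex {P : (ℕ → M) → M → Prop} [hP : Sig C fun v => P (tl v) (v 0)] :
    Sig C fun v => ∃ m, P v m :=
  ⟨SClass.mem_congr (C.ex_mem hP.out) fun v => by simp⟩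
instance (priority := 80) Rec.toSig {P : (ℕ → M) → Prop} [hP : Rec C P] : Sig C P := ⟨hP.pos⟩
instance (priority := 200) Rec.toSig_not {P : (ℕ → M) → Prop} [hP : Rec C P] :
    Sig C fun v => ¬ P v := ⟨hP.neg⟩
instance Sig.imp {P Q : (ℕ → M) → Prop} [hP : Rec C P] [hQ : Sig C Q] :
    Sig C fun v => P v → Q v :=
  Sig.congr (P := fun v => ¬ P v ∨ Q v) inferInstance fun v => by tauto

instance Rec.and {P Q : (ℕ → M) → Prop} [hP : Rec C P] [hQ : Rec C Q] :
    Rec C fun v => P v ∧ Q v :=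
  Rec.mk' inferInstance
    (Sig.congr (P := fun v => ¬ P v ∨ ¬ Q v) inferInstance fun v => by tauto)
instance Rec.not {P : (ℕ → M) → Prop} [hP : Rec C P] : Rec C fun v => ¬ P v :=
  Rec.mk' inferInstance (Sig.congr (P := P) inferInstance fun v => by tauto)
instance Rec.or {P Q : (ℕ → M) → Prop} [hP : Rec C P] [hQ : Rec C Q] :
    Rec C fun v => P v ∨ Q v :=
  Rec.congr (P := fun v => ¬ (¬ P v ∧ ¬ Q v)) inferInstance fun v => by tauto
instance Rec.imp {P Q : (ℕ → M) → Prop} [hP : Rec C P] [hQ : Rec C Q] :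
    Rec C fun v => P v → Q v :=
  Rec.congr (P := fun v => ¬ P v ∨ Q v) inferInstance fun v => by tauto
instance Rec.iff {P Q : (ℕ → M) → Prop} [hP : Rec C P] [hQ : Rec C Q] :
    Rec C fun v => P v ↔ Q v :=
  Rec.congr (P := fun v => (P v → Q v) ∧ (Q v → P v)) inferInstance fun v => by tauto

/-! Functions. -/
theorem Sig.subst {P : M → (ℕ → M) → Prop} {g : (ℕ → M) → M}
    (hP : Sig C fun v => P (v 0) (tl v)) (hg : Fn C g) : Sig C fun v => P (g v) v := by
  have h1 : Sig C fun v => g (tl v) = v 0 := ⟨hg.out⟩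
  exact Sig.congr (P := fun v => ∃ m, g v = m ∧ P m v) inferInstance fun v => by simp

theorem Rec.subst {P : M → (ℕ → M) → Prop} {g : (ℕ → M) → M}
    (hP : Rec C fun v => P (v 0) (tl v)) (hg : Fn C g) : Rec C fun v => P (g v) v :=
  Rec.mk' (Sig.subst inferInstance hg)
    (Sig.subst (P := fun m v => ¬ P m v) inferInstance hg)

theorem Sig.eq0 : Sig C fun v : ℕ → M => v 0 = v 1 := by
  refine ⟨SClass.mem_congr (SClass.comp C.add_mem fun v => vc (v 0) (vc 0 (vc (v 1) v)))
    fun v => by simp⟩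

instance (priority := 200) Fn.var {h : (ℕ → M) → (ℕ → M)} [hh : VMap h] (i : ℕ) :
    Fn C fun v => h v i := by
  constructor
  exact SClass.mem_congr (SClass.comp Sig.eq0.out fun v => vc (h (tl v) i) (vc (v 0) v))
    fun v => by simp

instance (priority := 300) Fn.const (a : M) : Fn C fun _ => a := by
  constructor
  exact SClass.mem_congr (SClass.comp Sig.eq0.out fun v => vc a (vc (v 0) v)) fun v => by simp

theorem Sig.subst2 {P : M → M → Prop} {f g : (ℕ → M) → M}
    (hP : Sig C fun v => P (v 0) (v 1)) (hf : Fn C f) (hg : Fn C g) :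
    Sig C fun v => P (f v) (g v) := by
  refine Sig.subst (P := fun m v => P m (g v)) ?_ hf
  refine Sig.subst (P := fun m v => P (v 0) m) (g := fun v => g (tl v)) ?_ inferInstance
  exact ⟨SClass.comp hP.out fun v => vc (tl v 0) v⟩

theorem Rec.subst2 {P : M → M → Prop} {f g : (ℕ → M) → M}
    (hP : Rec C fun v => P (v 0) (v 1)) (hf : Fn C f) (hg : Fn C g) :
    Rec C fun v => P (f v) (g v) := by
  refine Rec.mk' (Sig.subst2 inferInstance hf hg)
    (Sig.subst2 (P := fun x y => ¬ P x y) inferInstance hf hg)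

theorem Sig.subst3 {P : M → M → M → Prop} {f g k : (ℕ → M) → M}
    (hP : Sig C fun v => P (v 0) (v 1) (v 2)) (hf : Fn C f) (hg : Fn C g) (hk : Fn C k) :
    Sig C fun v => P (f v) (g v) (k v) := by
  refine Sig.subst (P := fun m v => P m (g v) (k v)) ?_ hf
  refine Sig.subst (P := fun m v => P (v 0) m (k (tl v))) (g := fun v => g (tl v)) ?_ inferInstance
  refine Sig.subst (P := fun m v => P (v 1) (v 0) m) (g := fun v => k (tl (tl v))) ?_ inferInstance
  exact ⟨SClass.comp hP.out fun v => vc (tl v 1) (vc (tl v 0) (vc (v 0) v))⟩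

theorem Rec.subst3 {P : M → M → M → Prop} {f g k : (ℕ → M) → M}
    (hP : Rec C fun v => P (v 0) (v 1) (v 2)) (hf : Fn C f) (hg : Fn C g) (hk : Fn C k) :
    Rec C fun v => P (f v) (g v) (k v) := by
  refine Rec.mk' (Sig.subst3 inferInstance hf hg hk)
    (Sig.subst3 (P := fun x y z => ¬ P x y z) inferInstance hf hg hk)

instance (priority := 40) Sig.app1 {P : M → Prop} {f : (ℕ → M) → M} [hP : Sig1 C P] [hf : Fn C f] :
    Sig C fun v => P (f v) :=
  Sig.subst (P := fun m _ => P m) hP.out hf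
instance (priority := 40) Rec.app1 {P : M → Prop} {f : (ℕ → M) → M} [hP : Rec1 C P] [hf : Fn C f] :
    Rec C fun v => P (f v) :=
  Rec.subst (P := fun m _ => P m) hP.out hf
instance (priority := 40) Sig.app2 {P : M → M → Prop} {f g : (ℕ → M) → M} [hP : Sig2 C P]
    [hf : Fn C f] [hg : Fn C g] : Sig C fun v => P (f v) (g v) := Sig.subst2 hP.out hf hg
instance (priority := 40) Rec.app2 {P : M → M → Prop} {f g : (ℕ → M) → M} [hP : Rec2 C P]
    [hf : Fn C f] [hg : Fn C g] : Rec C fun v => P (f v) (g v) := Rec.subst2 hP.out hf hg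
instance (priority := 40) Sig.app3 {P : M → M → M → Prop} {f g k : (ℕ → M) → M} [hP : Sig3 C P]
    [hf : Fn C f] [hg : Fn C g] [hk : Fn C k] : Sig C fun v => P (f v) (g v) (k v) :=
  Sig.subst3 hP.out hf hg hk
instance (priority := 40) Rec.app3 {P : M → M → M → Prop} {f g k : (ℕ → M) → M} [hP : Rec3 C P]
    [hf : Fn C f] [hg : Fn C g] [hk : Fn C k] : Rec C fun v => P (f v) (g v) (k v) :=
  Rec.subst3 hP.out hf hg hk

instance (priority := 40) Fn.app1 {F : M → M} {f : (ℕ → M) → M} [hF : Fn1 C F] [hf : Fn C f] :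
    Fn C fun v => F (f v) := by
  have h := hF.out.out
  have h1 : Sig2 C fun x y => F x = y :=
    ⟨⟨SClass.mem_congr (SClass.comp h fun v => vc (v 1) (vc (v 0) v)) fun v => by simp [tl]⟩⟩
  constructor
  exact (Sig.subst2 (P := fun x y => F x = y) h1.out (inferInstance : Fn C fun v => f (tl v))
    (inferInstance : Fn C fun v => v 0)).out

instance (priority := 40) Fn.app2 {F : M → M → M} {f g : (ℕ → M) → M} [hF : Fn2 C F]
    [hf : Fn C f] [hg : Fn C g] : Fn C fun v => F (f v) (g v) := by
  have h := hF.out.out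
  have h1 : Sig3 C fun x y z => F x y = z :=
    ⟨⟨SClass.mem_congr (SClass.comp h fun v => vc (v 2) (vc (v 0) (vc (v 1) v)))
      fun v => by simp [tl]⟩⟩
  constructor
  exact (Sig.subst3 (P := fun x y z => F x y = z) h1.out (inferInstance : Fn C fun v => f (tl v))
    (inferInstance : Fn C fun v => g (tl v)) (inferInstance : Fn C fun v => v 0)).out

/-! Atoms. -/
instance Sig.lt {f g : (ℕ → M) → M} [hf : Fn C f] [hg : Fn C g] : Sig C fun v => f v < g v :=
  Sig.subst2 (P := fun x y => x < y) ⟨C.lt_mem⟩ hf hg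

instance Rec.eq {f g : (ℕ → M) → M} [hf : Fn C f] [hg : Fn C g] : Rec C fun v => f v = g v := by
  refine Rec.mk' (Sig.subst2 (P := fun x y => x = y) Sig.eq0 hf hg) ?_
  exact Sig.congr (P := fun v => f v < g v ∨ g v < f v) inferInstance
    fun v => ⟨fun h => h.elim ne_of_lt fun h => (ne_of_lt h).symm, lt_or_gt_of_ne⟩
instance Rec.ne {f g : (ℕ → M) → M} [hf : Fn C f] [hg : Fn C g] : Rec C fun v => f v ≠ g v :=
  Rec.not (P := fun v => f v = g v)
instance Rec.lt {f g : (ℕ → M) → M} [hf : Fn C f] [hg : Fn C g] : Rec C fun v => f v < g v := by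
  refine Rec.mk' inferInstance ?_
  exact Sig.congr (P := fun v => g v < f v ∨ f v = g v) inferInstance
    fun v => by rw [not_lt, le_iff_lt_or_eq, eq_comm]
instance Rec.le {f g : (ℕ → M) → M} [hf : Fn C f] [hg : Fn C g] : Rec C fun v => f v ≤ g v :=
  Rec.congr (P := fun v => ¬ g v < f v) inferInstance fun v => not_lt
instance (priority := 300) Rec.prop (p : Prop) : Rec C fun _ : ℕ → M => p := by
  by_cases h : p
  · exact Rec.congr (P := fun _ => (0 : M) = 0) inferInstance fun v => by simp [h]
  · exact Rec.congr (P := fun _ => (0 : M) ≠ 0) inferInstance fun v => by simp [h]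

instance Fn.add {f g : (ℕ → M) → M} [hf : Fn C f] [hg : Fn C g] : Fn C fun v => f v + g v :=
  ⟨(Sig.subst3 (P := fun x y z => x + y = z) ⟨C.add_mem⟩
    (inferInstance : Fn C fun v => f (tl v)) (inferInstance : Fn C fun v => g (tl v))
    (inferInstance : Fn C fun v => v 0)).out⟩
instance Fn.mul {f g : (ℕ → M) → M} [hf : Fn C f] [hg : Fn C g] : Fn C fun v => f v * g v :=
  ⟨(Sig.subst3 (P := fun x y z => x * y = z) ⟨C.mul_mem⟩
    (inferInstance : Fn C fun v => f (tl v)) (inferInstance : Fn C fun v => g (tl v))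
    (inferInstance : Fn C fun v => v 0)).out⟩
instance Fn.pr {f g : (ℕ → M) → M} [hf : Fn C f] [hg : Fn C g] : Fn C fun v => pr (f v) (g v) := by
  unfold PaperArith.pr; infer_instance

/-! Bounded quantifiers. -/
instance Sig.ball {t : (ℕ → M) → M} {P : (ℕ → M) → M → Prop} [ht : Fn C t]
    [hP : Sig C fun v => P (tl v) (v 0)] : Sig C fun v => ∀ m, m < t v → P v m := by
  refine Sig.subst (P := fun b v => ∀ m, m < b → P v m) ?_ ht
  have h1 : Sig C fun v => P (tl (tl v)) (v 0) :=
    ⟨SClass.comp hP.out fun v => vc (v 0) (tl (tl v))⟩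
  exact ⟨SClass.mem_congr (C.ball_mem h1.out) fun v => by simp⟩
instance Rec.ball {t : (ℕ → M) → M} {P : (ℕ → M) → M → Prop} [ht : Fn C t]
    [hP : Rec C fun v => P (tl v) (v 0)] : Rec C fun v => ∀ m, m < t v → P v m :=
  Rec.mk' inferInstance (Sig.congr (P := fun v => ∃ m, m < t v ∧ ¬ P v m) inferInstance
    fun v => by push Not; rfl)
instance Rec.bex {t : (ℕ → M) → M} {P : (ℕ → M) → M → Prop} [ht : Fn C t]
    [hP : Rec C fun v => P (tl v) (v 0)] : Rec C fun v => ∃ m, m < t v ∧ P v m :=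
  Rec.congr (P := fun v => ¬ ∀ m, m < t v → ¬ P v m) inferInstance fun v => by push Not; rfl
instance Sig.ball_le {t : (ℕ → M) → M} {P : (ℕ → M) → M → Prop} [ht : Fn C t]
    [hP : Sig C fun v => P (tl v) (v 0)] : Sig C fun v => ∀ m, m ≤ t v → P v m :=
  Sig.congr (P := fun v => ∀ m, m < t v + 1 → P v m) inferInstance fun v => by simp only [lt_succ]
instance Rec.ball_le {t : (ℕ → M) → M} {P : (ℕ → M) → M → Prop} [ht : Fn C t]
    [hP : Rec C fun v => P (tl v) (v 0)] : Rec C fun v => ∀ m, m ≤ t v → P v m :=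
  Rec.congr (P := fun v => ∀ m, m < t v + 1 → P v m) inferInstance fun v => by simp only [lt_succ]
instance Rec.bex_le {t : (ℕ → M) → M} {P : (ℕ → M) → M → Prop} [ht : Fn C t]
    [hP : Rec C fun v => P (tl v) (v 0)] : Rec C fun v => ∃ m, m ≤ t v ∧ P v m :=
  Rec.congr (P := fun v => ∃ m, m < t v + 1 ∧ P v m) inferInstance fun v => by simp only [lt_succ]

instance Fn.fs {f : (ℕ → M) → M} [hf : Fn C f] : Fn C fun v => fs (f v) :=
  ⟨(Sig.congr (P := fun v => (∃ y < f (tl v) + 1, f (tl v) = PaperArith.pr (v 0) y) ∨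
    (v 0 = 0 ∧ ∀ x' < f (tl v) + 1, ∀ y < f (tl v) + 1, ¬ f (tl v) = PaperArith.pr x' y))
    inferInstance fun v => (fs_graph _ _).symm).out⟩
instance Fn.sn {f : (ℕ → M) → M} [hf : Fn C f] : Fn C fun v => sn (f v) :=
  ⟨(Sig.congr (P := fun v => (∃ y < f (tl v) + 1, f (tl v) = PaperArith.pr y (v 0)) ∨
    (v 0 = 0 ∧ ∀ x' < f (tl v) + 1, ∀ y < f (tl v) + 1, ¬ f (tl v) = PaperArith.pr x' y))
    inferInstance fun v => (sn_graph _ _).symm).out⟩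

end

section
variable {M : Type} [Arith M] (C : SClass M)

theorem exists_least {P : M → Prop} [hP : Rec C fun v => P (v 0)] {m : M} (h : P m) :
    ∃ m, P m ∧ ∀ k < m, ¬ P k :=
  C.lnp hP.pos hP.neg (fun _ => 0) m h

theorem rec_induction {P : M → Prop} [hP : Rec C fun v => P (v 0)] (h0 : P 0)
    (hs : ∀ m, P m → P (m + 1)) (m : M) : P m := by
  by_contra hm
  obtain ⟨k, hk, hl⟩ := exists_least C (P := fun m => ¬ P m) hm
  rcases eq_zero_or_succ k with rfl | ⟨j, rfl⟩
  · exact hk h0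
  · exact hk (hs j (not_not.1 (hl j (lt_add_one j))))

theorem pi_collection {Q : M → M → Prop} [hQ : Sig C fun v => Q (v 0) (v 1)] {a : M}
    (h : ∀ i < a, ∃ b, ¬ Q i b) : ∃ B, ∀ i < a, ∃ b < B, ¬ Q i b := by
  have h1 : C.mem fun v => Q (v 1) (v 0) := SClass.comp hQ.out fun v => vc (v 1) (vc (v 0) v)
  exact C.b2 h1 (fun _ => 0) a h

theorem sig_nf {P : M → M → Prop} [hP : Sig C fun v => P (v 0) (v 1)] :
    ∃ R : M → M → M → Prop, Rec3 C R ∧ ∀ x y, P x y ↔ ∃ w, R x y w := by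
  obtain ⟨R, h1, h2, h3⟩ := C.nf hP.out
  have hR : Rec C R := ⟨h1, h2⟩
  refine ⟨fun x y w => R (vc w (vc x (vc y fun _ => 0))), ⟨?_⟩, ?_⟩
  · exact Rec.comp (h := fun v => vc (v 2) (vc (v 0) (vc (v 1) fun _ => 0)))
  · intro x y
    exact h3 (vc x (vc y fun _ => 0))

theorem sig_nf1 {P : M → Prop} [hP : Sig C fun v => P (v 0)] :
    ∃ R : M → M → Prop, Rec2 C R ∧ ∀ x, P x ↔ ∃ w, R x w := by
  obtain ⟨R, h1, h2⟩ := sig_nf C (P := fun x y => P x)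
  exact ⟨fun x w => R x 0 w, ⟨inferInstance⟩, fun x => h2 x 0⟩

theorem strong_collection {P : M → M → Prop} [hP : Sig C fun v => P (v 0) (v 1)] (a : M) :
    ∃ B, ∀ i < a, (∃ b, P i b) → ∃ b < B, P i b := by
  obtain ⟨R, hR, h⟩ := sig_nf C (P := P)
  obtain ⟨B, hB⟩ := pi_collection C (a := a)
    (Q := fun i w => (∃ y m, R i y m) ∧ ¬ ∃ y ≤ w, ∃ m ≤ w, R i y m) (by
      intro i hi
      by_cases hc : ∃ y m, R i y m
      · obtain ⟨y, m, hm⟩ := hc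
        refine ⟨max y m, fun hn => hn.2 ⟨y, le_max_left _ _, m, le_max_right _ _, hm⟩⟩
      · exact ⟨0, fun hn => hc hn.1⟩)
  refine ⟨B, fun i hi ⟨b, hb⟩ => ?_⟩
  obtain ⟨w, hw, hn⟩ := hB i hi
  have h1 : ∃ y m, R i y m := ⟨b, (h i b).1 hb⟩
  have h2 : ∃ y ≤ w, ∃ m ≤ w, R i y m := by
    by_contra h3; exact hn ⟨h1, h3⟩
  obtain ⟨y, hy, m, hm, hr⟩ := h2
  exact ⟨y, lt_of_le_of_lt hy hw, (h i y).2 ⟨m, hr⟩⟩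

theorem sig_collection {P : M → M → Prop} [hP : Sig C fun v => P (v 0) (v 1)] {a : M}
    (h : ∀ i < a, ∃ b, P i b) : ∃ B, ∀ i < a, ∃ b < B, P i b := by
  obtain ⟨B, hB⟩ := strong_collection C (P := P) a
  exact ⟨B, fun i hi => hB i hi (h i hi)⟩

theorem bounded_rec {P : M → Prop} [hP : Sig C fun v => P (v 0)] (a : M) :
    ∃ P' : M → Prop, Rec1 C P' ∧ ∀ i < a, P i ↔ P' i := by
  obtain ⟨R, hR, h⟩ := sig_nf1 C (P := P)
  obtain ⟨B, hB⟩ := strong_collection C (P := R) a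
  refine ⟨fun i => ∃ w < B, R i w, ⟨inferInstance⟩, fun i hi => ?_⟩
  rw [h]
  exact ⟨fun hx => hB i hi hx, fun ⟨w, _, hw⟩ => ⟨w, hw⟩⟩

theorem sig_induction {P : M → Prop} [hP : Sig C fun v => P (v 0)] (h0 : P 0)
    (hs : ∀ m, P m → P (m + 1)) (m : M) : P m := by
  obtain ⟨P', hP', h⟩ := bounded_rec C (P := P) (m + 1)
  have : ∀ k, k ≤ m → P' k := by
    refine rec_induction C (P := fun k => k ≤ m → P' k) ?_ ?_
    · intro _; exact (h 0 (lt_succ.2 zero_le)).1 h0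
    · intro k hk hkm
      have hk' : k ≤ m := le_trans le_self_add hkm
      exact (h _ (lt_succ.2 hkm)).1 (hs k ((h k (lt_succ.2 hk')).2 (hk hk')))
  exact (h m (lt_add_one m)).2 (this m le_rfl)

theorem sig_least {P : M → Prop} [hP : Sig C fun v => P (v 0)] {m : M} (h : P m) :
    ∃ m, P m ∧ ∀ k < m, ¬ P k := by
  obtain ⟨P', hP', h'⟩ := bounded_rec C (P := P) (m + 1)
  obtain ⟨k, hk, hl⟩ := exists_least C (P := P') ((h' m (lt_add_one m)).1 h)
  have hkm : k ≤ m := by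
    by_contra hc
    exact hl m (not_le.1 hc) ((h' m (lt_add_one m)).1 h)
  exact ⟨k, (h' k (lt_succ.2 hkm)).2 hk, fun j hj hn =>
    hl j hj ((h' j (lt_trans hj (lt_succ.2 hkm))).1 hn)⟩

theorem sig_select {P : M → M → Prop} [hP : Sig C fun v => P (v 0) (v 1)]
    (h : ∀ x, ∃ y, P x y) : ∃ f : M → M, Fn1 C f ∧ ∀ x, P x (f x) := by
  obtain ⟨R, hR, h'⟩ := sig_nf C (P := P)
  have hT : ∀ x, ∃ w, R x (fs w) (sn w) ∧ ∀ k < w, ¬ R x (fs k) (sn k) := by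
    intro x
    obtain ⟨y, hy⟩ := h x
    obtain ⟨m, hm⟩ := (h' x y).1 hy
    exact exists_least C (P := fun w => R x (fs w) (sn w)) (m := pr y m) (by simpa using hm)
  choose w hw1 hw2 using hT
  have hwf : Fn1 C w := by
    constructor
    constructor
    have : Sig C fun v => R (v 1) (fs (v 0)) (sn (v 0)) ∧
      ∀ k < v 0, ¬ R (v 1) (fs k) (sn k) := inferInstance
    refine SClass.mem_congr this.out fun v => ?_
    simp only [tl]
    constructor
    · rintro ⟨h1, h2⟩
      rcases lt_trichotomy (w (v 1)) (v 0) with h3 | h3 | h3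
      · exact absurd (hw1 _) (h2 _ h3)
      · exact h3
      · exact absurd h1 (hw2 _ _ h3)
    · intro h3
      rw [← h3]
      exact ⟨hw1 _, hw2 _⟩
  exact ⟨fun x => fs (w x), ⟨inferInstance⟩, fun x => (h' _ _).2 ⟨_, hw1 x⟩⟩

end

section
variable {M : Type} [Arith M]

/-- `a` is invertible modulo `b`. -/
def Cop (a b : M) : Prop := ∃ x y, x * a = 1 + y * b

theorem Cop.symm {a b : M} (ha : 0 < a) (hb : 0 < b) (h : Cop a b) : Cop b a := by
  obtain ⟨x, y, h⟩ := h
  obtain ⟨a', rfl⟩ := (eq_zero_or_succ a).resolve_left ha.ne'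
  obtain ⟨b', rfl⟩ := (eq_zero_or_succ b).resolve_left hb.ne'
  refine ⟨x + (x + y) * a', y + (x + y) * b', ?_⟩
  have h1 : (x + (x + y) * a') * (b' + 1) + y * (b' + 1) = (x + y) * (a' + 1) * (b' + 1) := by ring
  have h2 : 1 + (y + (x + y) * b') * (a' + 1) + x * (a' + 1)
    = 1 + (x + y) * (a' + 1) * (b' + 1) := by ring
  have h3 : (x + (x + y) * a') * (b' + 1) + (1 + y * (b' + 1))
      = 1 + (y + (x + y) * b') * (a' + 1) + x * (a' + 1) := by
    rw [h2, ← h1]; ring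
  rw [h] at h3
  exact add_right_cancel h3

theorem Cop.mul_left {a a' b : M} (h : Cop a b) (h' : Cop a' b) : Cop (a * a') b := by
  obtain ⟨x, y, h⟩ := h
  obtain ⟨x', y', h'⟩ := h'
  refine ⟨x * x', y' + y + y * y' * b, ?_⟩
  calc x * x' * (a * a') = (x * a) * (x' * a') := by ring
    _ = (1 + y * b) * (1 + y' * b) := by rw [h, h']
    _ = _ := by ring

theorem Cop.add_self {a b : M} (h : Cop a b) : Cop (b + a) b := by
  obtain ⟨x, y, h⟩ := h
  refine ⟨x, x + y, ?_⟩
  rw [mul_add, h]; ring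

theorem Cop.of_dvd {a b d : M} (h : Cop a b) (hd : d ∣ b) : Cop a d := by
  obtain ⟨x, y, h⟩ := h
  obtain ⟨k, rfl⟩ := hd
  exact ⟨x, y * k, by rw [h]; ring⟩

theorem dvd_of_dvd_add {d a b : M} (h : d ∣ a + b) (hb : d ∣ b) : d ∣ a := by
  obtain ⟨l, hl⟩ := h
  obtain ⟨k, rfl⟩ := hb
  rcases le_total k l with h | h
  · obtain ⟨c, rfl⟩ := exists_add_of_le h
    refine ⟨c, ?_⟩
    rw [mul_add, add_comm] at hl
    exact add_left_cancel hl
  · have : d * l ≤ d * k := by gcongr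
    have h1 : a + d * k ≤ 0 + d * k := by rw [hl, zero_add]; exact this
    have h2 : a ≤ 0 := le_of_add_le_add_right h1
    have h3 : a = 0 := le_antisymm h2 zero_le
    simp [h3]

theorem Cop.dvd_of_dvd_mul {d a b : M} (h : Cop a d) (hd : d ∣ a * b) : d ∣ b := by
  obtain ⟨x, y, h⟩ := h
  refine dvd_of_dvd_add (b := d * (y * b)) ?_ ⟨_, rfl⟩
  have : b + d * (y * b) = x * (a * b) := by
    calc b + d * (y * b) = (1 + y * d) * b := by ring
      _ = x * (a * b) := by rw [← h]; ring
  rw [this]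
  exact Dvd.dvd.mul_left hd x

theorem le_of_dvd' {d a : M} (h : d ∣ a) (ha : 0 < a) : d ≤ a := by
  obtain ⟨k, rfl⟩ := h
  rcases eq_zero_or_succ k with rfl | ⟨j, rfl⟩
  · simp at ha
  · rw [mul_add, mul_one]; exact le_add_self

theorem dvd_iff_bounded {d a : M} : d ∣ a ↔ ∃ k ≤ a, a = d * k := by
  constructor
  · rintro ⟨k, rfl⟩
    rcases eq_zero_or_succ d with rfl | ⟨j, rfl⟩
    · exact ⟨0, by simp⟩
    · exact ⟨k, by rw [add_mul, one_mul]; exact le_add_self, rfl⟩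
  · rintro ⟨k, -, h⟩; exact ⟨k, h⟩

/-- Moduli for the Chinese remainder coding. -/
def md (v i : M) : M := 1 + (i + 1) * v

theorem md_pos (v i : M) : 0 < md v i := by
  unfold md; exact lt_of_lt_of_le zero_lt_one le_self_add

theorem md_cop_aux {v i d : M} (hd : d + 1 ∣ v) : Cop (md v (i + d + 1)) (md v i) := by
  rcases eq_zero_or_succ v with rfl | ⟨v', hv'⟩
  · exact ⟨1, 0, by simp [md]⟩
  have hv : 0 < v := by rw [hv']; exact lt_of_lt_of_le zero_lt_one le_add_self
  have h1 : Cop (md v i) v := ⟨1, i + 1, by simp [md]⟩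
  have h2 : Cop (md v i) (d + 1) := h1.of_dvd hd
  have h1' := h1.symm (md_pos _ _) hv
  have h2' := h2.symm (md_pos _ _) (lt_of_lt_of_le zero_lt_one le_add_self)
  have h3 := (h2'.mul_left h1').add_self
  have : md v i + (d + 1) * v = md v (i + d + 1) := by unfold md; ring
  rwa [this] at h3

theorem md_cop {v c i j : M} (hv : ∀ k < c, k + 1 ∣ v) (hi : i < c) (hj : j < c) (hij : i ≠ j) :
    Cop (md v i) (md v j) := by
  have key : ∀ i j, j < c → i < j → Cop (md v j) (md v i) := by
    intro i j hj hij
    obtain ⟨d, rfl⟩ := exists_add_of_le (Arith.succ_le hij)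
    have : i + 1 + d = i + d + 1 := by ring
    rw [this] at hj ⊢
    refine md_cop_aux (hv d ?_)
    exact lt_of_le_of_lt (le_trans le_add_self le_self_add) hj
  rcases lt_or_gt_of_ne hij with h | h
  · exact (key i j hj h).symm (md_pos _ _) (md_pos _ _)
  · exact key j i hi h

/-- Membership in the finite set coded by `t`. -/
def mm (i t : M) : Prop := i < fs t ∧ md (sn (sn t)) i ∣ fs (sn t)

theorem mm_lt {i t : M} (h : mm i t) : i < t := lt_of_lt_of_le h.1 (fs_le t)

theorem mm_pr {i c u v : M} : mm i (pr c (pr u v)) ↔ i < c ∧ md v i ∣ u := by simp [mm]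

/-- `v` and `U` allow coding of subsets of the initial segment below `c`. -/
def GoodAt (c v U : M) : Prop :=
  0 < v ∧ 0 < U ∧ (∀ j < c, j + 1 ∣ v) ∧ ∀ i < c, md v i ∣ U

variable (C : SClass M)

instance Rec.dvd {C : SClass M} {f g : (ℕ → M) → M} [Fn C f] [Fn C g] :
    Rec C fun v => f v ∣ g v :=
  Rec.congr (P := fun v => ∃ k ≤ g v, g v = f v * k) inferInstance fun v => dvd_iff_bounded.symm
instance Fn.md {C : SClass M} {f g : (ℕ → M) → M} [Fn C f] [Fn C g] :
    Fn C fun v => md (f v) (g v) := by unfold PaperArith.md; infer_instance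
instance Rec.mm {C : SClass M} {f g : (ℕ → M) → M} [Fn C f] [Fn C g] :
    Rec C fun v => mm (f v) (g v) := by unfold PaperArith.mm; infer_instance
instance Rec.goodAt {C : SClass M} {f g h : (ℕ → M) → M} [Fn C f] [Fn C g] [Fn C h] :
    Rec C fun v => GoodAt (f v) (g v) (h v) := by unfold GoodAt; infer_instance
instance Sig.cop {C : SClass M} {f g : (ℕ → M) → M} [Fn C f] [Fn C g] :
    Sig C fun v => Cop (f v) (g v) := by unfold Cop; infer_instance

theorem exists_goodAt (C : SClass M) (c : M) : ∃ v U, GoodAt c v U := by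
  have h1 : ∃ v, 0 < v ∧ ∀ j < c, j + 1 ∣ v := by
    refine sig_induction C (P := fun c => ∃ v, 0 < v ∧ ∀ j < c, j + 1 ∣ v) ?_ ?_ c
    · exact ⟨1, zero_lt_one, fun j hj => absurd hj (not_lt.2 zero_le)⟩
    · rintro m ⟨v, hv, h⟩
      refine ⟨v * (m + 1), mul_pos hv (lt_of_lt_of_le zero_lt_one le_add_self), fun j hj => ?_⟩
      rcases lt_or_eq_of_le (lt_succ.1 hj) with h' | rfl
      · exact Dvd.dvd.mul_right (h j h') _
      · exact Dvd.intro_left v rfl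
  obtain ⟨v, hv, hd⟩ := h1
  have h2 : ∃ U, 0 < U ∧ ∀ j < c, md v j ∣ U := by
    refine sig_induction C (P := fun c => ∃ U, 0 < U ∧ ∀ j < c, md v j ∣ U) ?_ ?_ c
    · exact ⟨1, zero_lt_one, fun j hj => absurd hj (not_lt.2 zero_le)⟩
    · rintro m ⟨U, hU, h⟩
      refine ⟨U * md v m, mul_pos hU (md_pos _ _), fun j hj => ?_⟩
      rcases lt_or_eq_of_le (lt_succ.1 hj) with h' | rfl
      · exact Dvd.dvd.mul_right (h j h') _
      · exact Dvd.intro_left U rfl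
  obtain ⟨U, hU, hm⟩ := h2
  exact ⟨v, U, hv, hU, hd, hm⟩

theorem code_of_goodAt {c v U : M} (hg : GoodAt c v U) {P : M → Prop}
    [hP : Rec C fun v => P (v 0)] : ∃ u ≤ U, ∀ i < c, md v i ∣ u ↔ P i := by
  obtain ⟨hv, hU, hd, hm⟩ := hg
  have hP1 : Rec1 C P := ⟨hP⟩
  have key : ∀ k, k ≤ c → ∃ u, u ∣ U ∧ (∀ i < c, md v i ∣ u ↔ (i < k ∧ P i)) ∧
      ∀ i < c, k ≤ i → Cop u (md v i) := by
    refine sig_induction C (P := fun k => k ≤ c → ∃ u, u ∣ U ∧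
      (∀ i < c, md v i ∣ u ↔ (i < k ∧ P i)) ∧ ∀ i < c, k ≤ i → Cop u (md v i)) ?_ ?_
    · intro _
      refine ⟨1, one_dvd _, fun i hi => ?_, fun i _ _ => ⟨1, 0, by simp⟩⟩
      constructor
      · intro h
        have h1 := le_of_dvd' h zero_lt_one
        have h2 : 1 < md v i := by
          unfold md
          exact lt_add_of_pos_right _ (mul_pos (lt_of_lt_of_le zero_lt_one le_add_self) hv)
        exact absurd h1 (not_le.2 h2)
      · rintro ⟨h, -⟩; exact absurd h (not_lt.2 zero_le)
    · intro k ih hk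
      have hkc : k < c := succ_le_iff'.1 hk
      obtain ⟨u, h1, h2, h3⟩ := ih hkc.le
      by_cases hPk : P k
      · refine ⟨u * md v k, ?_, fun i hi => ?_, fun i hi hki => ?_⟩
        · obtain ⟨q, hq⟩ := h1
          have h4 := hm k hkc
          rw [hq] at h4 ⊢
          exact mul_dvd_mul_left u ((h3 k hkc le_rfl).dvd_of_dvd_mul h4)
        · by_cases hik : i = k
          · subst hik
            exact ⟨fun _ => ⟨lt_add_one _, hPk⟩, fun _ => Dvd.intro_left u rfl⟩
          · constructor
            · intro h
              rw [mul_comm] at h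
              have h5 := (md_cop hd hkc hi (Ne.symm hik)).dvd_of_dvd_mul h
              have h6 := (h2 i hi).1 h5
              exact ⟨lt_trans h6.1 (lt_add_one _), h6.2⟩
            · rintro ⟨h5, h6⟩
              exact Dvd.dvd.mul_right ((h2 i hi).2 ⟨lt_of_le_of_ne (lt_succ.1 h5) hik, h6⟩) _
        · have hki' : k < i := succ_le_iff'.1 hki
          exact (h3 i hi hki'.le).mul_left (md_cop hd hkc hi hki'.ne)
      · refine ⟨u, h1, fun i hi => ?_, fun i hi hki => h3 i hi (le_trans le_self_add hki)⟩
        rw [h2 i hi]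
        constructor
        · rintro ⟨h5, h6⟩; exact ⟨lt_trans h5 (lt_add_one _), h6⟩
        · rintro ⟨h5, h6⟩
          refine ⟨lt_of_le_of_ne (lt_succ.1 h5) ?_, h6⟩
          rintro rfl; exact hPk h6
  obtain ⟨u, h1, h2, -⟩ := key c le_rfl
  exact ⟨u, le_of_dvd' h1 hU, fun i hi => (h2 i hi).trans ⟨fun h => h.2, fun h => ⟨hi, h⟩⟩⟩

theorem exists_code_bound : ∃ F : M → M, Fn1 C F ∧ ∀ (c : M) (P : M → Prop),
    (Sig C fun v => P (v 0)) → ∃ t ≤ F c, ∀ i, mm i t ↔ i < c ∧ P i := by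
  obtain ⟨G, hG, h⟩ := sig_select C (P := fun c w => GoodAt c (fs w) (sn w)) (by
    intro c
    obtain ⟨v, U, h⟩ := exists_goodAt C c
    exact ⟨pr v U, by simpa using h⟩)
  refine ⟨fun c => pr c (pr (sn (G c)) (fs (G c))), ⟨inferInstance⟩, fun c P hP => ?_⟩
  obtain ⟨P', hP', hPP'⟩ := bounded_rec C (P := P) c
  obtain ⟨u, hu, hi⟩ := code_of_goodAt C (h c) (P := P')
  refine ⟨pr c (pr u (fs (G c))), pr_mono le_rfl (pr_mono hu le_rfl), fun i => ?_⟩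
  rw [mm_pr]
  constructor
  · rintro ⟨h1, h2⟩; exact ⟨h1, (hPP' i h1).2 ((hi i h1).1 h2)⟩
  · rintro ⟨h1, h2⟩; exact ⟨h1, (hi i h1).2 ((hPP' i h1).1 h2)⟩

theorem exists_code {P : M → Prop} [hP : Sig C fun v => P (v 0)] (c : M) :
    ∃ t, ∀ i, mm i t ↔ i < c ∧ P i := by
  obtain ⟨F, _, h⟩ := exists_code_bound C
  obtain ⟨t, _, ht⟩ := h c P hP
  exact ⟨t, ht⟩

end

/-- Inclusion of coded finite sets. -/
def sbs {M : Type} [Arith M] (σ τ : M) : Prop := ∀ i < σ, mm i σ → mm i τ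

theorem sbs_iff {M : Type} [Arith M] {σ τ : M} : sbs σ τ ↔ ∀ i, mm i σ → mm i τ :=
  ⟨fun h i hi => h i (mm_lt hi) hi, fun h i _ hi => h i hi⟩

instance Rec.sbs {M : Type} [Arith M] {C : SClass M} {f g : (ℕ → M) → M} [Fn C f] [Fn C g] :
    Rec C fun v => sbs (f v) (g v) := by unfold PaperArith.sbs; infer_instance

/-- The data for the low basis construction: `f` and `p` give a `Π₁` class of functions bounded
by `f`, and `T` is the matrix of a universal `Σ₁` relation. -/
structure LowData {M : Type} [Arith M] (C : SClass M) where
  f : M → M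
  p : M → M → M → Prop
  T : M → M → M → Prop
  F : M → M
  cs : M → M
  e1 : M
  hf : Fn1 C f
  hp : Rec3 C p
  hT : Rec3 C T
  hF : Fn1 C F
  hcs : Fn1 C cs
  hex : ∀ x, ∃ y < f x, ∀ z, p x y z
  he1 : ∀ x i σ, (∃ y, T (pr e1 (pr x i)) σ y) ↔ mm (pr x i) σ
  code : ∀ (c : M) (P : M → Prop), (Sig C fun v => P (v 0)) →
    ∃ t ≤ F c, ∀ i, mm i t ↔ i < c ∧ P i
  lt_cs : ∀ s x y, x < s → y < f x → pr x y < cs s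

attribute [instance] LowData.hf LowData.hp LowData.hT LowData.hF LowData.hcs

namespace LowData
variable {M : Type} [Arith M] {C : SClass M} (L : LowData C)

/-- `τ` codes a function with domain `[0, s)` approximating the `Π₁` class up to `s`. -/
def Appr (τ s : M) : Prop :=
  (∀ x < s, ∃ y < τ, mm (pr x y) τ) ∧
  (∀ i < τ, mm i τ → ∃ x < s, ∃ y < L.f x, i = pr x y ∧ ∀ z < s, L.p x y z) ∧
  (∀ i < τ, ∀ j < τ, mm i τ → mm j τ → fs i = fs j → i = j)

def Avoid (e τ s : M) : Prop := ∀ σ < s, sbs σ τ → ∀ y < s, ¬ L.T e σ y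

def Av (D b τ s : M) : Prop := ∀ e < b, mm e D → L.Avoid e τ s

def A (D b s : M) : Prop := ∃ τ ≤ L.F (L.cs s), L.Appr τ s ∧ L.Av D b τ s

def N (D e s : M) : Prop := ∃ τ ≤ L.F (L.cs s), L.Appr τ s ∧ L.Av D e τ s ∧ L.Avoid e τ s

def Gr (D b : M) : Prop := ∀ e < b, (mm e D ↔ ∀ s, L.N D e s)

instance Rec.appr {f g : (ℕ → M) → M} [Fn C f] [Fn C g] :
    Rec C fun v => L.Appr (f v) (g v) := by unfold Appr; infer_instance
instance Rec.avoid {f g h : (ℕ → M) → M} [Fn C f] [Fn C g] [Fn C h] :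
    Rec C fun v => L.Avoid (f v) (g v) (h v) := by unfold Avoid; infer_instance
instance Rec.av {f g h k : (ℕ → M) → M} [Fn C f] [Fn C g] [Fn C h] [Fn C k] :
    Rec C fun v => L.Av (f v) (g v) (h v) (k v) := by unfold Av; infer_instance
instance Rec.A' {f g h : (ℕ → M) → M} [Fn C f] [Fn C g] [Fn C h] :
    Rec C fun v => L.A (f v) (g v) (h v) := by unfold A; infer_instance
instance Rec.N' {f g h : (ℕ → M) → M} [Fn C f] [Fn C g] [Fn C h] :
    Rec C fun v => L.N (f v) (g v) (h v) := by unfold N; infer_instance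

variable {L}

theorem Appr.total {τ s x : M} (h : L.Appr τ s) (hx : x < s) : ∃ y < L.f x, mm (pr x y) τ := by
  obtain ⟨y, hy, hm⟩ := h.1 x hx
  obtain ⟨x', -, y', hy', he, -⟩ := h.2.1 _ (mm_lt hm) hm
  obtain ⟨rfl, rfl⟩ := pr_inj.1 he
  exact ⟨y, hy', hm⟩

theorem Appr.bound {τ s x y : M} (h : L.Appr τ s) (hm : mm (pr x y) τ) :
    x < s ∧ y < L.f x ∧ ∀ z < s, L.p x y z := by
  obtain ⟨x', hx', y', hy', he, hz⟩ := h.2.1 _ (mm_lt hm) hm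
  obtain ⟨rfl, rfl⟩ := pr_inj.1 he
  exact ⟨hx', hy', hz⟩

theorem Appr.pair {τ s i : M} (h : L.Appr τ s) (hm : mm i τ) : i = pr (fs i) (sn i) := by
  obtain ⟨x', hx', y', hy', rfl, hz⟩ := h.2.1 _ (mm_lt hm) hm
  simp

theorem Appr.func {τ s x y y' : M} (h : L.Appr τ s) (hm : mm (pr x y) τ) (hm' : mm (pr x y') τ) :
    y = y' :=
  (pr_inj.1 (h.2.2 _ (mm_lt hm) _ (mm_lt hm') hm hm' (by simp))).2

theorem Appr.restrict {τ s s' : M} (h : L.Appr τ s') (hs : s ≤ s') :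
    ∃ τ' ≤ L.F (L.cs s), L.Appr τ' s ∧ sbs τ' τ ∧ ∀ x < s, ∀ y, mm (pr x y) τ → mm (pr x y) τ' := by
  obtain ⟨t, ht, hm⟩ := L.code (L.cs s) (fun i => mm i τ ∧ fs i < s) inferInstance
  have key : ∀ x y, mm (pr x y) t ↔ mm (pr x y) τ ∧ x < s := by
    intro x y
    rw [hm]
    constructor
    · rintro ⟨-, h1, h2⟩; exact ⟨h1, by simpa using h2⟩
    · rintro ⟨h1, h2⟩
      exact ⟨L.lt_cs s x y h2 (h.bound h1).2.1, h1, by simpa using h2⟩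
  have hsub : ∀ i, mm i t → mm i τ := fun i hi => ((hm i).1 hi).2.1
  refine ⟨t, ht, ⟨?_, ?_, ?_⟩, sbs_iff.2 hsub, fun x hx y hy => (key x y).2 ⟨hy, hx⟩⟩
  · intro x hx
    obtain ⟨y, hy, hyt⟩ := h.total (lt_of_lt_of_le hx hs)
    have := (key x y).2 ⟨hyt, hx⟩
    exact ⟨y, lt_of_le_of_lt (right_le_pr x y) (mm_lt this), this⟩
  · intro i _ hi
    obtain ⟨_, h1, h2⟩ := (hm i).1 hi
    obtain ⟨h3, h4, h5⟩ := h.bound (h.pair h1 ▸ h1)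
    exact ⟨fs i, h2, sn i, h4, h.pair h1, fun z hz => h5 z (lt_of_lt_of_le hz hs)⟩
  · intro i _ j _ hi hj hij
    exact h.2.2 i (mm_lt (hsub i hi)) j (mm_lt (hsub j hj)) (hsub i hi) (hsub j hj) hij

theorem Avoid.mono {e τ τ' s s' : M} (h : L.Avoid e τ s') (hs : s ≤ s') (ht : sbs τ' τ) :
    L.Avoid e τ' s := by
  intro σ hσ hst y hy
  refine h σ (lt_of_lt_of_le hσ hs) (sbs_iff.2 fun i hi => ?_) y (lt_of_lt_of_le hy hs)
  exact sbs_iff.1 ht i (sbs_iff.1 hst i hi)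

theorem exists_appr (s : M) : ∃ τ ≤ L.F (L.cs s), L.Appr τ s := by
  obtain ⟨t, ht, hm⟩ := L.code (L.cs s) (fun i => ∃ x < s, ∃ y < L.f x, i = pr x y ∧
    (∀ z < s, L.p x y z) ∧ ∀ y' < y, ¬ ∀ z < s, L.p x y' z) inferInstance
  have key : ∀ x y, mm (pr x y) t ↔ x < s ∧ y < L.f x ∧ (∀ z < s, L.p x y z) ∧
      ∀ y' < y, ¬ ∀ z < s, L.p x y' z := by
    intro x y
    rw [hm]
    constructor
    · rintro ⟨-, x', hx', y', hy', he, h1, h2⟩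
      obtain ⟨rfl, rfl⟩ := pr_inj.1 he
      exact ⟨hx', hy', h1, h2⟩
    · rintro ⟨h1, h2, h3, h4⟩
      exact ⟨L.lt_cs s x y h1 h2, x, h1, y, h2, rfl, h3, h4⟩
  refine ⟨t, ht, ?_, ?_, ?_⟩
  · intro x hx
    obtain ⟨y, hy, hz⟩ := L.hex x
    obtain ⟨y', h1, h2⟩ := exists_least C (P := fun y => ∀ z < s, L.p x y z) (m := y)
      (fun z _ => hz z)
    have h3 : y' ≤ y := by
      by_contra hc
      exact h2 y (not_le.1 hc) fun z _ => hz z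
    have := (key x y').2 ⟨hx, lt_of_le_of_lt h3 hy, h1, h2⟩
    exact ⟨y', lt_of_le_of_lt (right_le_pr x y') (mm_lt this), this⟩
  · intro i _ hi
    obtain ⟨-, x', hx', y', hy', he, h1, h2⟩ := (hm i).1 hi
    exact ⟨x', hx', y', hy', he, h1⟩
  · intro i _ j _ hi hj hij
    obtain ⟨-, x, hx, y, hy, rfl, h1, h2⟩ := (hm i).1 hi
    obtain ⟨-, x', hx', y', hy', rfl, h1', h2'⟩ := (hm j).1 hj
    simp only [fs_pr] at hij
    subst hij
    rcases lt_trichotomy y y' with h | h | h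
    · exact absurd h1 (h2' y h)
    · rw [h]
    · exact absurd h1' (h2 y' h)

theorem Gr.mono {D b b' : M} (h : L.Gr D b') (hb : b ≤ b') : L.Gr D b :=
  fun e he => h e (lt_of_lt_of_le he hb)

theorem Gr.A_all {D b : M} (h : L.Gr D b) (s : M) : L.A D b s := by
  suffices H : ∀ s, L.A D b s from H s
  by_contra hc
  push Not at hc
  obtain ⟨b', hb', hl⟩ := sig_least C (P := fun b' => b' ≤ b ∧ ∃ s, ¬ L.A D b' s) (m := b)
    ⟨le_rfl, hc⟩
  obtain ⟨hb'b, s, hs⟩ := hb'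
  rcases eq_zero_or_succ b' with rfl | ⟨k, rfl⟩
  · obtain ⟨τ, ht, hτ⟩ := L.exists_appr s
    exact hs ⟨τ, ht, hτ, fun e he => absurd he (not_lt.2 zero_le)⟩
  · have hk : k < b := succ_le_iff'.1 hb'b
    have hA : ∀ s, L.A D k s := by
      intro s
      by_contra hn
      exact hl k (lt_add_one k) ⟨hk.le, s, hn⟩
    by_cases hm : mm k D
    · obtain ⟨τ, ht, h1, h2, h3⟩ := (h k hk).1 hm s
      refine hs ⟨τ, ht, h1, fun e he hme => ?_⟩
      rcases lt_or_eq_of_le (lt_succ.1 he) with h4 | rfl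
      · exact h2 e h4 hme
      · exact h3
    · obtain ⟨τ, ht, h1, h2⟩ := hA s
      refine hs ⟨τ, ht, h1, fun e he hme => ?_⟩
      rcases lt_or_eq_of_le (lt_succ.1 he) with h4 | rfl
      · exact h2 e h4 hme
      · exact absurd hme hm

theorem N.congr {D D' e s : M} (hD : ∀ i < e, mm i D ↔ mm i D') : L.N D e s ↔ L.N D' e s := by
  have : ∀ τ, L.Av D e τ s ↔ L.Av D' e τ s := by
    intro τ
    constructor
    · intro h i hi hm; exact h i hi ((hD i hi).2 hm)
    · intro h i hi hm; exact h i hi ((hD i hi).1 hm)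
  unfold N
  simp only [this]

theorem Gr.unique {D D' b : M} (h : L.Gr D b) (h' : L.Gr D' b) : ∀ e < b, mm e D ↔ mm e D' := by
  by_contra hc
  push Not at hc
  obtain ⟨e, he, hne⟩ := hc
  obtain ⟨e, ⟨he, hne⟩, hl⟩ := exists_least C
    (P := fun e => e < b ∧ ¬ (mm e D ↔ mm e D')) (m := e) ⟨he, by tauto⟩
  apply hne
  rw [h e he, h' e he]
  have : ∀ i < e, mm i D ↔ mm i D' := by
    intro i hi
    by_contra hn
    exact hl i hi ⟨lt_trans hi he, hn⟩
  exact forall_congr' fun s => N.congr this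

theorem exists_Gr (b : M) : ∃ D, L.Gr D b := by
  obtain ⟨S, hS⟩ := strong_collection C (P := fun i s => ¬ L.N (fs i) (sn i) s)
    (pr (L.F b) b + 1)
  have hS' : ∀ D ≤ L.F b, ∀ e < b, (∀ s < S, L.N D e s) → ∀ s, L.N D e s := by
    intro D hD e he h s
    by_contra hn
    obtain ⟨s', hs', hn'⟩ := hS (pr D e) (lt_succ.2 (pr_mono hD he.le)) ⟨s, by simpa using hn⟩
    exact hn' (by simpa using h s' hs')
  have key : ∀ b', b' ≤ b → ∃ D ≤ L.F b, ∀ e < b', mm e D ↔ ∀ s < S, L.N D e s := by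
    refine sig_induction C (P := fun b' => b' ≤ b → ∃ D ≤ L.F b, ∀ e < b',
      mm e D ↔ ∀ s < S, L.N D e s) ?_ ?_
    · intro _
      obtain ⟨t, ht, -⟩ := L.code b (fun _ => False) inferInstance
      exact ⟨t, ht, fun e he => absurd he (not_lt.2 zero_le)⟩
    · intro k ih hk
      have hkb : k < b := succ_le_iff'.1 hk
      obtain ⟨D, hD, hDe⟩ := ih hkb.le
      obtain ⟨D', hD', hm⟩ := L.code b
        (fun i => (i < k ∧ mm i D) ∨ (i = k ∧ ∀ s < S, L.N D k s)) inferInstance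
      have hDD : ∀ i < k, mm i D ↔ mm i D' := by
        intro i hi
        rw [hm]
        constructor
        · intro h; exact ⟨lt_trans hi hkb, Or.inl ⟨hi, h⟩⟩
        · rintro ⟨-, h | h⟩
          · exact h.2
          · exact absurd h.1 hi.ne
      refine ⟨D', hD', fun e he => ?_⟩
      rcases lt_or_eq_of_le (lt_succ.1 he) with h4 | rfl
      · rw [← hDD e h4, hDe e h4]
        exact forall_congr' fun s => imp_congr_right fun _ =>
          N.congr fun i hi => hDD i (lt_trans hi h4)
      · have : (∀ s < S, L.N D' e s) ↔ ∀ s < S, L.N D e s :=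
          forall_congr' fun s => imp_congr_right fun _ => (N.congr hDD).symm
        rw [this, hm]
        constructor
        · rintro ⟨-, h | h⟩
          · exact absurd h.1 (lt_irrefl _)
          · exact h.2
        · intro h; exact ⟨hkb, Or.inr ⟨rfl, h⟩⟩
  obtain ⟨D, hD, h⟩ := key b le_rfl
  exact ⟨D, fun e he => (h e he).trans ⟨hS' D hD e he, fun h s _ => h s⟩⟩

variable (L)
/-- The indices decided to be avoided. -/
def E (e : M) : Prop := ∃ D, L.Gr D (e + 1) ∧ mm e D

variable {L}
theorem Gr.mm_iff {D b e : M} (h : L.Gr D b) (he : e < b) : mm e D ↔ L.E e := by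
  have h1 := h.mono (Arith.succ_le he)
  constructor
  · intro hm; exact ⟨D, h1, hm⟩
  · rintro ⟨D', h2, h3⟩
    exact (h1.unique h2 e (lt_add_one e)).2 h3

theorem approx_decides (c e : M) : ∃ D b s0, L.Gr D b ∧ e < b ∧ c ≤ s0 ∧ ∀ s, s0 ≤ s → ∀ τ,
    L.Appr τ s → L.Av D b τ s →
    ∀ x < c, ∀ i, i < L.f x → (mm (pr x i) τ ↔ ¬ L.E (pr L.e1 (pr x i))) := by
  obtain ⟨D, hD⟩ := L.exists_Gr (max (pr L.e1 (L.cs c)) e + 1)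
  set b := max (pr L.e1 (L.cs c)) e + 1 with hb
  obtain ⟨S, hS⟩ := strong_collection C (P := fun e s => ¬ L.N D e s) b
  obtain ⟨S', hS'⟩ := sig_collection C (a := L.cs c) (P := fun j w =>
      (∀ k < fs w, mm k (fs w) → k = j) ∧ (∃ y ≤ sn w, L.T (pr L.e1 j) (fs w) y) ∨
        ¬ ∃ x ≤ j, ∃ i ≤ j, j = pr x i) (by
    intro j hj
    by_cases hji : ∃ x ≤ j, ∃ i ≤ j, j = pr x i
    · obtain ⟨x, -, i, -, rfl⟩ := hji
      obtain ⟨t, ht⟩ := exists_code C (P := fun k => k = pr x i) (pr x i + 1)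
      have h1 : mm (pr x i) t := (ht _).2 ⟨lt_add_one _, rfl⟩
      obtain ⟨y, hy⟩ := (L.he1 x i t).2 h1
      refine ⟨pr t y, Or.inl ⟨?_, y, by simp, by simpa using hy⟩⟩
      intro k _ hk
      rw [fs_pr] at hk
      exact ((ht k).1 hk).2
    · exact ⟨0, Or.inr hji⟩)
  refine ⟨D, b, max c (max S S' + 1), hD, ?_, le_max_left _ _, ?_⟩
  · exact lt_succ.2 (le_max_right _ _)
  intro s hs τ hτ hav x hx i hi
  have hSs : S ≤ s := le_trans (le_trans (le_max_left _ _) le_self_add)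
    (le_trans (le_max_right _ _) hs)
  have hSs' : S' ≤ s := le_trans (le_trans (le_max_right _ _) le_self_add)
    (le_trans (le_max_right _ _) hs)
  have hxi : pr x i < L.cs c := L.lt_cs c x i hx hi
  have hlt : pr L.e1 (pr x i) < b := lt_succ.2 (le_trans (pr_mono le_rfl hxi.le) (le_max_left _ _))
  constructor
  · intro hm hE
    have h1 : mm (pr L.e1 (pr x i)) D := (hD.mm_iff hlt).2 hE
    have h2 := hav _ hlt h1
    obtain ⟨w, hw, h3 | h3⟩ := hS' _ hxi
    · obtain ⟨h3, y, hy, hT⟩ := h3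
      refine h2 (fs w) (lt_of_le_of_lt (fs_le w) (lt_of_lt_of_le hw hSs')) ?_ y
        (lt_of_le_of_lt (le_trans hy (sn_le w)) (lt_of_lt_of_le hw hSs')) hT
      intro k hk hkm
      rw [h3 k hk hkm]; exact hm
    · exact h3 ⟨x, left_le_pr _ _, i, right_le_pr _ _, rfl⟩
  · intro hE
    have h1 : ¬ mm (pr L.e1 (pr x i)) D := fun h => hE ((hD.mm_iff hlt).1 h)
    have h2 : ∃ s, ¬ L.N D (pr L.e1 (pr x i)) s := by
      by_contra hc; push Not at hc
      exact h1 ((hD _ hlt).2 hc)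
    obtain ⟨s1, hs1, hN⟩ := hS _ hlt h2
    obtain ⟨τ', ht', h4, h5, h6⟩ := hτ.restrict (hs1.le.trans hSs)
    by_contra hm
    apply hN
    refine ⟨τ', ht', h4, fun e' he' hm' =>
      (hav e' (lt_trans he' hlt) hm').mono (hs1.le.trans hSs) h5, ?_⟩
    intro σ _ hσ y _ hT
    exact hm (sbs_iff.1 h5 _ (sbs_iff.1 hσ _ ((L.he1 x i σ).1 ⟨y, hT⟩)))

theorem exists_u : ∃ u : M → M, (∀ x, u x < L.f x ∧ ∀ z, L.p x (u x) z) ∧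
    ∀ c e, ∃ D b s0, L.Gr D b ∧ e < b ∧ c ≤ s0 ∧ ∀ s, s0 ≤ s → ∀ τ,
      L.Appr τ s → L.Av D b τ s → ∀ x < c, ∀ i, mm (pr x i) τ ↔ i = u x := by
  have h1 : ∀ x, ∃ i, i < L.f x ∧ ¬ L.E (pr L.e1 (pr x i)) := by
    intro x
    obtain ⟨D, b, s0, hD, _, hc, h⟩ := L.approx_decides (x + 1) 0
    obtain ⟨τ, _, hτ, hav⟩ := hD.A_all s0
    obtain ⟨i, hi, hm⟩ := hτ.total (succ_le_iff'.1 hc)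
    exact ⟨i, hi, (h s0 le_rfl τ hτ hav x (lt_add_one x) i hi).1 hm⟩
  choose u hu hE using h1
  have key : ∀ c e, ∃ D b s0, L.Gr D b ∧ e < b ∧ c ≤ s0 ∧ ∀ s, s0 ≤ s → ∀ τ,
      L.Appr τ s → L.Av D b τ s → ∀ x < c, ∀ i, mm (pr x i) τ ↔ i = u x := by
    intro c e
    obtain ⟨D, b, s0, hD, he, hc, h⟩ := L.approx_decides c e
    refine ⟨D, b, s0, hD, he, hc, fun s hs τ hτ hav x hx i => ?_⟩
    have h2 : mm (pr x (u x)) τ := (h s hs τ hτ hav x hx _ (hu x)).2 (hE x)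
    constructor
    · intro hm; exact hτ.func hm h2
    · rintro rfl; exact h2
  refine ⟨u, fun x => ⟨hu x, fun z => ?_⟩, key⟩
  obtain ⟨D, b, s0, hD, _, hc, h⟩ := key (x + 1) 0
  obtain ⟨τ, _, hτ, hav⟩ := hD.A_all (max s0 (z + 1))
  have h2 := (h _ (le_max_left _ _) τ hτ hav x (lt_add_one x) (u x)).2 rfl
  exact (hτ.bound h2).2.2 z (lt_of_lt_of_le (lt_add_one z) (le_max_right _ _))

end LowData

/-- `σ` codes a finite part of the graph of `u`. -/
def Pre {M : Type} [Arith M] (u : M → M) (σ : M) : Prop := ∀ i, mm i σ → i = pr (fs i) (u (fs i))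

/-- `u` is low for `C`, relative to the universal `Σ₁` relation `W`. -/
structure IsLow {M : Type} [Arith M] (C : SClass M) (W : M → M → Prop) (u : M → M) : Prop where
  coded : ∀ c, ∃ σ, Pre u σ ∧ ∀ x < c, mm (pr x (u x)) σ
  low : ∃ Z : M → M → Prop, (Sig C fun v => Z (v 0) (v 1)) ∧
    ∀ e, (¬ ∃ σ, Pre u σ ∧ W (fs e) (pr (sn e) σ)) ↔ ∃ d, ¬ Z d e

namespace LowData
variable {M : Type} [Arith M] {C : SClass M} {L : LowData C}

theorem E_form : ∃ Z : M → M → Prop, (Sig C fun v => Z (v 0) (v 1)) ∧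
    ∀ e, L.E e ↔ ∃ d, ¬ Z d e := by
  refine ⟨fun d e => ¬ mm e (fs d) ∨ ∃ e' < e + 1, (mm e' (fs d) ∧ ∃ s, ¬ L.N (fs d) e' s) ∨
    (¬ mm e' (fs d) ∧ ∀ s < sn d, L.N (fs d) e' s), inferInstance, fun e => ?_⟩
  constructor
  · rintro ⟨D, hD, hm⟩
    obtain ⟨S, hS⟩ := strong_collection C (P := fun e s => ¬ L.N D e s) (e + 1)
    refine ⟨pr D S, ?_⟩
    simp only [fs_pr, sn_pr]
    rintro (h | ⟨e', he', ⟨h, s, hs⟩ | ⟨h, hs⟩⟩)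
    · exact h hm
    · exact hs ((hD e' he').1 h s)
    · apply h
      rw [hD e' he']
      by_contra hc; push Not at hc
      obtain ⟨s, h1, h2⟩ := hS e' he' hc
      exact h2 (hs s h1)
  · rintro ⟨d, hd⟩
    push Not at hd
    refine ⟨fs d, fun e' he' => ⟨fun hm s => ?_, fun h => ?_⟩, hd.1⟩
    · exact (hd.2 e' he').1 hm s
    · by_contra hm
      obtain ⟨s, _, hs⟩ := (hd.2 e' he').2 hm
      exact hs (h s)

theorem exists_low {W : M → M → Prop}
    (hW : ∀ e σ, W (fs e) (pr (sn e) σ) ↔ ∃ y, L.T e σ y) :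
    ∃ u : M → M, (∀ x, u x < L.f x ∧ ∀ z, L.p x (u x) z) ∧ IsLow C W u := by
  obtain ⟨u, hu, key⟩ := L.exists_u
  have pre_of : ∀ {c D b s0 τ τ' : M}, L.Appr τ s0 → (∀ x < c, ∀ i, mm (pr x i) τ ↔ i = u x) →
      L.Appr τ' c → sbs τ' τ → Pre u τ' := by
    intro c D b s0 τ τ' hτ h hτ' hs i hi
    have h1 := hτ'.pair hi
    have h2 : mm (pr (fs i) (sn i)) τ' := h1 ▸ hi
    have h3 := (h (fs i) (hτ'.bound h2).1 (sn i)).1 (sbs_iff.1 hs _ h2)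
    rw [← h3]; exact h1
  refine ⟨u, hu, ?_, ?_⟩
  · intro c
    obtain ⟨D, b, s0, hD, _, hc, h⟩ := key c 0
    obtain ⟨τ, _, hτ, hav⟩ := hD.A_all s0
    obtain ⟨τ', _, h4, h5, h6⟩ := hτ.restrict hc
    have h7 := h s0 le_rfl τ hτ hav
    exact ⟨τ', pre_of (D := D) (b := b) hτ h7 h4 h5, fun x hx => h6 x hx _ ((h7 x hx _).2 rfl)⟩
  · obtain ⟨Z, hZ, hE⟩ := L.E_form
    refine ⟨Z, hZ, fun e => ?_⟩
    rw [← hE]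
    constructor
    · intro hn
      by_contra hE
      obtain ⟨D0, hD0⟩ := L.exists_Gr (e + 1)
      have h0 : ∃ s, ¬ L.N D0 e s := by
        by_contra hc; push Not at hc
        exact hE ((hD0.mm_iff (lt_add_one e)).1 ((hD0 e (lt_add_one e)).2 hc))
      obtain ⟨s1, hs1⟩ := h0
      obtain ⟨D, b, s0, hD, he, hc, h⟩ := key s1 e
      have hs1' : ¬ L.N D e s1 := by
        rw [N.congr (D' := D0) fun i hi =>
          (hD.mono he.le).unique (hD0.mono (le_self_add)) i hi]
        exact hs1
      obtain ⟨τ, _, hτ, hav⟩ := hD.A_all s0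
      obtain ⟨τ', ht', h4, h5, h6⟩ := hτ.restrict hc
      have h7 := h s0 le_rfl τ hτ hav
      have hpre := pre_of (D := D) (b := b) hτ h7 h4 h5
      apply hs1'
      refine ⟨τ', ht', h4, fun e' he' hm' => (hav e' (lt_trans he' he) hm').mono hc h5, ?_⟩
      intro σ _ hσ y _ hT
      exact hn ⟨σ, fun i hi => hpre i (sbs_iff.1 hσ i hi), (hW e σ).2 ⟨y, hT⟩⟩
    · rintro hE ⟨σ, hσ, hw⟩
      obtain ⟨y, hT⟩ := (hW e σ).1 hw
      obtain ⟨D, b, s0, hD, he, hc, h⟩ := key σ e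
      obtain ⟨τ, _, hτ, hav⟩ := hD.A_all (max s0 (max σ y + 1))
      have h7 := h _ (le_max_left _ _) τ hτ hav
      have hlt : max σ y < max s0 (max σ y + 1) :=
        lt_of_lt_of_le (lt_add_one _) (le_max_right _ _)
      refine hav e he ((hD.mm_iff he).2 hE) σ (lt_of_le_of_lt (le_max_left _ _) hlt) ?_ y
        (lt_of_le_of_lt (le_max_right _ _) hlt) hT
      intro i hi hm
      have h8 := hσ i hm
      rw [h8]
      exact (h7 (fs i) (lt_of_le_of_lt (fs_le i) hi) _).2 rfl

end LowData

/-- `W` enumerates all unary relations of the class. -/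
structure IsUniv {M : Type} [Arith M] (C : SClass M) (W : M → M → Prop) : Prop where
  sig : Sig2 C W
  univ : ∀ P : M → Prop, (Sig C fun v => P (v 0)) → ∃ e, ∀ z, P z ↔ W e z

section
variable {M : Type} [Arith M] {C : SClass M} {W : M → M → Prop} {u : M → M}

theorem VMap.elim (ρ : ℕ → ℕ ⊕ M) : VMap fun v : ℕ → M => vc (v 0) fun i => Sum.elim (tl v) id (ρ i) :=
  VMap.vc_var (g := fun v => v) (hh := VMap.comp_tl (h := fun v : ℕ → M => fun i => Sum.elim v id (ρ i))
    (hh := ⟨ρ, fun _ _ => rfl⟩)) 0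

theorem VMap.diag : VMap fun v : ℕ → M => vc (v 0) fun _ => v 1 :=
  VMap.vc_var (g := fun v => v) (hh := ⟨fun _ => Sum.inl 1, fun _ _ => rfl⟩) 0

/-- The relations that are `Σ₁` in `u` over the class `C`. -/
def ExtMem (C : SClass M) (u : M → M) (Q : (ℕ → M) → Prop) : Prop :=
  ∃ R : M → (ℕ → M) → Prop, (Sig C fun v => R (v 0) (tl v)) ∧
    ∀ v, Q v ↔ ∃ σ, Pre u σ ∧ R σ v

theorem ExtMem.mono_form {Q : (ℕ → M) → Prop} (h : ExtMem C u Q) :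
    ∃ R : M → (ℕ → M) → Prop, (Sig C fun v => R (v 0) (tl v)) ∧
    (∀ σ σ' v, sbs σ σ' → R σ v → R σ' v) ∧ ∀ v, Q v ↔ ∃ σ, Pre u σ ∧ R σ v := by
  obtain ⟨R, hR, h⟩ := h
  have i2 : Sig C fun v => R (v 0) (tl (tl v)) :=
    ⟨SClass.comp hR.out fun v => vc (v 0) (tl (tl v))⟩
  refine ⟨fun σ v => ∃ τ, sbs τ σ ∧ R τ v, inferInstance, ?_, fun v => ?_⟩
  · rintro σ σ' v h1 ⟨τ, h2, h3⟩
    exact ⟨τ, sbs_iff.2 fun i hi => sbs_iff.1 h1 i (sbs_iff.1 h2 i hi), h3⟩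
  · rw [h]
    constructor
    · rintro ⟨σ, h1, h2⟩; exact ⟨σ, h1, σ, fun i _ hi => hi, h2⟩
    · rintro ⟨σ, h1, τ, h2, h3⟩; exact ⟨τ, fun i hi => h1 i (sbs_iff.1 h2 i hi), h3⟩

theorem Pre.join {σ τ : M} (C : SClass M) (h : Pre u σ) (h' : Pre u τ) :
    ∃ ρ, Pre u ρ ∧ sbs σ ρ ∧ sbs τ ρ := by
  obtain ⟨t, ht⟩ := exists_code C (P := fun i => mm i σ ∨ mm i τ) (max σ τ)
  refine ⟨t, fun i hi => ?_, fun i hi hm => (ht i).2 ⟨lt_of_lt_of_le hi (le_max_left _ _), Or.inl hm⟩,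
    fun i hi hm => (ht i).2 ⟨lt_of_lt_of_le hi (le_max_right _ _), Or.inr hm⟩⟩
  rcases ((ht i).1 hi).2 with h1 | h1
  · exact h i h1
  · exact h' i h1

theorem IsLow.cover (hl : IsLow C W u) (B : M) : ∃ τ, Pre u τ ∧ ∀ σ < B, Pre u σ → sbs σ τ := by
  obtain ⟨τ, h1, h2⟩ := hl.coded B
  refine ⟨τ, h1, fun σ hσ hp i hi hm => ?_⟩
  rw [hp i hm]
  exact h2 _ (lt_of_le_of_lt (fs_le i) (lt_trans hi hσ))

theorem ExtMem.of_mem (hl : IsLow C W u) {Q : (ℕ → M) → Prop} (h : C.mem Q) : ExtMem C u Q := by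
  obtain ⟨σ, hσ, -⟩ := hl.coded 0
  have : Sig C Q := ⟨h⟩
  exact ⟨fun _ => Q, ⟨SClass.comp h tl⟩, fun v => ⟨fun hq => ⟨σ, hσ, hq⟩, fun ⟨_, _, hq⟩ => hq⟩⟩

theorem ExtMem.sub {Q : (ℕ → M) → Prop} (ρ : ℕ → ℕ ⊕ M) (h : ExtMem C u Q) :
    ExtMem C u fun v => Q fun i => Sum.elim v id (ρ i) := by
  obtain ⟨R, hR, h⟩ := h
  exact ⟨fun σ v => R σ fun i => Sum.elim v id (ρ i),
    ⟨SClass.comp hR.out _ (hh := VMap.elim ρ)⟩,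
    fun v => h _⟩

theorem ExtMem.and {P Q : (ℕ → M) → Prop} (hP : ExtMem C u P) (hQ : ExtMem C u Q) :
    ExtMem C u fun v => P v ∧ Q v := by
  obtain ⟨R, hR, hm, h⟩ := hP.mono_form
  obtain ⟨R', hR', hm', h'⟩ := hQ.mono_form
  refine ⟨fun σ v => R σ v ∧ R' σ v, inferInstance, fun v => ?_⟩
  beta_reduce
  rw [h, h']
  constructor
  · rintro ⟨⟨σ, h1, h2⟩, τ, h3, h4⟩
    obtain ⟨ρ, h5, h6, h7⟩ := h1.join C h3
    exact ⟨ρ, h5, hm _ _ _ h6 h2, hm' _ _ _ h7 h4⟩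
  · rintro ⟨σ, h1, h2, h3⟩
    exact ⟨⟨σ, h1, h2⟩, σ, h1, h3⟩

theorem ExtMem.or {P Q : (ℕ → M) → Prop} (hP : ExtMem C u P) (hQ : ExtMem C u Q) :
    ExtMem C u fun v => P v ∨ Q v := by
  obtain ⟨R, hR, h⟩ := hP
  obtain ⟨R', hR', h'⟩ := hQ
  refine ⟨fun σ v => R σ v ∨ R' σ v, inferInstance, fun v => ?_⟩
  beta_reduce
  rw [h, h', ← exists_or]
  exact exists_congr fun σ => and_or_left.symm

theorem ExtMem.ex {Q : (ℕ → M) → Prop} (h : ExtMem C u Q) :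
    ExtMem C u fun v => ∃ m, Q (vc m v) := by
  obtain ⟨R, hR, h⟩ := h
  have i2 : Sig C fun v => R (tl v 0) (vc (v 0) (tl (tl v))) :=
    ⟨SClass.comp hR.out fun v => vc (tl v 0) (vc (v 0) (tl (tl v)))⟩
  refine ⟨fun σ v => ∃ m, R σ (vc m v), inferInstance, fun v => ?_⟩
  simp only [h]
  constructor
  · rintro ⟨m, σ, h1, h2⟩; exact ⟨σ, h1, m, h2⟩
  · rintro ⟨σ, h1, m, h2⟩; exact ⟨m, σ, h1, h2⟩

theorem ExtMem.pre : ExtMem C u fun v => Pre u (v 0) :=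
  ⟨fun σ v => σ = v 0, inferInstance, fun v => by simp⟩

theorem ExtMem.not_pre (hl : IsLow C W u) : ExtMem C u fun v => ¬ Pre u (v 0) := by
  refine ⟨fun τ v => ∃ i < v 0, mm i (v 0) ∧ ∃ y < τ, mm (pr (fs i) y) τ ∧ i ≠ pr (fs i) y,
    inferInstance, fun v => ?_⟩
  constructor
  · intro hn
    unfold Pre at hn
    push Not at hn
    obtain ⟨i, hi, hne⟩ := hn
    obtain ⟨τ, h1, h2⟩ := hl.coded (fs i + 1)
    have h3 := h2 _ (lt_add_one _)
    exact ⟨τ, h1, i, mm_lt hi, hi, u (fs i), lt_of_le_of_lt (right_le_pr _ _) (mm_lt h3), h3, hne⟩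
  · rintro ⟨τ, h1, i, _, hi, y, _, h2, hne⟩ hp
    apply hne
    have h3 := h1 _ h2
    simp only [fs_pr] at h3
    rw [h3]; exact hp i hi

theorem ExtMem.b2 (hU : IsUniv C W) (hl : IsLow C W u) {Q : (ℕ → M) → Prop} (h : ExtMem C u Q)
    (v : ℕ → M) (a : M) (hb : ∀ i < a, ∃ b, ¬ Q (vc b (vc i v))) :
    ∃ B, ∀ i < a, ∃ b < B, ¬ Q (vc b (vc i v)) := by
  obtain ⟨R, hR, h⟩ := h
  obtain ⟨Z, hZ, hlow⟩ := hl.low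
  have i3 : Sig3 C fun σ b i => R σ (vc b (vc i v)) :=
    ⟨⟨SClass.comp hR.out fun w => vc (w 0) (vc (w 1) (vc (w 2) v))⟩⟩
  obtain ⟨e, he⟩ := hU.univ (fun z => R (sn z) (vc (fs (fs z)) (vc (sn (fs z)) v)))
    (Sig.app3 (P := fun σ b i => R σ (vc b (vc i v))))
  have key : ∀ b i, ¬ Q (vc b (vc i v)) ↔ ∃ d, ¬ Z d (pr e (pr b i)) := by
    intro b i
    rw [← hlow, h]
    simp only [fs_pr, sn_pr, ← he]
  simp only [key] at hb ⊢
  have i4 : Sig2 C Z := ⟨hZ⟩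
  obtain ⟨B, hB⟩ := pi_collection C (a := a) (Q := fun i w => Z (sn w) (pr e (pr (fs w) i))) (by
    intro i hi
    obtain ⟨b, d, hd⟩ := hb i hi
    exact ⟨pr b d, by simpa using hd⟩)
  refine ⟨B, fun i hi => ?_⟩
  obtain ⟨w, hw, h1⟩ := hB i hi
  exact ⟨fs w, lt_of_le_of_lt (fs_le w) hw, sn w, h1⟩

theorem ExtMem.b1 (hU : IsUniv C W) (hl : IsLow C W u) {R : M → M → Prop} [Sig2 C R]
    (hm : ∀ σ σ' i, sbs σ σ' → R σ i → R σ' i) (a : M) (h : ∀ i < a, ∃ σ, Pre u σ ∧ R σ i) :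
    ∃ σ, Pre u σ ∧ ∀ i < a, R σ i := by
  obtain ⟨R0, hR0, hR⟩ := sig_nf C (P := R)
  have hmem : ExtMem C u fun v => ¬ Pre u (fs (v 0)) ∨ ¬ R0 (fs (v 0)) (v 1) (sn (v 0)) := by
    refine ExtMem.or ?_ (ExtMem.of_mem hl (Sig.out (P := fun v => ¬ R0 (fs (v 0)) (v 1) (sn (v 0)))))
    obtain ⟨R, hR, h⟩ := ExtMem.not_pre hl
    refine ⟨fun σ v => ∃ m, m = fs (v 0) ∧ R σ (vc m v), ?_, fun v => ?_⟩
    · have : Sig C fun v => R (tl v 0) (vc (v 0) (tl (tl v))) :=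
        ⟨SClass.comp hR.out fun v => vc (tl v 0) (vc (v 0) (tl (tl v)))⟩
      infer_instance
    · simp only [exists_eq_left]
      exact h (vc (fs (v 0)) v)
  obtain ⟨B, hB⟩ := hmem.b2 hU hl (fun _ => 0) a (by
    intro i hi
    obtain ⟨σ, h1, h2⟩ := h i hi
    obtain ⟨w, hw⟩ := (hR σ i).1 h2
    refine ⟨pr σ w, ?_⟩
    simp only [vc_zero, fs_pr, vc_one, sn_pr]
    tauto)
  obtain ⟨τ, h1, h2⟩ := hl.cover B
  refine ⟨τ, h1, fun i hi => ?_⟩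
  obtain ⟨b, hb, h3⟩ := hB i hi
  push Not at h3
  exact hm _ _ _ (h2 (fs b) (lt_of_le_of_lt (fs_le b) hb) h3.1) ((hR _ _).2 ⟨_, h3.2⟩)

theorem ExtMem.ball (hU : IsUniv C W) (hl : IsLow C W u) {Q : (ℕ → M) → Prop}
    (h : ExtMem C u Q) : ExtMem C u fun v => ∀ m, m < v 0 → Q (vc m v) := by
  obtain ⟨R, hR, hm, h⟩ := h.mono_form
  have i2 : Sig C fun v => R (tl v 0) (vc (v 0) (tl (tl v))) :=
    ⟨SClass.comp hR.out fun v => vc (tl v 0) (vc (v 0) (tl (tl v)))⟩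
  refine ⟨fun σ v => ∀ m, m < v 0 → R σ (vc m v), inferInstance, fun v => ?_⟩
  simp only [h]
  constructor
  · intro hq
    have : Sig2 C fun σ m => R σ (vc m v) := ⟨⟨SClass.comp hR.out fun w => vc (w 0) (vc (w 1) v)⟩⟩
    exact ExtMem.b1 hU hl (R := fun σ m => R σ (vc m v)) (fun σ σ' i => hm _ _ _) (v 0) hq
  · rintro ⟨σ, h1, h2⟩ m hm
    exact ⟨σ, h1, h2 m hm⟩

theorem ExtMem.nf (hl : IsLow C W u) {Q : (ℕ → M) → Prop} (h : ExtMem C u Q) :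
    ∃ R, ExtMem C u R ∧ ExtMem C u (fun v => ¬ R v) ∧ ∀ v, Q v ↔ ∃ m, R (vc m v) := by
  obtain ⟨R, hR, h⟩ := h
  obtain ⟨R0, h1, h2, h3⟩ := C.nf hR.out
  have i0 : Rec C R0 := ⟨h1, h2⟩
  have i1 : Rec3 C fun _ _ _ : M => True := ⟨inferInstance⟩
  have hsub : ∀ {P : M → (ℕ → M) → Prop}, ExtMem C u (fun v => P (v 0) v) →
      (ExtMem C u fun v => P (fs (v 0)) (vc (fs (v 0)) v)) := by
    rintro P ⟨R, hR, h⟩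
    refine ⟨fun σ v => ∃ m, m = fs (v 0) ∧ R σ (vc m v), ?_, fun v => ?_⟩
    · have : Sig C fun v => R (tl v 0) (vc (v 0) (tl (tl v))) :=
        ⟨SClass.comp hR.out fun v => vc (tl v 0) (vc (v 0) (tl (tl v)))⟩
      infer_instance
    · simp only [exists_eq_left]
      exact h (vc (fs (v 0)) v)
  have i2 : Rec C fun v => R0 (vc (sn (v 0)) (vc (fs (v 0)) (tl v))) := by
    have j : Rec C fun v => R0 (vc (v 1) (vc (v 0) (tl (tl (tl v))))) := inferInstance
    exact Rec.subst (P := fun m v => R0 (vc m (vc (fs (v 0)) (tl v))))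
      (Rec.subst (P := fun m v => R0 (vc (v 0) (vc m (tl (tl v)))))
        (g := fun v => fs (tl v 0)) j inferInstance) inferInstance
  refine ⟨fun v => Pre u (fs (v 0)) ∧ R0 (vc (sn (v 0)) (vc (fs (v 0)) (tl v))),
    ExtMem.and (hsub (P := fun m _ => Pre u m) ExtMem.pre) (ExtMem.of_mem hl i2.pos), ?_, fun v => ?_⟩
  · obtain ⟨R, hR, h⟩ := ExtMem.or (hsub (P := fun m _ => ¬ Pre u m) (ExtMem.not_pre hl))
      (ExtMem.of_mem hl i2.neg)
    exact ⟨R, hR, fun v => by rw [← h]; tauto⟩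
  · rw [h]
    constructor
    · rintro ⟨σ, h4, h5⟩
      obtain ⟨m, hm⟩ := (h3 (vc σ v)).1 h5
      exact ⟨pr σ m, by simpa using h4, by simpa using hm⟩
    · rintro ⟨w, h4, h5⟩
      exact ⟨fs w, h4, (h3 (vc (fs w) v)).2 ⟨sn w, by simpa using h5⟩⟩

theorem ExtMem.lnp (hU : IsUniv C W) (hl : IsLow C W u) {Q : (ℕ → M) → Prop}
    (h : ExtMem C u Q) (h' : ExtMem C u fun v => ¬ Q v) (v : ℕ → M) (m : M) (hQ : Q (vc m v)) :
    ∃ m, Q (vc m v) ∧ ∀ k < m, ¬ Q (vc k v) := by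
  obtain ⟨R, hR, hm, h⟩ := h.mono_form
  obtain ⟨R', hR', hm', h'⟩ := h'.mono_form
  have i1 : Sig2 C fun σ m => R σ (vc m v) := ⟨⟨SClass.comp hR.out fun w => vc (w 0) (vc (w 1) v)⟩⟩
  have i2 : Sig2 C fun σ m => R' σ (vc m v) :=
    ⟨⟨SClass.comp hR'.out fun w => vc (w 0) (vc (w 1) v)⟩⟩
  have i3 : Sig2 C fun σ m => R σ (vc m v) ∨ R' σ (vc m v) :=
    ⟨Sig.or (P := fun w => R (w 0) (vc (w 1) v)) (Q := fun w => R' (w 0) (vc (w 1) v))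
      (hP := i1.out) (hQ := i2.out)⟩
  obtain ⟨σ, h1, h2⟩ := ExtMem.b1 hU hl (R := fun σ m => R σ (vc m v) ∨ R' σ (vc m v))
    (fun σ σ' i hs => Or.imp (hm _ _ _ hs) (hm' _ _ _ hs)) (m + 1) (by
      intro i _
      by_cases hq : Q (vc i v)
      · obtain ⟨σ, h1, h2⟩ := (h _).1 hq
        exact ⟨σ, h1, Or.inl h2⟩
      · obtain ⟨σ, h1, h2⟩ := (h' _).1 hq
        exact ⟨σ, h1, Or.inr h2⟩)
  have key : ∀ i < m + 1, (Q (vc i v) ↔ R σ (vc i v)) := by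
    intro i hi
    refine ⟨fun hq => (h2 i hi).resolve_right fun hr => (h' _).2 ⟨σ, h1, hr⟩ hq,
      fun hr => (h _).2 ⟨σ, h1, hr⟩⟩
  have i4 : Sig C fun w => R σ (vc (w 0) v) := ⟨SClass.comp hR.out fun w => vc σ (vc (w 0) v)⟩
  obtain ⟨k, h3, h4⟩ := sig_least C (P := fun i => R σ (vc i v)) (m := m)
    ((key m (lt_add_one m)).1 hQ)
  have hk : k ≤ m := by
    by_contra hc
    exact h4 m (not_le.1 hc) ((key m (lt_add_one m)).1 hQ)
  exact ⟨k, (key k (lt_succ.2 hk)).2 h3, fun j hj hq =>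
    h4 j hj ((key j (lt_trans hj (lt_succ.2 hk))).1 hq)⟩

/-- The class of relations that are `Σ₁` in a low function. -/
def SClass.ext (C : SClass M) (hU : IsUniv C W) (hl : IsLow C W u) : SClass M where
  mem := ExtMem C u
  sub ρ h := h.sub ρ
  add_mem := ExtMem.of_mem hl C.add_mem
  mul_mem := ExtMem.of_mem hl C.mul_mem
  lt_mem := ExtMem.of_mem hl C.lt_mem
  and_mem := ExtMem.and
  or_mem := ExtMem.or
  ex_mem := ExtMem.ex
  ball_mem := ExtMem.ball hU hl
  nf := ExtMem.nf hl
  lnp := ExtMem.lnp hU hl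
  b2 := ExtMem.b2 hU hl

theorem ext_univ (hU : IsUniv C W) (hl : IsLow C W u) :
    IsUniv (C.ext hU hl) fun e z => ∃ σ, Pre u σ ∧ W e (pr z σ) := by
  have := hU.sig
  refine ⟨⟨⟨⟨fun σ v => W (v 0) (pr (v 1) σ), inferInstance, fun v => Iff.rfl⟩⟩⟩, ?_⟩
  rintro P ⟨R, hR, h⟩
  have i1 : Sig2 C fun σ z => R σ fun _ => z :=
    ⟨⟨SClass.comp hR.out _ (hh := VMap.diag)⟩⟩
  obtain ⟨e, he⟩ := hU.univ (fun z => R (sn z) fun _ => fs z) (Sig.app2 (P := fun σ z => R σ fun _ => z))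
  refine ⟨e, fun z => ?_⟩
  have := h fun _ => z
  beta_reduce at this
  rw [this]
  simp [← he]

theorem ext_fn (hU : IsUniv C W) (hl : IsLow C W u) : Fn1 (C.ext hU hl) u := by
  refine ⟨⟨⟨fun σ v => mm (pr (v 1) (v 0)) σ, inferInstance, fun v => ?_⟩⟩⟩
  constructor
  · intro h
    obtain ⟨σ, h1, h2⟩ := hl.coded (v 1 + 1)
    have := h2 _ (lt_add_one _)
    refine ⟨σ, h1, ?_⟩
    change u (v 1) = v 0 at h
    rwa [← h]
  · rintro ⟨σ, h1, h2⟩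
    have := (pr_inj.1 (h1 _ h2)).2
    change u (v 1) = v 0
    simpa using this.symm

end

section
variable {M : Type} [Arith M] {C : SClass M} {W : M → M → Prop}

theorem IsUniv.exists_lowData (hU : IsUniv C W) {f : M → M} {p : M → M → M → Prop} (hf : Fn1 C f)
    (hp : Rec3 C p) (hex : ∀ x, ∃ y < f x, ∀ z, p x y z) :
    ∃ L : LowData C, L.f = f ∧ L.p = p ∧ ∀ e σ, W (fs e) (pr (sn e) σ) ↔ ∃ y, L.T e σ y := by
  have := hU.sig
  obtain ⟨T, hT, h1⟩ := sig_nf C (P := fun e σ => W (fs e) (pr (sn e) σ))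
  obtain ⟨e1, he1⟩ := hU.univ (fun z => mm (fs z) (sn z)) inferInstance
  obtain ⟨F, hF, h2⟩ := exists_code_bound C
  obtain ⟨cs, hcs, h3⟩ := sig_select C (P := fun s B => ∀ x < s, ∀ y < f x, pr x y < B) (by
    intro s
    obtain ⟨B, hB⟩ := sig_collection C (a := s) (P := fun x w => w = pr x (f x)) fun i _ => ⟨_, rfl⟩
    refine ⟨B, fun x hx y hy => ?_⟩
    obtain ⟨w, hw, rfl⟩ := hB x hx
    exact lt_of_le_of_lt (pr_mono le_rfl hy.le) hw)
  have he1' : ∀ x i σ, (∃ y, T (pr e1 (pr x i)) σ y) ↔ mm (pr x i) σ := by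
    intro x i σ
    rw [← h1]
    simp [← he1]
  exact ⟨⟨f, p, T, F, cs, e1, hf, hp, hT, hF, hcs, hex, he1', h2, fun s x y hx hy => h3 s x hx y hy⟩,
    rfl, rfl, h1⟩

/-- `C'` contains a solution of each bounded `Π₁` choice problem over `C`. -/
def Solves (C C' : SClass M) : Prop := ∀ (f : M → M) (p : M → M → M → Prop), Fn1 C f → Rec3 C p →
  (∀ x, ∃ y < f x, ∀ z, p x y z) → ∃ u : M → M, Fn1 C' u ∧ ∀ x, u x < f x ∧ ∀ z, p x (u x) z

theorem universal_problem {T : M → M → M → Prop} [hT : Rec3 C T] (e w b : M) (hb : b ≠ 0) :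
    ∃ y < b, ∀ s, (∃ t ≤ s, T e (pr w y) t) → ∀ y' < b, ∃ t ≤ s, T e (pr w y') t := by
  by_cases hc : ∃ y < b, ¬ ∃ t, T e (pr w y) t
  · obtain ⟨y, hy, hn⟩ := hc
    exact ⟨y, hy, fun s ⟨t, _, ht⟩ => absurd ⟨t, ht⟩ hn⟩
  · push Not at hc
    obtain ⟨B, hB⟩ := sig_collection C (P := fun y t => T e (pr w y) t) hc
    obtain ⟨s, hs, hl⟩ := exists_least C (P := fun s => ∀ y' < b, ∃ t ≤ s, T e (pr w y') t) (m := B)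
      (fun y hy => by obtain ⟨t, ht, h⟩ := hB y hy; exact ⟨t, ht.le, h⟩)
    have h0 : 0 < b := pos_iff_ne_zero.2 hb
    rcases eq_zero_or_succ s with rfl | ⟨k, rfl⟩
    · exact ⟨0, h0, fun s _ y' hy' => by
        obtain ⟨t, ht, h⟩ := hs y' hy'
        exact ⟨t, ht.trans zero_le, h⟩⟩
    · have := hl k (lt_add_one k)
      push Not at this
      obtain ⟨y, hy, hn⟩ := this
      refine ⟨y, hy, fun s ⟨t, ht, h⟩ y' hy' => ?_⟩
      have hks : k + 1 ≤ s := by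
        by_contra hc
        exact hn t (ht.trans (lt_succ.1 (not_le.1 hc))) h
      obtain ⟨t', ht', h'⟩ := hs y' hy'
      exact ⟨t', ht'.trans hks, h'⟩

theorem IsUniv.exists_solves (hU : IsUniv C W) : ∃ (C' : SClass M) (W' : M → M → Prop),
    IsUniv C' W' ∧ (∀ Q, C.mem Q → C'.mem Q) ∧ Solves C C' := by
  have := hU.sig
  obtain ⟨T, hT, h1⟩ := sig_nf C (P := W)
  have j1 : Fn1 C fun X => sn (sn X) + 1 := ⟨inferInstance⟩
  obtain ⟨L, hLf, hLp, hLT⟩ := hU.exists_lowData (f := fun X => sn (sn X) + 1)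
    (p := fun X y s => (sn (sn X) = 0 ∨ y < sn (sn X)) ∧
      ((∃ t ≤ s, T (fs X) (pr (fs (sn X)) y) t) →
        ∀ y' < sn (sn X), ∃ t ≤ s, T (fs X) (pr (fs (sn X)) y') t)) j1 ⟨inferInstance⟩ (by
      intro X
      by_cases hb : sn (sn X) = 0
      · exact ⟨0, by simp, fun z => ⟨Or.inl hb, fun _ y' hy' => by simp [hb] at hy'⟩⟩
      · obtain ⟨y, hy, h⟩ := universal_problem (C := C) (T := T) (fs X) (fs (sn X)) _ hb
        exact ⟨y, lt_trans hy (lt_add_one _), fun z => ⟨Or.inr hy, h z⟩⟩)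
  obtain ⟨u, hu, hl⟩ := LowData.exists_low (L := L) hLT
  rw [hLf, hLp] at hu
  refine ⟨C.ext hU hl, _, ext_univ hU hl, fun Q hQ => ExtMem.of_mem hl hQ, ?_⟩
  intro f p hf hp hex
  obtain ⟨e, he⟩ := hU.univ (fun z => ∃ s, ¬ p (fs z) (sn z) s) inferInstance
  have i1 := ext_fn hU hl
  have i2 : Fn1 (C.ext hU hl) f := ⟨⟨ExtMem.of_mem hl hf.out.out⟩⟩
  refine ⟨fun x => u (pr e (pr x (f x))), ⟨inferInstance⟩, fun x => ?_⟩
  obtain ⟨-, h2⟩ := hu (pr e (pr x (f x)))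
  simp only [sn_pr, fs_pr] at h2
  obtain ⟨y, hy, hyp⟩ := hex x
  refine ⟨(h2 0).1.resolve_left fun h0 => by simp [h0] at hy, fun z => ?_⟩
  by_contra hz
  obtain ⟨t, ht⟩ := (h1 e (pr x (u (pr e (pr x (f x)))))).1 ((he _).1 ⟨z, by simpa using hz⟩)
  obtain ⟨t', _, ht'⟩ := (h2 t).2 ⟨t, le_rfl, ht⟩ y hy
  obtain ⟨s, hs⟩ := (he _).2 ((h1 e (pr x y)).2 ⟨t', ht'⟩)
  simp only [fs_pr, sn_pr] at hs
  exact hs (hyp s)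

/-- The union of an increasing chain of classes. -/
def SClass.iUnion (Cs : ℕ → SClass M) (hmono : ∀ k l, k ≤ l → ∀ Q, (Cs k).mem Q → (Cs l).mem Q) :
    SClass M where
  mem Q := ∃ k, (Cs k).mem Q
  sub ρ h := h.imp fun k h => (Cs k).sub ρ h
  add_mem := ⟨0, (Cs 0).add_mem⟩
  mul_mem := ⟨0, (Cs 0).mul_mem⟩
  lt_mem := ⟨0, (Cs 0).lt_mem⟩
  and_mem := fun ⟨k, h⟩ ⟨l, h'⟩ => ⟨max k l, (Cs _).and_mem (hmono k _ (le_max_left _ _) _ h)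
    (hmono l _ (le_max_right _ _) _ h')⟩
  or_mem := fun ⟨k, h⟩ ⟨l, h'⟩ => ⟨max k l, (Cs _).or_mem (hmono k _ (le_max_left _ _) _ h)
    (hmono l _ (le_max_right _ _) _ h')⟩
  ex_mem := fun ⟨k, h⟩ => ⟨k, (Cs k).ex_mem h⟩
  ball_mem := fun ⟨k, h⟩ => ⟨k, (Cs k).ball_mem h⟩
  nf := fun ⟨k, h⟩ => by
    obtain ⟨R, h1, h2, h3⟩ := (Cs k).nf h
    exact ⟨R, ⟨k, h1⟩, ⟨k, h2⟩, h3⟩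
  lnp := fun ⟨k, h⟩ ⟨l, h'⟩ => (Cs (max k l)).lnp (hmono k _ (le_max_left _ _) _ h)
    (hmono l _ (le_max_right _ _) _ h')
  b2 := fun ⟨k, h⟩ => (Cs k).b2 h

theorem IsUniv.exists_closed (hU : IsUniv C W) [Countable M] : ∃ C' : SClass M,
    (∀ Q, C.mem Q → C'.mem Q) ∧ Solves C' C' ∧
    {P : M → Prop | Sig C' fun v => P (v 0)}.Countable := by
  let St := {D : SClass M × (M → M → Prop) // IsUniv D.1 D.2}
  have hstep : ∀ s : St, ∃ s' : St, (∀ Q, s.1.1.mem Q → s'.1.1.mem Q) ∧ Solves s.1.1 s'.1.1 := by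
    intro s
    obtain ⟨C', W', h1, h2, h3⟩ := s.2.exists_solves
    exact ⟨⟨(C', W'), h1⟩, h2, h3⟩
  choose nx h1 h2 using hstep
  let s : ℕ → St := fun k => Nat.rec ⟨(C, W), hU⟩ (fun _ => nx) k
  have hmono : ∀ k l, k ≤ l → ∀ Q, (s k).1.1.mem Q → (s l).1.1.mem Q := by
    intro k l hkl
    induction hkl with
    | refl => exact fun _ h => h
    | step _ ih => exact fun Q h => h1 _ Q (ih Q h)
  refine ⟨SClass.iUnion (fun k => (s k).1.1) hmono, fun Q h => ⟨0, h⟩, ?_, ?_⟩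
  · intro f p hf hp hex
    obtain ⟨a, ha⟩ := hf.out.out
    obtain ⟨b, hb⟩ := hp.out.pos
    obtain ⟨c, hc⟩ := hp.out.neg
    let k := max a (max b c)
    obtain ⟨u, hu, h⟩ := h2 (s k) f p ⟨⟨hmono a k (by omega) _ ha⟩⟩
      ⟨⟨hmono b k (by omega) _ hb, hmono c k (by omega) _ hc⟩⟩ hex
    exact ⟨u, ⟨⟨k + 1, hu.out.out⟩⟩, h⟩
  · have hsub : {P : M → Prop | Sig (SClass.iUnion (fun k => (s k).1.1) hmono) fun v => P (v 0)} ⊆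
        Set.range fun q : ℕ × M => (s q.1).1.2 q.2 := by
      rintro P ⟨k, hP⟩
      obtain ⟨e, he⟩ := (s k).2.univ P ⟨hP⟩
      exact ⟨(k, e), funext fun z => propext (he z).symm⟩
    exact (Set.countable_range _).mono hsub

end

/-- The structure for the language of arithmetic underlying `M`. -/
abbrev toStr (M : Type) [Arith M] : Str := ⟨M, 0, 1, (· + ·), (· * ·), (· < ·)⟩

section
variable {M : Type} [Arith M]

/-- Satisfaction in the structure underlying `M`. -/
abbrev sat (v : ℕ → M) (φ : Fml) : Prop := Sat0 (toStr M) v φ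

theorem upd_same {α : Type} (v : ℕ → α) (x : ℕ) (a : α) : upd v x a x = a := by simp [upd]

theorem upd_ne {α : Type} (v : ℕ → α) {x i : ℕ} (a : α) (h : i ≠ x) : upd v x a i = v i := by
  simp [upd, h]

theorem tval_fin (t : Term) : ∃ N, ∀ v v' : ℕ → M, (∀ i < N, v i = v' i) →
    tval (toStr M) v t = tval (toStr M) v' t := by
  induction t with
  | var i => exact ⟨i + 1, fun v v' h => h i (by omega)⟩
  | zero => exact ⟨0, fun v v' h => rfl⟩
  | one => exact ⟨0, fun v v' h => rfl⟩
  | add t s iht ihs =>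
    obtain ⟨N, hN⟩ := iht
    obtain ⟨N', hN'⟩ := ihs
    refine ⟨max N N', fun v v' h => ?_⟩
    simp only [tval, hN v v' fun i hi => h i (by omega), hN' v v' fun i hi => h i (by omega)]
  | mul t s iht ihs =>
    obtain ⟨N, hN⟩ := iht
    obtain ⟨N', hN'⟩ := ihs
    refine ⟨max N N', fun v v' h => ?_⟩
    simp only [tval, hN v v' fun i hi => h i (by omega), hN' v v' fun i hi => h i (by omega)]

/-- The truth value of `φ` depends only on the variables below `N`. -/
def FinDep (M : Type) [Arith M] (φ : Fml) (N : ℕ) : Prop :=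
  ∀ v v' : ℕ → M, (∀ i < N, v i = v' i) → (sat v φ ↔ sat v' φ)

theorem upd_congr {v v' : ℕ → M} {N x : ℕ} (h : ∀ i < N, v i = v' i) (m : M) :
    ∀ i < N, upd v x m i = upd v' x m i := by
  intro i hi
  unfold upd
  split_ifs
  · rfl
  · exact h i hi

theorem Delta0.fin {φ : Fml} (h : Delta0 φ) : ∃ N, FinDep M φ N := by
  induction h with
  | eq t s =>
    obtain ⟨N, hN⟩ := tval_fin (M := M) t
    obtain ⟨N', hN'⟩ := tval_fin (M := M) s
    refine ⟨max N N', fun v v' h => ?_⟩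
    simp only [sat, Sat0, Sat, hN v v' fun i hi => h i (by omega),
      hN' v v' fun i hi => h i (by omega)]
  | lt t s =>
    obtain ⟨N, hN⟩ := tval_fin (M := M) t
    obtain ⟨N', hN'⟩ := tval_fin (M := M) s
    refine ⟨max N N', fun v v' h => ?_⟩
    simp only [sat, Sat0, Sat, hN v v' fun i hi => h i (by omega),
      hN' v v' fun i hi => h i (by omega)]
  | not _ ih =>
    obtain ⟨N, hN⟩ := ih
    exact ⟨N, fun v v' h => not_congr (hN v v' h)⟩
  | and _ _ ih ih' =>
    obtain ⟨N, hN⟩ := ih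
    obtain ⟨N', hN'⟩ := ih'
    exact ⟨max N N', fun v v' h => and_congr (hN v v' fun i hi => h i (by omega))
      (hN' v v' fun i hi => h i (by omega))⟩
  | or _ _ ih ih' =>
    obtain ⟨N, hN⟩ := ih
    obtain ⟨N', hN'⟩ := ih'
    exact ⟨max N N', fun v v' h => or_congr (hN v v' fun i hi => h i (by omega))
      (hN' v v' fun i hi => h i (by omega))⟩
  | imp _ _ ih ih' =>
    obtain ⟨N, hN⟩ := ih
    obtain ⟨N', hN'⟩ := ih'
    exact ⟨max N N', fun v v' h => imp_congr (hN v v' fun i hi => h i (by omega))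
      (hN' v v' fun i hi => h i (by omega))⟩
  | ball x t _ ih =>
    obtain ⟨N, hN⟩ := ih
    obtain ⟨N', hN'⟩ := tval_fin (M := M) t
    refine ⟨max N N', fun v v' h => forall_congr' fun m => ?_⟩
    rw [hN' v v' fun i hi => h i (by omega)]
    exact imp_congr_right fun _ => hN _ _ (upd_congr (fun i hi => h i (by omega)) m)
  | bex x t _ ih =>
    obtain ⟨N, hN⟩ := ih
    obtain ⟨N', hN'⟩ := tval_fin (M := M) t
    refine ⟨max N N', fun v v' h => exists_congr fun m => ?_⟩
    rw [hN' v v' fun i hi => h i (by omega)]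
    exact and_congr_right fun _ => hN _ _ (upd_congr (fun i hi => h i (by omega)) m)

theorem Delta0.rename {φ : Fml} (h : Delta0 φ) : ∃ N0, ∀ N ≥ N0, ∀ σ : ℕ → ℕ, ∃ ψ, Delta0 ψ ∧
    ∀ v : ℕ → M, sat v ψ ↔ sat (fun i => v (N + σ i)) φ := by
  obtain ⟨N0, hN0⟩ := h.fin (M := M)
  refine ⟨N0, fun N hN σ => ?_⟩
  have key : ∀ k ≤ N, ∃ ψ, Delta0 ψ ∧
      ∀ v : ℕ → M, sat v ψ ↔ sat (fun i => if i < k then v (N + σ i) else v i) φ := by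
    intro k
    induction k with
    | zero => exact fun _ => ⟨φ, h, fun v => by simp⟩
    | succ k ih =>
      intro hk
      obtain ⟨ψ, h1, h2⟩ := ih (by omega)
      refine ⟨.bex k (.add (.var (N + σ k)) .one) (.and (.eq (.var k) (.var (N + σ k))) ψ),
        .bex _ _ (.and (.eq _ _) h1), fun v => ?_⟩
      have e : ∀ m, sat (upd v k m) (.and (.eq (.var k) (.var (N + σ k))) ψ) ↔
          m = v (N + σ k) ∧ sat (upd v k m) ψ := by
        intro m
        change upd v k m k = upd v k m (N + σ k) ∧ _ ↔ _
        rw [upd_same, upd_ne _ _ (by omega)]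
        rfl
      change (∃ m, m < v (N + σ k) + 1 ∧ sat (upd v k m) _) ↔ _
      simp only [e]
      have e2 : sat (upd v k (v (N + σ k))) ψ ↔
          sat (fun i => if i < k + 1 then v (N + σ i) else v i) φ := by
        rw [h2]
        have : (fun i => if i < k then upd v k (v (N + σ k)) (N + σ i)
            else upd v k (v (N + σ k)) i) = fun i => if i < k + 1 then v (N + σ i) else v i := by
          funext i
          rcases lt_trichotomy i k with hi | rfl | hi
          · rw [if_pos hi, if_pos (by omega), upd_ne _ _ (by omega)]
          · rw [if_neg (by omega), if_pos (by omega), upd_same]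
          · rw [if_neg (by omega), if_neg (by omega), upd_ne _ _ (by omega)]
        rw [this]
      rw [← e2]
      constructor
      · rintro ⟨m, _, rfl, hm⟩; exact hm
      · intro hm; exact ⟨_, lt_add_one _, rfl, hm⟩
  obtain ⟨ψ, h1, h2⟩ := key N le_rfl
  refine ⟨ψ, h1, fun v => (h2 v).trans (hN0 _ _ fun i hi => ?_)⟩
  rw [if_pos (by omega)]

/-- Relations defined by bounded formulas with parameters. -/
def D0 (Q : (ℕ → M) → Prop) : Prop :=
  ∃ φ, Delta0 φ ∧ ∃ ρ : ℕ → ℕ ⊕ M, ∀ v, Q v ↔ sat (fun i => Sum.elim v id (ρ i)) φ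

/-- A valuation with the parameters `c` and `v` placed at `N`, `N + 2`, `N + 4` and so on. -/
def val (N : ℕ) (c v : ℕ → M) (j : ℕ) : M :=
  if N ≤ j ∧ (j - N) % 2 = 0 then v ((j - N) / 2) else c j

theorem val_vc (N : ℕ) (c v : ℕ → M) (m : M) :
    val N c (vc m v) = upd (val (N + 2) c v) N m := by
  funext j
  unfold val upd
  by_cases h : j = N
  · subst h; simp
  · rw [if_neg h]
    by_cases h1 : N ≤ j ∧ (j - N) % 2 = 0
    · rw [if_pos h1]
      beta_reduce
      rw [if_pos (by omega)]
      obtain ⟨k, hk⟩ : ∃ k, (j - N) / 2 = k + 1 := ⟨(j - N) / 2 - 1, by omega⟩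
      rw [hk, vc_succ]
      congr 1
      omega
    · rw [if_neg h1]
      beta_reduce
      rw [if_neg (by omega)]

theorem val_head (N : ℕ) (c v : ℕ → M) : val N c v N = v 0 := by simp [val]

/-- `Q` is defined by a formula from `Γ`, in the normal form of `val`. -/
def Nice (Γ : Fml → Prop) (Q : (ℕ → M) → Prop) : Prop :=
  ∃ φ, Γ φ ∧ ∃ (N : ℕ) (c : ℕ → M), ∀ v, Q v ↔ sat (val N c v) φ

theorem D0.nice {Q : (ℕ → M) → Prop} (h : D0 Q) : Nice Delta0 Q := by
  obtain ⟨φ, hφ, ρ, h⟩ := h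
  obtain ⟨N, hN⟩ := hφ.rename (M := M)
  obtain ⟨ψ, h1, h2⟩ := hN N le_rfl fun i => (ρ i).elim (fun k => 2 * k) fun _ => 2 * i + 1
  refine ⟨ψ, h1, N, fun j => (ρ ((j - N) / 2)).elim (fun _ => 0) id, fun v => ?_⟩
  rw [h, h2]
  have : (fun i => Sum.elim v id (ρ i)) = fun i => val N (fun j => (ρ ((j - N) / 2)).elim
      (fun _ => 0) id) v (N + (ρ i).elim (fun k => 2 * k) fun _ => 2 * i + 1) := by
    funext i
    unfold val
    cases hi : ρ i with
    | inl k => simp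
    | inr a =>
      have e1 : (2 * i + 1) / 2 = i := by omega
      have e2 : (2 * i + 1) % 2 = 1 := by omega
      simp [e1, e2, hi]
  rw [this]

theorem Nice.d0 {Q : (ℕ → M) → Prop} (h : Nice Delta0 Q) : D0 Q := by
  obtain ⟨φ, hφ, N, c, h⟩ := h
  refine ⟨φ, hφ, fun j => if N ≤ j ∧ (j - N) % 2 = 0 then Sum.inl ((j - N) / 2)
    else Sum.inr (c j), fun v => ?_⟩
  rw [h]
  have : val N c v = fun j => Sum.elim v id (if N ≤ j ∧ (j - N) % 2 = 0 then Sum.inl ((j - N) / 2)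
    else Sum.inr (c j)) := by
    funext j
    unfold val
    split_ifs <;> rfl
  rw [this]

theorem D0.of_sat {φ : Fml} (h : Delta0 φ) : D0 fun v : ℕ → M => sat v φ :=
  ⟨φ, h, Sum.inl, fun _ => Iff.rfl⟩

theorem D0.sub {Q : (ℕ → M) → Prop} (τ : ℕ → ℕ ⊕ M) (h : D0 Q) :
    D0 fun v => Q fun i => Sum.elim v id (τ i) := by
  obtain ⟨φ, hφ, ρ, h⟩ := h
  refine ⟨φ, hφ, fun i => (ρ i).elim τ Sum.inr, fun v => ?_⟩
  beta_reduce
  rw [h]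
  have : (fun i => Sum.elim (fun i => Sum.elim v id (τ i)) id (ρ i)) =
      fun i => Sum.elim v id ((ρ i).elim τ Sum.inr) := by
    funext i
    cases ρ i <;> rfl
  rw [this]

theorem D0.not {Q : (ℕ → M) → Prop} (h : D0 Q) : D0 fun v => ¬ Q v := by
  obtain ⟨φ, hφ, ρ, h⟩ := h
  exact ⟨.not φ, .not hφ, ρ, fun v => not_congr (h v)⟩

theorem D0.and {P Q : (ℕ → M) → Prop} (hP : D0 P) (hQ : D0 Q) : D0 fun v => P v ∧ Q v := by
  obtain ⟨φ, hφ, ρ, h⟩ := hP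
  obtain ⟨ψ, hψ, τ, h'⟩ := hQ
  obtain ⟨N, hN⟩ := hφ.rename (M := M)
  obtain ⟨N', hN'⟩ := hψ.rename (M := M)
  obtain ⟨φ', h1, h2⟩ := hN (max N N') (le_max_left _ _)
    fun i => (ρ i).elim (fun k => 3 * k) fun _ => 3 * i + 1
  obtain ⟨ψ', h3, h4⟩ := hN' (max N N') (le_max_right _ _)
    fun i => (τ i).elim (fun k => 3 * k) fun _ => 3 * i + 2
  generalize max N N' = K at h2 h4
  let π : ℕ → ℕ ⊕ M := fun j => if (j - K) % 3 = 0 then Sum.inl ((j - K) / 3) else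
    if (j - K) % 3 = 1 then ρ ((j - K) / 3) else τ ((j - K) / 3)
  refine ⟨.and φ' ψ', .and h1 h3, π, fun v => ?_⟩
  change _ ↔ sat _ φ' ∧ sat _ ψ'
  beta_reduce
  rw [h, h', h2, h4]
  have e1 : (fun i => Sum.elim v id (ρ i)) = fun i => Sum.elim v id
      (π (K + (ρ i).elim (fun k => 3 * k) fun _ => 3 * i + 1)) := by
    funext i
    cases hi : ρ i with
    | inl k => simp [π]
    | inr a =>
      have e1 : (3 * i + 1) / 3 = i := by omega
      have e2 : (3 * i + 1) % 3 = 1 := by omega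
      simp [π, e1, e2, hi]
  have e2 : (fun i => Sum.elim v id (τ i)) = fun i => Sum.elim v id
      (π (K + (τ i).elim (fun k => 3 * k) fun _ => 3 * i + 2)) := by
    funext i
    cases hi : τ i with
    | inl k => simp [π]
    | inr a =>
      have e1 : (3 * i + 2) / 3 = i := by omega
      have e2 : (3 * i + 2) % 3 = 2 := by omega
      simp [π, e1, e2, hi]
  rw [← e1, ← e2]

theorem D0.bex {Q : (ℕ → M) → Prop} (h : D0 Q) : D0 fun v => ∃ m, m < v 0 ∧ Q (vc m v) := by
  obtain ⟨φ, hφ, N, c, h⟩ := h.nice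
  refine Nice.d0 ⟨.bex N (.var (N + 2)) φ, .bex _ _ hφ, N + 2, c, fun v => ?_⟩
  change _ ↔ ∃ m, m < val (N + 2) c v (N + 2) ∧ sat (upd (val (N + 2) c v) N m) φ
  simp only [h, val_vc, val_head]

theorem D0.congr {P Q : (ℕ → M) → Prop} (h : D0 P) (e : ∀ v, P v ↔ Q v) : D0 Q :=
  (funext fun v => propext (e v) : P = Q) ▸ h

theorem D0.or {P Q : (ℕ → M) → Prop} (hP : D0 P) (hQ : D0 Q) : D0 fun v => P v ∨ Q v :=
  (hP.not.and hQ.not).not.congr fun v => by tauto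

theorem D0.ball {Q : (ℕ → M) → Prop} (h : D0 Q) : D0 fun v => ∀ m, m < v 0 → Q (vc m v) :=
  h.not.bex.not.congr fun v => by push Not; rfl

theorem D0.comp {P : (ℕ → M) → Prop} (hP : D0 P) (h : (ℕ → M) → (ℕ → M)) [hh : VMap h] :
    D0 fun v => P (h v) := by
  obtain ⟨ρ, hρ⟩ := hh.out
  refine (hP.sub ρ).congr fun v => ?_
  have : h v = fun i => Sum.elim v id (ρ i) := funext (hρ v)
  rw [this]

theorem D0.induction (hI : IndFor (toStr M) Delta0) {Q : (ℕ → M) → Prop} (h : D0 Q) (v : ℕ → M)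
    (h0 : Q (vc 0 v)) (hs : ∀ m, Q (vc m v) → Q (vc (m + 1) v)) (m : M) : Q (vc m v) := by
  obtain ⟨φ, hφ, N, c, h⟩ := h.nice
  simp only [h, val_vc] at *
  exact hI φ hφ _ N h0 hs m

/-- The least number principle for `R`, in the first variable. -/
def Lnp (R : (ℕ → M) → Prop) : Prop :=
  ∀ v m, R (vc m v) → ∃ m, R (vc m v) ∧ ∀ k < m, ¬ R (vc k v)

theorem D0.lnp (hI : IndFor (toStr M) Delta0) {R : (ℕ → M) → Prop} (h : D0 R) : Lnp R := by
  intro v m hm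
  by_contra hc
  push Not at hc
  have h1 : D0 fun v => R (vc (v 0) (tl (tl v))) := h.comp fun v => vc (v 0) (tl (tl v))
  have h2 : ∀ j, ∀ k, k < j → ¬ R (vc k v) := by
    refine D0.induction hI h1.not.ball v ?_ ?_
    · intro k hk; exact absurd hk (not_lt.2 zero_le)
    · intro j ih k hk hR
      obtain ⟨i, hi, hRi⟩ := hc k hR
      exact ih i (lt_of_lt_of_le hi (lt_succ.1 hk)) hRi
  exact h2 (m + 1) m (lt_add_one m) hm

end

section
variable {M : Type} [Arith M]

/-- Closure of a class of relations under substitution, positive Boolean combinations and bounded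
quantification. -/
structure Cl (H : ((ℕ → M) → Prop) → Prop) : Prop where
  sub : ∀ {Q} (ρ : ℕ → ℕ ⊕ M), H Q → H fun v => Q fun i => Sum.elim v id (ρ i)
  and : ∀ {P Q}, H P → H Q → H fun v => P v ∧ Q v
  or : ∀ {P Q}, H P → H Q → H fun v => P v ∨ Q v
  ball : ∀ {Q}, H Q → H fun v => ∀ m, m < v 0 → Q (vc m v)
  bex : ∀ {Q}, H Q → H fun v => ∃ m, m < v 0 ∧ Q (vc m v)
  lt : H fun v => v 0 < v 1
  add : H fun v => v 0 + v 1 = v 2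
  mul : H fun v => v 0 * v 1 = v 2

theorem D0.cl : Cl (D0 : ((ℕ → M) → Prop) → Prop) where
  sub := D0.sub
  and := D0.and
  or := D0.or
  ball := D0.ball
  bex := D0.bex
  lt := D0.of_sat (.lt (.var 0) (.var 1))
  add := D0.of_sat (.eq (.add (.var 0) (.var 1)) (.var 2))
  mul := D0.of_sat (.eq (.mul (.var 0) (.var 1)) (.var 2))

variable {H : ((ℕ → M) → Prop) → Prop}

theorem Cl.comp (hc : Cl H) {P : (ℕ → M) → Prop} (hP : H P) (h : (ℕ → M) → (ℕ → M))
    [hh : VMap h] : H fun v => P (h v) := by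
  obtain ⟨ρ, hρ⟩ := hh.out
  have : (fun v => P (h v)) = fun v => P fun i => Sum.elim v id (ρ i) :=
    funext fun v => congrArg P (funext (hρ v))
  rw [this]
  exact hc.sub ρ hP

theorem class_congr {P Q : (ℕ → M) → Prop} (h : H P) (e : ∀ v, P v ↔ Q v) : H Q :=
  (funext fun v => propext (e v) : P = Q) ▸ h

/-- Projections of complements of relations in `H`. -/
def Next (H : ((ℕ → M) → Prop) → Prop) (Q : (ℕ → M) → Prop) : Prop :=
  ∃ R, H R ∧ ∀ v, Q v ↔ ∃ m, ¬ R (vc m v)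

/-- Collection for the complement of `Q`. -/
def B2 (Q : (ℕ → M) → Prop) : Prop :=
  ∀ v a, (∀ i < a, ∃ b, ¬ Q (vc b (vc i v))) → ∃ B, ∀ i < a, ∃ b < B, ¬ Q (vc b (vc i v))

theorem Cl.co_next (hc : Cl H) {R : (ℕ → M) → Prop} (h : H R) : Next H fun v => ¬ R v :=
  ⟨fun v => R (tl v), hc.comp h tl, fun v => by simp⟩

theorem Next.mono {H' : ((ℕ → M) → Prop) → Prop} (hm : ∀ Q, H Q → H' Q) {Q : (ℕ → M) → Prop}
    (h : Next H Q) : Next H' Q := by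
  obtain ⟨R, hR, h⟩ := h
  exact ⟨R, hm R hR, h⟩

/-- `∀ w < b, R w` with the remaining variables not including `b`. -/
theorem Cl.ball' (hc : Cl H) {R : (ℕ → M) → Prop} (h : H R) :
    H fun v => ∀ w, w < v 0 → R (vc w (tl v)) :=
  hc.ball (hc.comp h fun v => vc (v 0) (tl (tl v)))

theorem Cl.next_ex (hc : Cl H) {Q : (ℕ → M) → Prop} (h : Next H Q) :
    Next H fun v => ∃ m, Q (vc m v) := by
  obtain ⟨R, hR, h⟩ := h
  have h1 := hc.ball' hR
  have h2 := hc.ball (hc.comp h1 fun v => vc (v 1) (vc (v 0) (tl (tl v))))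
  refine ⟨_, h2, fun v => ?_⟩
  simp only [h]
  constructor
  · rintro ⟨m, w, hw⟩
    refine ⟨max m w + 1, fun hc => hw ?_⟩
    exact hc m (lt_succ.2 (le_max_left _ _)) w (lt_succ.2 (le_max_right _ _))
  · rintro ⟨b, hb⟩
    push Not at hb
    obtain ⟨m, _, w, _, hw⟩ := hb
    exact ⟨m, w, hw⟩

theorem Cl.next (hc : Cl H) (hm : ∀ Q, H Q → Next H Q) (hb : ∀ Q, H Q → B2 Q) : Cl (Next H) := by
  have hsub : ∀ {Q : (ℕ → M) → Prop} (ρ : ℕ → ℕ ⊕ M), Next H Q →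
      Next H fun v => Q fun i => Sum.elim v id (ρ i) := by
    rintro Q ρ ⟨R, hR, h⟩
    have : VMap fun v : ℕ → M => vc (v 0) fun i => Sum.elim (tl v) id (ρ i) := by
      refine VMap.vc_var (g := fun v => v) (h := fun v i => Sum.elim (tl v) id (ρ i))
        (hh := ⟨fun i => (ρ i).elim (fun k => Sum.inl (k + 1)) Sum.inr, fun v i => ?_⟩) 0
      beta_reduce
      cases ρ i <;> rfl
    refine ⟨_, hc.comp hR fun v => vc (v 0) fun i => Sum.elim (tl v) id (ρ i), fun v => ?_⟩
    simp only [h]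
    rfl
  have hand : ∀ {P Q : (ℕ → M) → Prop}, Next H P → Next H Q → Next H fun v => P v ∧ Q v := by
    rintro P Q ⟨R, hR, h⟩ ⟨R', hR', h'⟩
    refine ⟨_, hc.or (hc.ball' hR) (hc.ball' hR'), fun v => ?_⟩
    simp only [h, h', vc_zero, tl_vc]
    constructor
    · rintro ⟨⟨m, hm⟩, m', hm'⟩
      refine ⟨max m m' + 1, ?_⟩
      rintro (hc | hc)
      · exact hm (hc m (lt_succ.2 (le_max_left _ _)))
      · exact hm' (hc m' (lt_succ.2 (le_max_right _ _)))
    · rintro ⟨b, hb⟩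
      push Not at hb
      obtain ⟨⟨m, _, hm⟩, m', _, hm'⟩ := hb
      exact ⟨⟨m, hm⟩, m', hm'⟩
  have hlt : Next H fun v => v 0 < v 1 := hm _ hc.lt
  refine ⟨hsub, hand, ?_, ?_, ?_, hlt, hm _ hc.add, hm _ hc.mul⟩
  · rintro P Q ⟨R, hR, h⟩ ⟨R', hR', h'⟩
    refine ⟨_, hc.and hR hR', fun v => ?_⟩
    simp only [h, h']
    rw [← exists_or]
    exact exists_congr fun m => by tauto
  · rintro Q ⟨R, hR, h⟩
    have h1 := hc.ball' hR
    have h2 := hc.bex (hc.comp h1 fun v => vc (v 2) (vc (v 0) (tl (tl (tl v)))))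
    have h3 := hc.comp h2 fun v => vc (v 1) v
    refine ⟨_, h3, fun v => ?_⟩
    simp only [h]
    constructor
    · intro hq
      obtain ⟨B, hB⟩ := hb R hR v (v 0) hq
      refine ⟨B, ?_⟩
      rintro ⟨m, hm, hw⟩
      obtain ⟨w, hwB, hR'⟩ := hB m hm
      exact hR' (hw w hwB)
    · rintro ⟨B, hB⟩ m hm
      by_contra hc
      push Not at hc
      exact hB ⟨m, hm, fun w _ => hc w⟩
  · intro Q hQ
    have h1 : Next H fun v => v 0 < v 1 ∧ Q v := hand hlt hQ
    exact hc.next_ex h1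

theorem lnp_of_bounded {P P' : (ℕ → M) → Prop} (h : Lnp P') (v v' : ℕ → M) (m : M)
    (hm : P (vc m v)) (e : ∀ i ≤ m, P (vc i v) ↔ P' (vc i v')) :
    ∃ m, P (vc m v) ∧ ∀ k < m, ¬ P (vc k v) := by
  obtain ⟨l, hl, hl'⟩ := h v' m ((e m le_rfl).1 hm)
  have hlm : l ≤ m := by
    by_contra hc
    exact hl' m (not_le.1 hc) ((e m le_rfl).1 hm)
  refine ⟨l, (e l hlm).2 hl, fun k hk hP => hl' k hk ((e k (hk.le.trans hlm)).1 hP)⟩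

theorem Cl.next_lnp (hc : Cl H) (hm : ∀ Q, H Q → Next H Q) (hb : ∀ Q, H Q → B2 Q)
    (hb' : ∀ Q, Next H Q → B2 Q) (hl : ∀ Q, H Q → Lnp Q ∧ Lnp fun v => ¬ Q v)
    {Q : (ℕ → M) → Prop} (hQ : Next H Q) : Lnp Q ∧ Lnp fun v => ¬ Q v := by
  have hc' := hc.next hm hb
  obtain ⟨R, hR, h⟩ := id hQ
  have key : ∀ v a, ∃ B, ∀ i < a, Q (vc i v) ↔ ∃ w < B, ¬ R (vc w (vc i v)) := by
    intro v a
    have h1 : Next H fun v => R v ∧ Q (tl v) := hc'.and (hm R hR) (hc'.comp hQ tl)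
    obtain ⟨B, hB⟩ := hb' _ h1 v a (fun i hi => by
      by_cases hq : Q (vc i v)
      · obtain ⟨w, hw⟩ := (h _).1 hq
        exact ⟨w, fun hc => hw hc.1⟩
      · exact ⟨0, fun hc => hq hc.2⟩)
    refine ⟨B, fun i hi => ⟨fun hq => ?_, fun ⟨w, _, hw⟩ => (h _).2 ⟨w, hw⟩⟩⟩
    obtain ⟨w, hw, hw'⟩ := hB i hi
    exact ⟨w, hw, fun hr => hw' ⟨hr, hq⟩⟩
  have h2 : H fun v => ∀ w, w < v 1 → R (vc w (vc (v 0) (tl (tl v)))) :=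
    hc.comp (hc.ball' hR) fun v => vc (v 1) (vc (v 0) (tl (tl v)))
  constructor
  · intro v m hm
    obtain ⟨B, hB⟩ := key v (m + 1)
    refine lnp_of_bounded (hl _ h2).2 v (vc B v) m hm fun i hi => ?_
    rw [hB i (lt_succ.2 hi)]
    simp
  · intro v m hm
    obtain ⟨B, hB⟩ := key v (m + 1)
    refine lnp_of_bounded (P := fun v => ¬ Q v) (hl _ h2).1 v (vc B v) m hm fun i hi => ?_
    rw [hB i (lt_succ.2 hi)]
    simp

/-- The class of projections of complements of `H`, as an abstract class. -/
def Cl.sclass (hc : Cl H) (hm : ∀ Q, H Q → Next H Q) (hb : ∀ Q, H Q → B2 Q)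
    (hb' : ∀ Q, Next H Q → B2 Q) (hl : ∀ Q, H Q → Lnp Q ∧ Lnp fun v => ¬ Q v) : SClass M where
  mem := Next H
  sub := (hc.next hm hb).sub
  add_mem := (hc.next hm hb).add
  mul_mem := (hc.next hm hb).mul
  lt_mem := (hc.next hm hb).lt
  and_mem := (hc.next hm hb).and
  or_mem := (hc.next hm hb).or
  ex_mem := hc.next_ex
  ball_mem := (hc.next hm hb).ball
  nf := by
    rintro Q ⟨R, hR, h⟩
    exact ⟨fun v => ¬ R v, hc.co_next hR, class_congr (hm R hR) fun v => by simp, h⟩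
  lnp := fun hR _ => (hc.next_lnp hm hb hb' hl hR).1
  b2 := fun hQ => hb' _ hQ

/-- The levels of the arithmetical hierarchy. -/
def Hs : ℕ → ((ℕ → M) → Prop) → Prop
  | 0 => D0
  | k + 1 => Next (Hs k)

theorem Hs.mono (k : ℕ) : ∀ Q : (ℕ → M) → Prop, Hs k Q → Hs (k + 1) Q := by
  induction k with
  | zero =>
    intro Q hQ
    exact class_congr (D0.cl.co_next hQ.not) fun v => by simp
  | succ k ih => exact fun Q hQ => Next.mono ih hQ

theorem Hs.le {k l : ℕ} (h : k ≤ l) {Q : (ℕ → M) → Prop} (hQ : Hs k Q) : Hs l Q := by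
  induction h with
  | refl => exact hQ
  | step _ ih => exact Hs.mono _ _ ih

theorem Hs.nice (k : ℕ) : ∀ Q : (ℕ → M) → Prop, Hs k Q →
    Nice (IsSigma k) Q ∧ Nice (IsPi k) fun v => ¬ Q v := by
  induction k with
  | zero =>
    intro Q hQ
    obtain ⟨φ, h, h'⟩ := D0.nice hQ
    obtain ⟨ψ, g, g'⟩ := (D0.not hQ).nice
    exact ⟨⟨φ, .delta0 h, h'⟩, ψ, .delta0 g, g'⟩
  | succ k ih =>
    rintro Q ⟨R, hR, h⟩
    obtain ⟨⟨φ, h1, N, c, h2⟩, ψ, g1, N', c', g2⟩ := ih R hR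
    refine ⟨⟨.ex N' ψ, .ex _ (.ofPi g1), N' + 2, c', fun v => ?_⟩,
      .all N φ, .all _ (.ofSigma h1), N + 2, c, fun v => ?_⟩
    · rw [h]
      simp only [g2, val_vc]
      rfl
    · beta_reduce
      rw [h]
      push Not
      simp only [h2, val_vc]
      rfl

theorem Hs.b2 {k : ℕ} (hB : CollFor (toStr M) (IsSigma (k + 1))) {Q : (ℕ → M) → Prop}
    (hQ : Hs k Q) : B2 Q := by
  obtain ⟨_, φ, h, N, c, h'⟩ := Hs.nice k Q hQ
  intro v a hyp
  simp only [h', val_vc] at hyp ⊢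
  exact hB φ (.ofPi h) _ (N + 2) N (by omega) a hyp

theorem Hs.cl {n : ℕ} (hB : ∀ Q : (ℕ → M) → Prop, Hs n Q → B2 Q) (k : ℕ) (hk : k ≤ n + 1) :
    Cl (Hs k : ((ℕ → M) → Prop) → Prop) := by
  induction k with
  | zero => exact D0.cl
  | succ k ih =>
    exact (ih (by omega)).next (Hs.mono k) fun Q hQ => hB Q (Hs.le (by omega) hQ)

theorem Hs.lnp {n : ℕ} (hI : IndFor (toStr M) Delta0) (hB : ∀ Q : (ℕ → M) → Prop, Hs n Q → B2 Q)
    (k : ℕ) (hk : k ≤ n) : ∀ Q : (ℕ → M) → Prop, Hs k Q → Lnp Q ∧ Lnp fun v => ¬ Q v := by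
  induction k with
  | zero => exact fun Q hQ => ⟨D0.lnp hI hQ, D0.lnp hI (D0.not hQ)⟩
  | succ k ih =>
    exact fun Q hQ => (Hs.cl hB k (by omega)).next_lnp (Hs.mono k)
      (fun Q hQ => hB Q (Hs.le (by omega) hQ)) (fun Q hQ => hB Q (Hs.le hk hQ))
      (ih (by omega)) hQ

/-- The `Σ_{k+1}` relations as an abstract class. -/
def Hs.sclass {n : ℕ} (hI : IndFor (toStr M) Delta0)
    (hB : ∀ Q : (ℕ → M) → Prop, Hs n Q → B2 Q) (k : ℕ) (hk : k + 1 ≤ n) : SClass M :=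
  (Hs.cl hB k (by omega)).sclass (Hs.mono k) (fun Q hQ => hB Q (Hs.le (by omega) hQ))
    (fun Q hQ => hB Q (Hs.le hk hQ)) (Hs.lnp hI hB k (by omega))

theorem Cl.upd {H : ((ℕ → M) → Prop) → Prop} (hc : Cl H) {Q : (ℕ → M) → Prop} (h : H Q) (x : ℕ) :
    H fun u => Q (upd (tl u) x (u 0)) := by
  have : VMap fun u : ℕ → M => PaperArith.upd (tl u) x (u 0) := by
    refine ⟨fun i => if i = x then Sum.inl 0 else Sum.inl (i + 1), fun v i => ?_⟩
    beta_reduce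
    unfold PaperArith.upd
    split_ifs <;> rfl
  exact hc.comp h fun u => PaperArith.upd (tl u) x (u 0)

mutual
theorem IsSigma.hs {n : ℕ} (hB : ∀ Q : (ℕ → M) → Prop, Hs n Q → B2 Q) {k : ℕ} {φ : Fml}
    (h : IsSigma k φ) (hk : k ≤ n + 1) : Hs k fun v : ℕ → M => sat v φ := by
  match h with
  | .delta0 h => exact Hs.le (Nat.zero_le k) (D0.of_sat h)
  | .ofPi h =>
    exact class_congr ((Hs.cl hB _ (by omega)).co_next (IsPi.hs hB h (by omega)))
      fun v => not_not
  | .ex x h =>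
    exact (Hs.cl hB _ (by omega)).next_ex ((Hs.cl hB _ hk).upd (IsSigma.hs hB h hk) x)
theorem IsPi.hs {n : ℕ} (hB : ∀ Q : (ℕ → M) → Prop, Hs n Q → B2 Q) {k : ℕ} {φ : Fml}
    (h : IsPi k φ) (hk : k ≤ n + 1) : Hs k fun v : ℕ → M => ¬ sat v φ := by
  match h with
  | .delta0 h => exact Hs.le (Nat.zero_le k) (D0.of_sat h).not
  | .ofSigma h => exact (Hs.cl hB _ (by omega)).co_next (IsSigma.hs hB h (by omega))
  | .all x h =>
    exact class_congr ((Hs.cl hB _ (by omega)).next_ex ((Hs.cl hB _ hk).upd (IsPi.hs hB h hk) x))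
      fun v => not_forall.symm
end

end

section
variable {M : Type} [Arith M]

/-- The local correctness condition for the triple `(e, z, w)`, asserting that the program `e`
has the value `w` at `z`, with respect to the coded set `t` of such triples. -/
def Rule (e z w t : M) : Prop :=
  (fs e = 0 → w = sn e) ∧ (fs e = 1 → w = fs z) ∧ (fs e = 2 → w = sn z) ∧
  (fs e = 3 → ∃ x < t, ∃ y < t, mm (pr (pr (fs (sn e)) z) x) t ∧
    mm (pr (pr (sn (sn e)) z) y) t ∧ w = x + y) ∧
  (fs e = 4 → ∃ x < t, ∃ y < t, mm (pr (pr (fs (sn e)) z) x) t ∧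
    mm (pr (pr (sn (sn e)) z) y) t ∧ w = x * y) ∧
  (fs e = 5 → ∃ x < t, ∃ y < t, mm (pr (pr (fs (sn e)) z) x) t ∧
    mm (pr (pr (sn (sn e)) z) y) t ∧ (x < y ∧ w = 1 ∨ ¬ x < y ∧ w = 0)) ∧
  (fs e = 6 → ∃ x < t, mm (pr (pr (sn (sn e)) z) x) t ∧ mm (pr (pr (fs (sn e)) x) w) t) ∧
  (fs e = 7 → ∃ x < t, mm (pr (pr (fs (sn e)) z) x) t ∧
    ((w = 1 ∧ ∃ m < x, mm (pr (pr (sn (sn e)) (pr m z)) 1) t) ∨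
      w = 0 ∧ ∀ m < x, mm (pr (pr (sn (sn e)) (pr m z)) 0) t))

theorem mm_right_lt {a x t : M} (h : mm (pr a x) t) : x < t := (right_le_pr a x).trans_lt (mm_lt h)

theorem Rule.mono {e z w t t' : M} (h : Rule e z w t) (ht : ∀ i, mm i t → mm i t') :
    Rule e z w t' := by
  obtain ⟨h0, h1, h2, h3, h4, h5, h6, h7⟩ := h
  refine ⟨h0, h1, h2, fun he => ?_, fun he => ?_, fun he => ?_, fun he => ?_, fun he => ?_⟩
  · obtain ⟨x, _, y, _, hx, hy, h⟩ := h3 he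
    exact ⟨x, mm_right_lt (ht _ hx), y, mm_right_lt (ht _ hy), ht _ hx, ht _ hy, h⟩
  · obtain ⟨x, _, y, _, hx, hy, h⟩ := h4 he
    exact ⟨x, mm_right_lt (ht _ hx), y, mm_right_lt (ht _ hy), ht _ hx, ht _ hy, h⟩
  · obtain ⟨x, _, y, _, hx, hy, h⟩ := h5 he
    exact ⟨x, mm_right_lt (ht _ hx), y, mm_right_lt (ht _ hy), ht _ hx, ht _ hy, h⟩
  · obtain ⟨x, _, hx, hy⟩ := h6 he
    exact ⟨x, mm_right_lt (ht _ hx), ht _ hx, ht _ hy⟩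
  · obtain ⟨x, _, hx, h⟩ := h7 he
    refine ⟨x, mm_right_lt (ht _ hx), ht _ hx, h.imp ?_ ?_⟩
    · rintro ⟨hw, m, hm, h⟩
      exact ⟨hw, m, hm, ht _ h⟩
    · rintro ⟨hw, h⟩
      exact ⟨hw, fun m hm => ht _ (h m hm)⟩

/-- `t` codes a set of locally correct triples. -/
def Valid (t : M) : Prop := ∀ i < t, mm i t → Rule (fs (fs i)) (sn (fs i)) (sn i) t

theorem Valid.rule {t e z w : M} (h : Valid t) (hm : mm (pr (pr e z) w) t) : Rule e z w t := by
  simpa using h _ (mm_lt hm) hm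

variable (C : SClass M)

instance Rec.rule {f g h k : (ℕ → M) → M} [Fn C f] [Fn C g] [Fn C h] [Fn C k] :
    Rec C fun v => Rule (f v) (g v) (h v) (k v) := by
  unfold Rule
  refine Rec.and (hQ := Rec.and (hQ := Rec.and (hQ := Rec.and (hQ := Rec.and (hQ := Rec.and
    (hQ := Rec.and))))))

instance Valid.rec : Rec1 C (Valid : M → Prop) := by
  constructor
  unfold Valid
  infer_instance

theorem exists_valid_union {P : M → Prop} [hP : Sig C fun v => P (v 0)] (B : M)
    (hv : ∀ t, P t → Valid t) : ∃ s, Valid s ∧ ∀ t < B, P t → ∀ i, mm i t → mm i s := by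
  obtain ⟨s, hs⟩ := exists_code C (P := fun i => ∃ t < B, P t ∧ mm i t) B
  have hsub : ∀ t < B, P t → ∀ i, mm i t → mm i s := fun t ht hP i hi =>
    (hs i).2 ⟨(mm_lt hi).trans ht, t, ht, hP, hi⟩
  refine ⟨s, fun i _ hi => ?_, hsub⟩
  obtain ⟨_, t, ht, hP, hi⟩ := (hs i).1 hi
  exact (hv t hP i (mm_lt hi) hi).mono (hsub t ht hP)

/-- `e` is a program computing `f`. -/
def Code (e : M) (f : M → M) : Prop :=
  (∀ z, ∃ t, Valid t ∧ mm (pr (pr e z) (f z)) t) ∧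
    ∀ z w t, Valid t → mm (pr (pr e z) w) t → w = f z

theorem Code.of_rule (C : SClass M) {e : M} {f : M → M} (h : ∀ z, ∃ t, Valid t ∧ Rule e z (f z) t)
    (h' : ∀ z w t, Valid t → Rule e z w t → w = f z) : Code e f := by
  refine ⟨fun z => ?_, fun z w t hv hm => h' z w t hv (hv.rule hm)⟩
  obtain ⟨t, hv, hr⟩ := h z
  obtain ⟨s, hs⟩ := exists_code C (P := fun i => mm i t ∨ i = pr (pr e z) (f z))
    (max t (pr (pr e z) (f z) + 1))
  have hsub : ∀ i, mm i t → mm i s := fun i hi =>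
    (hs i).2 ⟨lt_max_of_lt_left (mm_lt hi), Or.inl hi⟩
  refine ⟨s, fun i _ hi => ?_, (hs _).2 ⟨lt_max_of_lt_right (lt_add_one _), Or.inr rfl⟩⟩
  rcases ((hs i).1 hi).2 with hi | rfl
  · exact (hv i (mm_lt hi) hi).mono hsub
  · simpa using hr.mono hsub

theorem Code.pair (C : SClass M) {d e : M} {f g : M → M} (hf : Code d f) (hg : Code e g) (z y : M) :
    ∃ t, Valid t ∧ mm (pr (pr d z) (f z)) t ∧ mm (pr (pr e y) (g y)) t := by
  obtain ⟨t, ht, h⟩ := hf.1 z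
  obtain ⟨t', ht', h'⟩ := hg.1 y
  obtain ⟨s, hs, hs'⟩ := exists_valid_union C (P := fun i => i = t ∨ i = t') (max t t' + 1) (by
    rintro _ (rfl | rfl) <;> assumption)
  exact ⟨s, hs, hs' t (lt_succ.2 (le_max_left _ _)) (Or.inl rfl) _ h,
    hs' t' (lt_succ.2 (le_max_right _ _)) (Or.inr rfl) _ h'⟩

/-- `f` is computed by some program. -/
def HasCode (f : M → M) : Prop := ∃ e, Code e f

theorem valid_zero : Valid (0 : M) := fun i hi => absurd hi (not_lt.2 zero_le)

theorem HasCode.const (C : SClass M) (a : M) : HasCode fun _ => a :=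
  ⟨pr 0 a, Code.of_rule C (fun z => ⟨0, valid_zero, by simp [Rule]⟩)
    fun z w t hv hr => by simpa using hr.1 (by simp)⟩

theorem HasCode.fs (C : SClass M) : HasCode (fs : M → M) :=
  ⟨pr 1 0, Code.of_rule C (fun z => ⟨0, valid_zero, by simp [Rule]⟩)
    fun z w t hv hr => by simpa using hr.2.1 (by simp)⟩

theorem HasCode.sn (C : SClass M) : HasCode (sn : M → M) :=
  ⟨pr 2 0, Code.of_rule C (fun z => ⟨0, valid_zero, by simp [Rule]⟩)
    fun z w t hv hr => by simpa using hr.2.2.1 (by simp)⟩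

variable {C} {f g : M → M}

theorem HasCode.add (C : SClass M) (hf : HasCode f) (hg : HasCode g) :
    HasCode fun z => f z + g z := by
  obtain ⟨d, hd⟩ := hf
  obtain ⟨e, he⟩ := hg
  refine ⟨pr 3 (pr d e), Code.of_rule C (fun z => ?_) fun z w t hv hr => ?_⟩
  · obtain ⟨t, ht, h1, h2⟩ := hd.pair C he z z
    exact ⟨t, ht, by simpa [Rule] using
      ⟨_, mm_right_lt h1, _, mm_right_lt h2, h1, h2, rfl⟩⟩
  · obtain ⟨x, _, y, _, hx, hy, h⟩ := hr.2.2.2.1 (by simp)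
    rw [h, hd.2 z x t hv (by simpa using hx), he.2 z y t hv (by simpa using hy)]

theorem HasCode.mul (C : SClass M) (hf : HasCode f) (hg : HasCode g) :
    HasCode fun z => f z * g z := by
  obtain ⟨d, hd⟩ := hf
  obtain ⟨e, he⟩ := hg
  refine ⟨pr 4 (pr d e), Code.of_rule C (fun z => ?_) fun z w t hv hr => ?_⟩
  · obtain ⟨t, ht, h1, h2⟩ := hd.pair C he z z
    exact ⟨t, ht, by simpa [Rule] using
      ⟨_, mm_right_lt h1, _, mm_right_lt h2, h1, h2, rfl⟩⟩
  · obtain ⟨x, _, y, _, hx, hy, h⟩ := hr.2.2.2.2.1 (by simp)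
    rw [h, hd.2 z x t hv (by simpa using hx), he.2 z y t hv (by simpa using hy)]

open Classical in
/-- The truth value of a proposition as an element of `M`. -/
noncomputable def chi (p : Prop) : M := if p then 1 else 0

theorem chi_true {p : Prop} (h : p) : (chi p : M) = 1 := if_pos h
theorem chi_false {p : Prop} (h : ¬ p) : (chi p : M) = 0 := if_neg h
theorem chi_eq_one {p : Prop} : (chi p : M) = 1 ↔ p := by
  by_cases h : p <;> simp [chi, h]
theorem chi_lt_one {p : Prop} : (chi p : M) < 1 ↔ ¬ p := by
  by_cases h : p <;> simp [chi, h]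

theorem HasCode.lt (C : SClass M) (hf : HasCode f) (hg : HasCode g) :
    HasCode fun z => chi (f z < g z) := by
  obtain ⟨d, hd⟩ := hf
  obtain ⟨e, he⟩ := hg
  refine ⟨pr 5 (pr d e), Code.of_rule C (fun z => ?_) fun z w t hv hr => ?_⟩
  · obtain ⟨t, ht, h1, h2⟩ := hd.pair C he z z
    refine ⟨t, ht, ?_⟩
    have : ∃ x < t, ∃ y < t, mm (pr (pr d z) x) t ∧ mm (pr (pr e z) y) t ∧
        (x < y ∧ (chi (f z < g z) : M) = 1 ∨ ¬ x < y ∧ (chi (f z < g z) : M) = 0) := by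
      refine ⟨_, mm_right_lt h1, _, mm_right_lt h2, h1, h2, ?_⟩
      by_cases h : f z < g z
      · exact Or.inl ⟨h, chi_true h⟩
      · exact Or.inr ⟨h, chi_false h⟩
    simp [Rule, -not_lt]
    exact this
  · obtain ⟨x, _, y, _, hx, hy, h⟩ := hr.2.2.2.2.2.1 (by simp)
    rw [hd.2 z x t hv (by simpa using hx), he.2 z y t hv (by simpa using hy)] at h
    rcases h with ⟨h, rfl⟩ | ⟨h, rfl⟩
    · exact (chi_true h).symm
    · exact (chi_false h).symm

theorem HasCode.comp (C : SClass M) (hf : HasCode f) (hg : HasCode g) :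
    HasCode fun z => f (g z) := by
  obtain ⟨d, hd⟩ := hf
  obtain ⟨e, he⟩ := hg
  refine ⟨pr 6 (pr d e), Code.of_rule C (fun z => ?_) fun z w t hv hr => ?_⟩
  · obtain ⟨t, ht, h1, h2⟩ := hd.pair C he (g z) z
    exact ⟨t, ht, by simpa [Rule] using ⟨_, mm_right_lt h2, h2, h1⟩⟩
  · obtain ⟨x, _, hx, hy⟩ := hr.2.2.2.2.2.2.1 (by simp)
    have h1 := he.2 z x t hv (by simpa using hx)
    subst h1
    exact hd.2 _ _ t hv (by simpa using hy)

theorem HasCode.bex (C : SClass M) {p : M → M → Prop} (hf : HasCode f)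
    (hp : HasCode fun u => chi (p (PaperArith.fs u) (PaperArith.sn u))) :
    HasCode fun z => chi (∃ m < f z, p m z) := by
  obtain ⟨d, hd⟩ := hf
  obtain ⟨e, he⟩ := hp
  refine ⟨pr 7 (pr d e), Code.of_rule C (fun z => ?_) fun z w t hv hr => ?_⟩
  · have : ∃ t, Valid t ∧ ∃ x < t, mm (pr (pr d z) x) t ∧
        (((chi (∃ m < f z, p m z) : M) = 1 ∧ ∃ m < x, mm (pr (pr e (pr m z)) 1) t) ∨
        (chi (∃ m < f z, p m z) : M) = 0 ∧ ∀ m < x, mm (pr (pr e (pr m z)) 0) t) := by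
      by_cases h : ∃ m < f z, p m z
      · obtain ⟨m, hm, hpm⟩ := id h
        obtain ⟨t, ht, h1, h2⟩ := hd.pair C he z (pr m z)
        rw [chi_true (by simpa using hpm)] at h2
        exact ⟨t, ht, f z, mm_right_lt h1, h1, Or.inl ⟨chi_true h, m, hm, h2⟩⟩
      · push Not at h
        obtain ⟨s, hs, hs'⟩ := hd.1 z
        obtain ⟨B, hB⟩ := sig_collection C (a := f z)
          (P := fun m t => Valid t ∧ mm (pr (pr e (pr m z)) 0) t) (fun m hm => by
            obtain ⟨t, ht, h1⟩ := he.1 (pr m z)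
            beta_reduce at h1
            rw [chi_false (by simpa using h m hm)] at h1
            exact ⟨t, ht, h1⟩)
        obtain ⟨t, ht, h1⟩ := exists_valid_union C (P := Valid) (max B (s + 1)) fun _ h => h
        have h2 := h1 s (lt_max_of_lt_right (lt_add_one _)) hs _ hs'
        refine ⟨t, ht, f z, mm_right_lt h2, h2, Or.inr ⟨chi_false (by push Not; exact h),
          fun m hm => ?_⟩⟩
        obtain ⟨r, hr, hr', h3⟩ := hB m hm
        exact h1 r (lt_max_of_lt_left hr) hr' _ h3
    obtain ⟨t, ht, h⟩ := this
    refine ⟨t, ht, ?_⟩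
    simp [Rule]
    exact h
  · obtain ⟨x, _, hx, h⟩ := hr.2.2.2.2.2.2.2 (by simp)
    have h1 := hd.2 z x t hv (by simpa using hx)
    subst h1
    rcases h with ⟨rfl, m, hm, h⟩ | ⟨rfl, h⟩
    · have := he.2 _ _ t hv (by simpa using h)
      exact (chi_true ⟨m, hm, by simpa [chi_eq_one] using this.symm⟩).symm
    · refine (chi_false ?_).symm
      rintro ⟨m, hm, hpm⟩
      have := he.2 _ _ t hv (by simpa using h m hm)
      beta_reduce at this
      rw [chi_true (by simpa using hpm)] at this
      exact zero_ne_one this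

theorem HasCode.congr (h : HasCode f) (e : ∀ z, f z = g z) : HasCode g :=
  (funext e : f = g) ▸ h

theorem HasCode.not (C : SClass M) {p : M → Prop} (h : HasCode fun z => chi (p z)) :
    HasCode fun z => chi (¬ p z) :=
  (h.lt C (HasCode.const C 1)).congr fun z => congrArg chi (propext chi_lt_one)

theorem HasCode.and (C : SClass M) {p q : M → Prop} (h : HasCode fun z => chi (p z))
    (h' : HasCode fun z => chi (q z)) : HasCode fun z => chi (p z ∧ q z) :=
  (h.mul C h').congr fun z => by by_cases hp : p z <;> by_cases hq : q z <;> simp [chi, hp, hq]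

theorem HasCode.iff {p q : M → Prop} (h : HasCode fun z => chi (p z)) (e : ∀ z, p z ↔ q z) :
    HasCode fun z => chi (q z) :=
  h.congr fun z => congrArg chi (propext (e z))

theorem HasCode.tval (C : SClass M) {G : ℕ → M → M} (hG : ∀ i, HasCode (G i)) (t : Term) :
    HasCode fun z => (tval (toStr M) (fun i => G i z) t : M) := by
  induction t with
  | var i => exact hG i
  | zero => exact .const C 0
  | one => exact .const C 1
  | add t s iht ihs => exact iht.add C ihs
  | mul t s iht ihs => exact iht.mul C ihs

theorem HasCode.upd (C : SClass M) {G : ℕ → M → M} (hG : ∀ i, HasCode (G i)) (x i : ℕ) :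
    HasCode (upd (fun i u => G i (PaperArith.sn u)) x PaperArith.fs i) := by
  unfold PaperArith.upd
  split_ifs
  · exact .fs C
  · exact (hG i).comp C (.sn C)

theorem HasCode.sat_bex (C : SClass M) {G : ℕ → M → M} (hG : ∀ i, HasCode (G i)) (x : ℕ)
    (t : Term) {φ : Fml} (ih : HasCode fun u => chi (sat (fun i =>
      PaperArith.upd (fun i u => G i (PaperArith.sn u)) x PaperArith.fs i u) φ)) :
    HasCode fun z => chi (∃ m < (PaperArith.tval (toStr M) (fun i => G i z) t : M),
      sat (PaperArith.upd (fun i => G i z) x m) φ) := by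
  refine (HasCode.tval C hG t).bex C (p := fun m z => sat (PaperArith.upd (fun i => G i z) x m) φ)
    (ih.iff fun u => ?_)
  have : (fun i => PaperArith.upd (fun i u => G i (PaperArith.sn u)) x PaperArith.fs i u) =
      PaperArith.upd (fun i => G i (PaperArith.sn u)) x (PaperArith.fs u) := by
    funext i
    unfold PaperArith.upd
    split_ifs <;> rfl
  rw [this]

theorem HasCode.delta0 (C : SClass M) {φ : Fml} (h : Delta0 φ) :
    ∀ {G : ℕ → M → M}, (∀ i, HasCode (G i)) → HasCode fun z => chi (sat (fun i => G i z) φ) := by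
  induction h with
  | eq t s =>
    intro G hG
    have h1 := HasCode.tval C hG t
    have h2 := HasCode.tval C hG s
    refine ((h1.lt C (h2.add C (.const C 1))).and C (h2.lt C (h1.add C (.const C 1)))).iff
      fun z => ?_
    rw [lt_succ, lt_succ]
    exact ⟨fun h => le_antisymm h.1 h.2, fun h => ⟨le_of_eq h, ge_of_eq h⟩⟩
  | lt t s => exact fun hG => (HasCode.tval C hG t).lt C (HasCode.tval C hG s)
  | not _ ih => exact fun hG => (ih hG).not C
  | and _ _ ih ih' => exact fun hG => (ih hG).and C (ih' hG)
  | or _ _ ih ih' =>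
    intro G hG
    refine ((((ih hG).not C).and C ((ih' hG).not C)).not C).iff fun z => ?_
    change _ ↔ _ ∨ _
    tauto
  | imp _ _ ih ih' =>
    intro G hG
    refine (((ih hG).and C ((ih' hG).not C)).not C).iff fun z => ?_
    change _ ↔ (_ → _)
    tauto
  | @ball x t φ h ih =>
    intro G hG
    have h1 := HasCode.sat_bex C hG x t (φ := .not φ) ((ih (HasCode.upd C hG x)).not C)
    refine (h1.not C).iff fun z => ?_
    change (¬ ∃ m < _, ¬ _) ↔ ∀ m, m < _ → _
    push Not
    rfl
  | @bex x t φ h ih =>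
    intro G hG
    exact (HasCode.sat_bex C hG x t (ih (HasCode.upd C hG x))).iff fun z => Iff.rfl

/-- The universal `Σ₁` relation. -/
def Comp (e z : M) : Prop := ∃ m t, Valid t ∧ mm (pr (pr e (pr z m)) 1) t

theorem isUniv_comp (h : ∀ Q, C.mem Q → Next D0 Q) : IsUniv C Comp := by
  refine ⟨⟨?_⟩, fun P hP => ?_⟩
  · unfold Comp
    infer_instance
  · obtain ⟨R, ⟨φ, hφ, ρ, hR⟩, h⟩ := h _ hP.out
    have hG : ∀ i, HasCode (Sum.elim (fun k => if k = 0 then PaperArith.sn else PaperArith.fs)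
        (fun a _ => a) (ρ i) : M → M) := by
      intro i
      cases ρ i with
      | inl k =>
        simp only [Sum.elim_inl]
        split_ifs
        · exact .sn C
        · exact .fs C
      | inr a => exact .const C a
    obtain ⟨e, he⟩ := (HasCode.delta0 C hφ hG).not C
    refine ⟨e, fun z => ?_⟩
    have h1 : P z ↔ ∃ m, ¬ R (vc m fun _ => z) := h fun _ => z
    rw [h1]
    refine exists_congr fun m => ?_
    have h2 : (fun i => Sum.elim (vc m fun _ => z) id (ρ i)) = fun i => (Sum.elim (fun k =>
        if k = 0 then PaperArith.sn else PaperArith.fs) (fun a _ => a) (ρ i) : M → M) (pr z m) := by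
      funext i
      cases ρ i with
      | inl k => cases k <;> simp
      | inr a => rfl
    rw [hR, h2]
    constructor
    · intro hn
      obtain ⟨t, ht, h3⟩ := he.1 (pr z m)
      beta_reduce at h3
      rw [chi_true hn] at h3
      exact ⟨t, ht, h3⟩
    · rintro ⟨t, ht, h3⟩
      exact chi_eq_one.1 (he.2 _ _ t ht h3).symm

theorem IsUniv.next {C C' : SClass M} {W : M → M → Prop} (hU : IsUniv C W)
    (h : ∀ Q, C'.mem Q ↔ Next C.mem Q) : IsUniv C' fun e z => ∃ y, ¬ W e (pr z y) := by
  have := hU.sig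
  refine ⟨⟨⟨(h _).2 ⟨fun v => W (v 1) (pr (v 2) (v 0)), Sig.out, fun v => Iff.rfl⟩⟩⟩, fun P hP => ?_⟩
  obtain ⟨R, hR, hR'⟩ := (h _).1 hP.out
  have i1 : Sig2 C fun a z => R (vc a fun _ => z) := ⟨⟨SClass.comp hR _ (hh := VMap.diag)⟩⟩
  obtain ⟨e, he⟩ := hU.univ (fun u => R (vc (sn u) fun _ => fs u))
    (Sig.app2 (P := fun a z => R (vc a fun _ => z)))
  refine ⟨e, fun z => ?_⟩
  have h1 : P z ↔ ∃ m, ¬ R (vc m fun _ => z) := hR' fun _ => z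
  rw [h1]
  refine exists_congr fun m => not_congr ?_
  rw [← he]
  simp

theorem Hs.exists_univ {n : ℕ} (hI : IndFor (toStr M) Delta0)
    (hB : ∀ Q : (ℕ → M) → Prop, Hs n Q → B2 Q) (k : ℕ) (hk : k + 1 ≤ n) :
    ∃ W, IsUniv (Hs.sclass hI hB k hk) W := by
  induction k with
  | zero => exact ⟨_, isUniv_comp fun Q h => h⟩
  | succ k ih =>
    obtain ⟨W, hW⟩ := ih (by omega)
    exact ⟨_, hW.next fun Q => Iff.rfl⟩

end

section
variable {M : Type} [Arith M] {C : SClass M}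

/-- Unbounded subsets. -/
def Unbdd (B : M → Prop) : Prop := ∀ b, ∃ x, b ≤ x ∧ B x

variable (C) in
/-- Requirements on recursive unbounded sets that can be met by shrinking. -/
def Dense (T : (M → Prop) → Prop) : Prop :=
  ∀ B, Rec1 C B → Unbdd B → ∃ B', Rec1 C B' ∧ Unbdd B' ∧ (∀ x, B' x → B x) ∧ T B'

theorem exists_generic {T : ℕ → (M → Prop) → Prop} (hT : ∀ k, Dense C (T k)) :
    ∃ U : Ultrafilter M, ∀ k, ∃ B, Rec1 C B ∧ Unbdd B ∧ T k B ∧ ∀ᶠ x in (U : Filter M), B x := by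
  choose s hs1 hs2 hs3 hs4 using hT
  let Q := {B : M → Prop // Rec1 C B ∧ Unbdd B}
  let q : ℕ → Q := fun k => Nat.rec ⟨fun _ => True, ⟨inferInstance⟩, fun b => ⟨b, le_rfl, trivial⟩⟩
    (fun k B => ⟨s k B.1 B.2.1 B.2.2, hs1 _ _ _ _, fun b => hs2 _ _ _ _ b⟩) k
  have hq : ∀ k, ∀ x, (q (k + 1)).1 x → (q k).1 x := fun k => hs3 k _ _ _
  have hq' : ∀ k, T k (q (k + 1)).1 := fun k => hs4 k _ _ _
  have hanti : Antitone fun k => {x | (q k).1 x} := antitone_nat_of_succ_le fun k x hx => hq k x hx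
  have hne : (⨅ k, Filter.principal {x | (q k).1 x}).NeBot := by
    refine Filter.iInf_neBot_of_directed' ?_ ?_
    · intro i j
      exact ⟨max i j, Filter.principal_mono.2 (hanti (le_max_left _ _)),
        Filter.principal_mono.2 (hanti (le_max_right _ _))⟩
    · intro k
      obtain ⟨x, _, hx⟩ := (q k).2.2 0
      exact Filter.principal_neBot_iff.2 ⟨x, hx⟩
  refine ⟨Ultrafilter.of (⨅ k, Filter.principal {x | (q k).1 x}), fun k =>
    ⟨(q (k + 1)).1, (q (k + 1)).2.1, (q (k + 1)).2.2, hq' k, ?_⟩⟩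
  have h1 : {x | (q (k + 1)).1 x} ∈ (⨅ k, Filter.principal {x | (q k).1 x}) :=
    Filter.mem_iInf_of_mem (k + 1) (Filter.mem_principal_self _)
  exact Ultrafilter.of_le _ h1

theorem dense_sig (D : M → Prop) (hD : Sig1 C D) :
    Dense C fun B => (∀ x, B x → D x) ∨ ∀ x, B x → ¬ D x := by
  intro B hB hc
  by_cases h : ∀ b, ∃ x, b ≤ x ∧ B x ∧ D x
  · obtain ⟨g, hg, h1⟩ := sig_select C (P := fun b x => b ≤ x ∧ B x ∧ D x) h
    refine ⟨fun x => ∃ b ≤ x, g b = x, ⟨inferInstance⟩, fun b => ⟨g b, (h1 b).1, b, (h1 b).1, rfl⟩,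
      ?_, Or.inl ?_⟩
    · rintro x ⟨b, _, rfl⟩
      exact (h1 b).2.1
    · rintro x ⟨b, _, rfl⟩
      exact (h1 b).2.2
  · push Not at h
    obtain ⟨b, hb⟩ := h
    refine ⟨fun x => B x ∧ b ≤ x, ⟨inferInstance⟩, fun c => ?_, fun x hx => hx.1,
      Or.inr fun x hx => hb x hx.2 hx.1⟩
    obtain ⟨x, hx, hx'⟩ := hc (max b c)
    exact ⟨x, (le_max_right _ _).trans hx, hx', (le_max_left _ _).trans hx⟩

theorem dense_const (f : M → M) (hf : Fn1 C f) (a : M) :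
    Dense C fun B => (∀ x, B x → a ≤ f x) ∨ ∃ c, ∀ x, B x → f x = c := by
  intro B hB hc
  by_cases h : Unbdd fun x => B x ∧ a ≤ f x
  · exact ⟨_, ⟨inferInstance⟩, h, fun x hx => hx.1, Or.inl fun x hx => hx.2⟩
  · unfold Unbdd at h
    push Not at h
    obtain ⟨b, hb⟩ := h
    by_cases h' : ∃ c, Unbdd fun x => B x ∧ f x = c
    · obtain ⟨c, h'⟩ := h'
      exact ⟨_, ⟨inferInstance⟩, h', fun x hx => hx.1, Or.inr ⟨c, fun x hx => hx.2⟩⟩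
    · unfold Unbdd at h'
      push Not at h'
      obtain ⟨d, hd⟩ := pi_collection C (Q := fun c d => ∃ x, d ≤ x ∧ B x ∧ f x = c) (a := a)
        fun c _ => (h' c).imp fun d hd => by push Not; exact hd
      obtain ⟨x, hx, hx'⟩ := hc (max b d)
      obtain ⟨e, he, hn⟩ := hd (f x) (hb x ((le_max_left _ _).trans hx) hx')
      exact absurd ⟨x, he.le.trans ((le_max_right _ _).trans hx), hx', rfl⟩ hn

variable (C) in
/-- An ultrafilter deciding `Σ`-sets by recursive sets, on which bounded functions are constant. -/
structure Generic (U : Ultrafilter M) : Prop where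
  tail : ∀ a, ∀ᶠ x in (U : Filter M), a ≤ x
  dec : ∀ D, Sig1 C D → ∃ B, Rec1 C B ∧ (∀ᶠ x in (U : Filter M), B x) ∧
    ((∀ x, B x → D x) ∨ ∀ x, B x → ¬ D x)
  const : ∀ f, Fn1 C f → ∀ a, (∀ᶠ x in (U : Filter M), f x < a) → ∃ c, ∀ᶠ x in (U : Filter M), f x = c

theorem exists_ultrafilter [Countable M]
    (hc : {P : M → Prop | Sig C fun v => P (v 0)}.Countable) :
    ∃ U : Ultrafilter M, Generic C U := by
  let I := {P : M → Prop | Sig C fun v => P (v 0)} × Option M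
  have : Countable {P : M → Prop | Sig C fun v => P (v 0)} := hc.to_subtype
  have : Countable I := inferInstance
  have : Nonempty I := ⟨⟨fun _ => True, inferInstanceAs (Sig C fun v => True)⟩, none⟩
  obtain ⟨e, he⟩ := exists_surjective_nat I
  let T : I → (M → Prop) → Prop := fun i B => match i.2 with
    | none => (∀ x, B x → i.1.1 x) ∨ ∀ x, B x → ¬ i.1.1 x
    | some a => ∀ f, Fn1 C f → (∀ w, i.1.1 w ↔ f (fs w) = sn w) →
        (∀ x, B x → a ≤ f x) ∨ ∃ c, ∀ x, B x → f x = c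
  have hT : ∀ i, Dense C (T i) := by
    rintro ⟨⟨P, hP⟩, _ | a⟩
    · exact dense_sig P ⟨hP⟩
    · by_cases h : ∃ f, Fn1 C f ∧ ∀ w, P w ↔ f (fs w) = sn w
      · obtain ⟨f, hf, h⟩ := h
        intro B hB hB'
        obtain ⟨B', h1, h2, h3, h4⟩ := dense_const f hf a B hB hB'
        refine ⟨B', h1, h2, h3, fun g _ hg => ?_⟩
        have : g = f := funext fun x => by
          have := (hg (pr x (f x))).1 ((h _).2 (by simp))
          simpa using this
        rw [this]; exact h4
      · intro B hB hB'
        exact ⟨B, hB, hB', fun x hx => hx, fun f hf hf' => absurd ⟨f, hf, hf'⟩ h⟩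
  obtain ⟨U, hU⟩ := exists_generic fun k => hT (e k)
  have hU' : ∀ i, ∃ B, Rec1 C B ∧ Unbdd B ∧ T i B ∧ ∀ᶠ x in (U : Filter M), B x := fun i => by
    obtain ⟨k, rfl⟩ := he i
    exact hU k
  refine ⟨U, ⟨fun a => ?_, fun D hD => ?_, fun f hf a h => ?_⟩⟩
  · obtain ⟨B, -, h2, h3, h4⟩ := hU' ⟨⟨fun x => a ≤ x, inferInstanceAs (Sig C fun v => a ≤ v 0)⟩, none⟩
    rcases h3 with h3 | h3
    · exact h4.mono h3
    · obtain ⟨x, hx, hx'⟩ := h2 a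
      exact absurd hx (h3 x hx')
  · obtain ⟨B, h1, -, h3, h4⟩ := hU' ⟨⟨D, hD.out⟩, none⟩
    exact ⟨B, h1, h4, h3⟩
  · obtain ⟨B, -, -, h3, h4⟩ := hU' ⟨⟨fun w => f (fs w) = sn w,
      inferInstanceAs (Sig C fun v => f (fs (v 0)) = sn (v 0))⟩, some a⟩
    rcases h3 f hf fun _ => Iff.rfl with h3 | ⟨c, h3⟩
    · obtain ⟨x, hx, hx'⟩ := (h.and h4).exists
      exact absurd hx (not_lt.2 (h3 x hx'))
    · exact ⟨c, h4.mono h3⟩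

end

section
variable {M : Type} [Arith M] {C : SClass M}

mutual
theorem IsSigma.fin {k : ℕ} {φ : Fml} (h : IsSigma k φ) : ∃ N, FinDep M φ N := by
  match h with
  | .delta0 h => exact h.fin
  | .ofPi h => exact IsPi.fin h
  | .ex x h =>
    obtain ⟨N, hN⟩ := IsSigma.fin h
    exact ⟨N, fun v v' h => exists_congr fun m => hN _ _ (upd_congr h m)⟩
theorem IsPi.fin {k : ℕ} {φ : Fml} (h : IsPi k φ) : ∃ N, FinDep M φ N := by
  match h with
  | .delta0 h => exact h.fin
  | .ofSigma h => exact IsSigma.fin h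
  | .all x h =>
    obtain ⟨N, hN⟩ := IsPi.fin h
    exact ⟨N, fun v v' h => forall_congr' fun m => hN _ _ (upd_congr h m)⟩
end

theorem SClass.mem_fn {Q : (ℕ → M) → Prop} (hQ : C.mem Q) {N : ℕ}
    (hN : ∀ v v' : ℕ → M, (∀ i < N, v i = v' i) → (Q v ↔ Q v')) (F : ℕ → (ℕ → M) → M)
    (hF : ∀ i, Fn C (F i)) : C.mem fun v => Q fun i => F i v := by
  have key : ∀ K, C.mem fun v => Q fun i =>
      if i < K then F i fun j => v (2 * j) else v (2 * i + 1) := by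
    intro K
    induction K with
    | zero =>
      have : VMap fun v : ℕ → M => fun i => v (2 * i + 1) :=
        ⟨fun i => Sum.inl (2 * i + 1), fun _ _ => rfl⟩
      exact SClass.mem_congr (SClass.comp hQ fun v => fun i => v (2 * i + 1)) fun v => by simp
    | succ K ih =>
      have h1 : VMap fun v : ℕ → M => fun i => if i = 2 * K + 1 then v 0 else v (i + 1) :=
        ⟨fun i => Sum.inl (if i = 2 * K + 1 then 0 else i + 1), fun v i => by
          simp only [Sum.elim_inl]; split_ifs <;> rfl⟩
      have h2 : VMap fun v : ℕ → M => fun j => v (2 * j) :=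
        ⟨fun j => Sum.inl (2 * j), fun _ _ => rfl⟩
      have hK := hF K
      have h3 := (Sig.subst (C := C) (P := fun m v => Q fun i =>
          if i < K then F i fun j => v (2 * j) else if 2 * i + 1 = 2 * K + 1 then m
            else v (2 * i + 1)) (g := fun v => F K fun j => v (2 * j))
        ⟨SClass.mem_congr (SClass.comp ih fun v => fun i =>
          if i = 2 * K + 1 then v 0 else v (i + 1)) fun v => ?_⟩ inferInstance).out
      · refine SClass.mem_congr h3 fun v => iff_of_eq (congrArg Q (funext fun i => ?_))
        by_cases h : i = K
        · subst h; simp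
        · have : i < K + 1 ↔ i < K := by omega
          simp only [this]
          split_ifs <;> first | rfl | omega
      · refine iff_of_eq (congrArg Q (funext fun i => ?_))
        split_ifs with h
        · congr 1
          funext j
          change (if 2 * j = 2 * K + 1 then _ else _) = _
          rw [if_neg (by omega)]; rfl
        · exact if_pos ‹_›
        · exact if_neg ‹_›
  have h4 : VMap fun v : ℕ → M => fun i => if i % 2 = 0 then v (i / 2) else 0 :=
    ⟨fun i => if i % 2 = 0 then Sum.inl (i / 2) else Sum.inr 0, fun v i => by
      beta_reduce; split_ifs <;> rfl⟩
  refine SClass.mem_congr (SClass.comp (key N) fun v => fun i =>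
    if i % 2 = 0 then v (i / 2) else 0) fun v => hN _ _ fun i hi => ?_
  beta_reduce
  rw [if_pos hi]
  congr 1
  funext j
  simp

variable (C) in
/-- Functions with graph in the class. -/
abbrev Fun : Type := {f : M → M // Fn1 C f}

theorem exists_fn {U : Ultrafilter M} (hU : Generic C U) {P : M → M → Prop}
    [hP : Sig C fun v => P (v 0) (v 1)] (h : ∀ᶠ x in (U : Filter M), ∃ y, P x y) :
    ∃ f : Fun C, ∀ᶠ x in (U : Filter M), P x (f.1 x) := by
  have hP2 : Sig2 C P := ⟨hP⟩
  obtain ⟨B, hB, hBU, h1⟩ := hU.dec (fun x => ∃ y, P x y) ⟨inferInstance⟩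
  have h2 : ∀ x, B x → ∃ y, P x y := by
    rcases h1 with h1 | h1
    · exact h1
    · obtain ⟨x, hx, hx'⟩ := (h.and hBU).exists
      exact absurd hx (h1 x hx')
  obtain ⟨f, hf, h3⟩ := sig_select C (P := fun x y => B x → P x y) fun x => by
    by_cases hx : B x
    · exact (h2 x hx).imp fun y hy _ => hy
    · exact ⟨0, fun h => absurd h hx⟩
  exact ⟨⟨f, hf⟩, hBU.mono h3⟩

variable (C) in
/-- The universe of the restricted ultrapower. -/
abbrev UPow (U : Ultrafilter M) : Type :=
  {g : Filter.Germ (U : Filter M) M // ∃ f : Fun C, g = (f.1 : Filter.Germ (U : Filter M) M)}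

variable {U : Ultrafilter M}

/-- The class of a function. -/
def mk (U : Ultrafilter M) (f : Fun C) : UPow C U := ⟨f.1, f, rfl⟩

theorem exists_mk (a : UPow C U) : ∃ f, mk U f = a := by
  obtain ⟨g, f, rfl⟩ := a
  exact ⟨f, rfl⟩

/-- The constant function. -/
def cst (a : M) : Fun C := ⟨fun _ => a, ⟨inferInstance⟩⟩
instance : Add (Fun C) := ⟨fun f g => ⟨fun x => f.1 x + g.1 x, by
  have := f.2; have := g.2; exact ⟨inferInstance⟩⟩⟩
instance : Mul (Fun C) := ⟨fun f g => ⟨fun x => f.1 x * g.1 x, by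
  have := f.2; have := g.2; exact ⟨inferInstance⟩⟩⟩

instance : Add (UPow C U) := ⟨fun a b => ⟨a.1 + b.1, by
  obtain ⟨_, f, rfl⟩ := a
  obtain ⟨_, g, rfl⟩ := b
  exact ⟨f + g, rfl⟩⟩⟩
instance : Mul (UPow C U) := ⟨fun a b => ⟨a.1 * b.1, by
  obtain ⟨_, f, rfl⟩ := a
  obtain ⟨_, g, rfl⟩ := b
  exact ⟨f * g, rfl⟩⟩⟩

variable (C) in
/-- The restricted ultrapower as a structure. -/
noncomputable abbrev uStr (U : Ultrafilter M) : Str :=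
  ⟨UPow C U, mk U (cst 0), mk U (cst 1), (· + ·), (· * ·), fun a b => a.1 < b.1⟩

theorem mk_add (f g : Fun C) : mk U f + mk U g = mk U (f + g) := rfl
theorem mk_mul (f g : Fun C) : mk U f * mk U g = mk U (f * g) := rfl

theorem mk_eq {f g : Fun C} : mk U f = mk U g ↔ ∀ᶠ x in (U : Filter M), f.1 x = g.1 x := by
  rw [Subtype.ext_iff]
  exact Filter.Germ.coe_eq

theorem mk_lt {f g : Fun C} :
    (uStr C U).lt (mk U f) (mk U g) ↔ ∀ᶠ x in (U : Filter M), f.1 x < g.1 x :=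
  Filter.Germ.coe_lt

theorem uStr_tval (F : ℕ → Fun C) (t : Term) : ∃ f : Fun C,
    tval (uStr C U) (fun i => mk U (F i)) t = mk U f ∧
      ∀ x, f.1 x = tval (toStr M) (fun i => (F i).1 x) t := by
  induction t with
  | var i => exact ⟨F i, rfl, fun _ => rfl⟩
  | zero => exact ⟨cst 0, rfl, fun _ => rfl⟩
  | one => exact ⟨cst 1, rfl, fun _ => rfl⟩
  | add t s iht ihs =>
    obtain ⟨f, hf, hf'⟩ := iht
    obtain ⟨g, hg, hg'⟩ := ihs
    refine ⟨f + g, ?_, fun x => ?_⟩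
    · simp only [tval, hf, hg, mk_add]
    · simp only [tval, ← hf', ← hg']; rfl
  | mul t s iht ihs =>
    obtain ⟨f, hf, hf'⟩ := iht
    obtain ⟨g, hg, hg'⟩ := ihs
    refine ⟨f * g, ?_, fun x => ?_⟩
    · simp only [tval, hf, hg, mk_mul]
    · simp only [tval, ← hf', ← hg']; rfl

/-- Łoś's theorem for `φ`. -/
def Los (C : SClass M) (U : Ultrafilter M) (φ : Fml) : Prop := ∀ F : ℕ → Fun C,
  Sat0 (uStr C U) (fun i => mk U (F i)) φ ↔ ∀ᶠ x in (U : Filter M), sat (fun i => (F i).1 x) φ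

theorem mk_upd (F : ℕ → Fun C) (x : ℕ) (g : Fun C) :
    upd (fun i => mk U (F i)) x (mk U g) = fun i => mk U (upd F x g i) := by
  funext i; unfold upd; split_ifs <;> rfl

theorem upd_apply (F : ℕ → Fun C) (x : ℕ) (g : Fun C) (t : M) :
    upd (fun i => (F i).1 t) x (g.1 t) = fun i => (upd F x g i).1 t := by
  funext i; unfold upd; split_ifs <;> rfl

theorem Los.upd {φ : Fml} (h : Los C U φ) (F : ℕ → Fun C) (x : ℕ) (g : Fun C) :
    Sat0 (uStr C U) (PaperArith.upd (fun i => mk U (F i)) x (mk U g)) φ ↔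
      ∀ᶠ t in (U : Filter M), sat (PaperArith.upd (fun i => (F i).1 t) x (g.1 t)) φ := by
  rw [mk_upd, h]
  simp only [upd_apply]

/-- Substituting class functions for the variables of a formula. -/
theorem sig_fn {Q : (ℕ → M) → Prop} (hQ : C.mem Q) {N : ℕ}
    (hN : ∀ v v' : ℕ → M, (∀ i < N, v i = v' i) → (Q v ↔ Q v')) (F : ℕ → Fun C) (x : ℕ) :
    Sig C fun v => Q (PaperArith.upd (fun i => (F i).1 (v 0)) x (v 1)) := by
  refine ⟨SClass.mem_fn hQ hN (fun i v => PaperArith.upd (fun i => (F i).1 (v 0)) x (v 1) i)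
    fun i => ?_⟩
  unfold PaperArith.upd
  have := (F i).2
  split_ifs
  · infer_instance
  · infer_instance

theorem Los.ex (hU : Generic C U) {φ : Fml} (h : Los C U φ) (x : ℕ) {N : ℕ} (hN : FinDep M φ N)
    (hφ : C.mem fun v => sat v φ) : Los C U (.ex x φ) := by
  intro F
  constructor
  · rintro ⟨a, ha⟩
    obtain ⟨g, rfl⟩ := exists_mk a
    exact ((h.upd F x g).1 ha).mono fun t ht => ⟨_, ht⟩
  · intro h1
    have := sig_fn hφ hN F x
    obtain ⟨g, hg⟩ := exists_fn hU
      (P := fun t y => sat (PaperArith.upd (fun i => (F i).1 t) x y) φ) h1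
    exact ⟨mk U g, (h.upd F x g).2 hg⟩

theorem Los.all (hU : Generic C U) {φ : Fml} (h : Los C U φ) (x : ℕ) {N : ℕ} (hN : FinDep M φ N)
    (hφ : C.mem fun v => ¬ sat v φ) : Los C U (.all x φ) := by
  intro F
  constructor
  · intro h1
    by_contra h2
    rw [← Ultrafilter.eventually_not] at h2
    have := sig_fn hφ (fun v v' hv => not_congr (hN v v' hv)) F x
    obtain ⟨g, hg⟩ := exists_fn hU
      (P := fun t y => ¬ sat (PaperArith.upd (fun i => (F i).1 t) x y) φ)
      (h2.mono fun t ht => not_forall.1 ht)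
    obtain ⟨t, ht, ht'⟩ := (((h.upd F x g).1 (h1 (mk U g))).and hg).exists
    exact ht' ht
  · intro h1 a
    obtain ⟨g, rfl⟩ := exists_mk a
    exact (h.upd F x g).2 (h1.mono fun t ht => ht _)

theorem Los.not {φ : Fml} (h : Los C U φ) : Los C U (.not φ) := fun F =>
  (not_congr (h F)).trans Ultrafilter.eventually_not.symm

theorem Los.and {φ ψ : Fml} (h : Los C U φ) (h' : Los C U ψ) : Los C U (.and φ ψ) := fun F =>
  (and_congr (h F) (h' F)).trans Filter.eventually_and.symm

theorem Los.or {φ ψ : Fml} (h : Los C U φ) (h' : Los C U ψ) : Los C U (.or φ ψ) := fun F =>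
  (or_congr (h F) (h' F)).trans Ultrafilter.eventually_or.symm

theorem Los.imp {φ ψ : Fml} (h : Los C U φ) (h' : Los C U ψ) : Los C U (.imp φ ψ) := fun F =>
  (imp_congr (h F) (h' F)).trans Ultrafilter.eventually_imp.symm

theorem Los.eq (t s : Term) : Los C U (.eq t s) := by
  intro F
  obtain ⟨f, hf, hf'⟩ := uStr_tval (U := U) F t
  obtain ⟨g, hg, hg'⟩ := uStr_tval (U := U) F s
  simp only [sat, Sat0, Sat, hf, hg, mk_eq, hf', hg']

theorem Los.lt (t s : Term) : Los C U (.lt t s) := by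
  intro F
  obtain ⟨f, hf, hf'⟩ := uStr_tval (U := U) F t
  obtain ⟨g, hg, hg'⟩ := uStr_tval (U := U) F s
  simp only [sat, Sat0, Sat, hf, hg, ← hf', ← hg']
  exact mk_lt

theorem Los.bex (hU : Generic C U) {φ : Fml} (h : Los C U φ) (x : ℕ) (t : Term) {N : ℕ}
    (hN : FinDep M φ N) (hφ : C.mem fun v => sat v φ) : Los C U (.bex x t φ) := by
  intro F
  obtain ⟨f, hf, hf'⟩ := uStr_tval (U := U) F t
  constructor
  · rintro ⟨a, ha, ha'⟩
    obtain ⟨g, rfl⟩ := exists_mk a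
    rw [hf, mk_lt] at ha
    exact (ha.and ((h.upd F x g).1 ha')).mono fun s hs => ⟨_, by rw [← hf']; exact hs.1, hs.2⟩
  · intro h1
    have := sig_fn hφ hN F x
    have := f.2
    obtain ⟨g, hg⟩ := exists_fn hU
      (P := fun t y => y < f.1 t ∧ sat (PaperArith.upd (fun i => (F i).1 t) x y) φ)
      (h1.mono fun s hs => by
        obtain ⟨m, hm, hm'⟩ := hs
        exact ⟨m, by rw [hf']; exact hm, hm'⟩)
    rw [Filter.eventually_and] at hg
    exact ⟨mk U g, by rw [hf, mk_lt]; exact hg.1, (h.upd F x g).2 hg.2⟩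

theorem Los.ball (hU : Generic C U) {φ : Fml} (h : Los C U φ) (x : ℕ) (t : Term) {N : ℕ}
    (hN : FinDep M φ N) (hφ : C.mem fun v => ¬ sat v φ) : Los C U (.ball x t φ) := by
  have h1 := (Los.bex hU h.not x t (N := N) (fun v v' hv => not_congr (hN v v' hv)) hφ).not
  intro F
  refine Iff.trans ?_ ((h1 F).trans (iff_of_eq ?_))
  · simp only [Sat0, Sat, not_exists, not_and, not_not]
  · simp only [sat, Sat0, Sat, not_exists, not_and, not_not]

theorem Los.delta0 (hU : Generic C U) (hC : ∀ φ, Delta0 φ → C.mem fun v => sat v φ) {φ : Fml}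
    (h : Delta0 φ) : Los C U φ := by
  induction h with
  | eq t s => exact Los.eq t s
  | lt t s => exact Los.lt t s
  | not _ ih => exact ih.not
  | and _ _ ih ih' => exact ih.and ih'
  | or _ _ ih ih' => exact ih.or ih'
  | imp _ _ ih ih' => exact ih.imp ih'
  | ball x t h ih =>
    obtain ⟨N, hN⟩ := h.fin (M := M)
    exact Los.ball hU ih x t hN (hC _ h.not)
  | bex x t h ih =>
    obtain ⟨N, hN⟩ := h.fin (M := M)
    exact Los.bex hU ih x t hN (hC _ h)

mutual
theorem IsSigma.los (hU : Generic C U) {n : ℕ}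
    (hS : ∀ k ≤ n, ∀ φ, IsSigma k φ → C.mem fun v => sat v φ)
    (hP : ∀ k ≤ n, ∀ φ, IsPi k φ → C.mem fun v => ¬ sat v φ) {k : ℕ} (hk : k ≤ n) {φ : Fml}
    (h : IsSigma k φ) : Los C U φ := by
  match h with
  | .delta0 h => exact Los.delta0 hU (fun φ h => hS k hk φ (.delta0 h)) h
  | .ofPi h => exact IsPi.los hU hS hP (by omega) h
  | .ex x h =>
    obtain ⟨N, hN⟩ := h.fin (M := M)
    exact Los.ex hU (IsSigma.los hU hS hP hk h) x hN (hS _ hk _ h)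
theorem IsPi.los (hU : Generic C U) {n : ℕ}
    (hS : ∀ k ≤ n, ∀ φ, IsSigma k φ → C.mem fun v => sat v φ)
    (hP : ∀ k ≤ n, ∀ φ, IsPi k φ → C.mem fun v => ¬ sat v φ) {k : ℕ} (hk : k ≤ n) {φ : Fml}
    (h : IsPi k φ) : Los C U φ := by
  match h with
  | .delta0 h => exact Los.delta0 hU (fun φ h => hS k hk φ (.delta0 h)) h
  | .ofSigma h => exact IsSigma.los hU hS hP (by omega) h
  | .all x h =>
    obtain ⟨N, hN⟩ := h.fin (M := M)
    exact Los.all hU (IsPi.los hU hS hP hk h) x hN (hP _ hk _ h)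
end

end

section
variable {M : Type} [Arith M] {C : SClass M} {U : Ultrafilter M}

theorem uStr_paminus (hU : Generic C U) : PAminus (uStr C U) where
  add_assoc a b c := Subtype.ext (add_assoc a.1 b.1 c.1)
  add_comm a b := Subtype.ext (add_comm a.1 b.1)
  mul_assoc a b c := Subtype.ext (mul_assoc a.1 b.1 c.1)
  mul_comm a b := Subtype.ext (mul_comm a.1 b.1)
  distrib a b c := Subtype.ext (mul_add a.1 b.1 c.1)
  add_zero a := Subtype.ext (add_zero a.1)
  mul_zero a := Subtype.ext (mul_zero a.1)
  mul_one a := Subtype.ext (mul_one a.1)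
  lt_irrefl a := lt_irrefl a.1
  lt_trans a b c := lt_trans
  lt_total a b := (lt_trichotomy a.1 b.1).imp_right (Or.imp_left fun h => Subtype.ext h)
  add_lt_add a b c h := by
    obtain ⟨f, rfl⟩ := exists_mk a
    obtain ⟨g, rfl⟩ := exists_mk b
    obtain ⟨k, rfl⟩ := exists_mk c
    exact (mk_lt (f := f + k) (g := g + k)).2 ((mk_lt.1 h).mono fun x hx => by
      change f.1 x + k.1 x < g.1 x + k.1 x
      gcongr)
  mul_lt_mul a b c h h' := by
    obtain ⟨f, rfl⟩ := exists_mk a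
    obtain ⟨g, rfl⟩ := exists_mk b
    obtain ⟨k, rfl⟩ := exists_mk c
    exact (mk_lt (f := f * k) (g := g * k)).2 (((mk_lt.1 h).and (mk_lt.1 h')).mono fun x hx =>
      mul_lt_mul_of_pos_right hx.1 hx.2)
  zero_lt_one := mk_lt.2 (Filter.Eventually.of_forall fun x => zero_lt_one (α := M))
  zero_le a := by
    obtain ⟨f, rfl⟩ := exists_mk a
    by_cases h : ∀ᶠ x in (U : Filter M), f.1 x = 0
    · exact Or.inl (mk_eq.2 h)
    · exact Or.inr (mk_lt.2 ((Ultrafilter.eventually_not.2 h).mono fun x hx =>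
        pos_iff_ne_zero.2 hx))
  discrete a b h := by
    obtain ⟨f, rfl⟩ := exists_mk a
    obtain ⟨g, rfl⟩ := exists_mk b
    by_cases h' : ∀ᶠ x in (U : Filter M), f.1 x + 1 = g.1 x
    · exact Or.inl ((mk_eq (f := f + cst 1)).2 h')
    · exact Or.inr ((mk_lt (f := f + cst 1)).2 ((mk_lt.1 h).mp ((Ultrafilter.eventually_not.2 h').mono
        fun x hx hx' => lt_of_le_of_ne (succ_le_iff'.2 hx') hx)))
  pred a h := by
    obtain ⟨f, rfl⟩ := exists_mk a
    have := f.2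
    obtain ⟨g, hg⟩ := exists_fn hU (P := fun x y => y + 1 = f.1 x) ((mk_lt.1 h).mono fun x hx => by
      rcases eq_zero_or_succ (f.1 x) with h0 | ⟨b, hb⟩
      · exact absurd h0 (ne_of_gt hx)
      · exact ⟨b, hb.symm⟩)
    exact ⟨mk U g, (mk_eq (f := g + cst 1)).2 hg⟩
  sub a b h := by
    obtain ⟨f, rfl⟩ := exists_mk a
    obtain ⟨g, rfl⟩ := exists_mk b
    have := f.2
    have := g.2
    obtain ⟨k, hk⟩ := exists_fn hU (P := fun x y => f.1 x + y = g.1 x)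
      ((mk_lt.1 h).mono fun x hx => by
        obtain ⟨c, hc⟩ := exists_add_of_le (le_of_lt hx)
        exact ⟨c, hc.symm⟩)
    exact ⟨mk U k, (mk_eq (f := f + k)).2 hk⟩

theorem uStr_ind (hU : Generic C U) (hC : ∀ φ, Delta0 φ → C.mem fun v => sat v φ)
    (hI : IndFor (toStr M) Delta0) : IndFor (uStr C U) Delta0 := by
  intro φ hφ v x h0 hs a
  choose F hF using fun i => exists_mk (v i)
  obtain rfl : (fun i => mk U (F i)) = v := funext hF
  have hL := Los.delta0 hU hC hφ
  obtain ⟨f, rfl⟩ := exists_mk a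
  by_contra hn
  rw [hL.upd, ← Ultrafilter.eventually_not] at hn
  obtain ⟨N, hN⟩ := hφ.fin (M := M)
  have i1 := sig_fn (hC _ hφ) hN F x
  have i2 := sig_fn (hC _ hφ.not) (fun v v' hv => not_congr (hN v v' hv)) F x
  have i1 : Sig2 C fun t y => sat (upd (fun i => (F i).1 t) x y) φ := ⟨i1⟩
  have i2 : Sig2 C fun t y => ¬ sat (upd (fun i => (F i).1 t) x y) φ := ⟨i2⟩
  obtain ⟨g, hg⟩ := exists_fn hU (P := fun t y => sat (upd (fun i => (F i).1 t) x y) φ ∧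
      ¬ sat (upd (fun i => (F i).1 t) x (y + 1)) φ)
      (hP := Sig.and (hQ := Sig.app2 (P := fun t y => ¬ sat (upd (fun i => (F i).1 t) x y) φ)
        (f := fun v => v 0) (g := fun v => v 1 + 1)))
      ((((hL.upd F x (cst 0)).1 h0).and hn).mono fun t ht => by
        by_contra hc
        push Not at hc
        exact ht.2 (hI φ hφ _ x ht.1 hc _))
  rw [Filter.eventually_and] at hg
  have h1 : Sat0 (uStr C U) (upd (fun i => mk U (F i)) x (mk U (g + cst 1))) φ :=
    hs (mk U g) ((hL.upd F x g).2 hg.1)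
  rw [hL.upd] at h1
  obtain ⟨t, ht, ht'⟩ := (h1.and hg.2).exists
  exact ht' ht

/-- Substituting class functions for the variables of a formula, leaving two variables. -/
theorem sig_fn2 {Q : (ℕ → M) → Prop} (hQ : C.mem Q) {N : ℕ}
    (hN : ∀ v v' : ℕ → M, (∀ i < N, v i = v' i) → (Q v ↔ Q v')) (F : ℕ → Fun C) (x y : ℕ) :
    Sig C fun v => Q (upd (upd (fun i => (F i).1 (v 0)) x (v 1)) y (v 2)) := by
  refine ⟨SClass.mem_fn hQ hN (fun i v => upd (upd (fun i => (F i).1 (v 0)) x (v 1)) y (v 2) i)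
    fun i => ?_⟩
  unfold upd
  have := (F i).2
  split_ifs <;> infer_instance

theorem Los.upd2 {φ : Fml} (h : Los C U φ) (F : ℕ → Fun C) (x y : ℕ) (g k : Fun C) :
    Sat0 (uStr C U) (PaperArith.upd (PaperArith.upd (fun i => mk U (F i)) x (mk U g)) y (mk U k)) φ
      ↔ ∀ᶠ t in (U : Filter M),
        sat (PaperArith.upd (PaperArith.upd (fun i => (F i).1 t) x (g.1 t)) y (k.1 t)) φ := by
  rw [mk_upd, h.upd]
  simp only [upd_apply]

theorem uStr_coll (hU : Generic C U) (hC : Solves C C) {φ : Fml} (hφ : C.mem fun v => sat v φ)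
    (hL : Los C U φ) {N : ℕ} (hN : FinDep M φ N) (v : ℕ → UPow C U) (x y : ℕ) (a : UPow C U)
    (h : ∀ m, (uStr C U).lt m a → ∃ k, Sat0 (uStr C U) (upd (upd v x m) y k) φ) :
    ∃ b, ∀ m, (uStr C U).lt m a →
      ∃ k, (uStr C U).lt k b ∧ Sat0 (uStr C U) (upd (upd v x m) y k) φ := by
  choose F hF using fun i => exists_mk (v i)
  obtain rfl : (fun i => mk U (F i)) = v := funext hF
  obtain ⟨f, rfl⟩ := exists_mk a
  have i0 := f.2
  let P : M → M → M → Prop := fun t m k => sat (upd (upd (fun i => (F i).1 t) x m) y k) φ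
  have i1 : Sig3 C P := ⟨sig_fn2 hφ hN F x y⟩
  have i2 : Sig1 C fun t => ∀ m < f.1 t, ∃ k, P t m k := ⟨inferInstance⟩
  obtain ⟨B, hB, hBU, hD | hD⟩ := hU.dec _ i2
  · obtain ⟨b, hb⟩ := exists_fn hU (P := fun t b => ∀ m < f.1 t, ∃ k, k < b ∧ P t m k)
      (hBU.mono fun t ht => sig_collection C (P := P t) (a := f.1 t) (hD t ht))
    refine ⟨mk U b, fun m hm => ?_⟩
    obtain ⟨g, rfl⟩ := exists_mk m
    have i3 := b.2
    have i4 := g.2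
    obtain ⟨k, hk⟩ := exists_fn hU (P := fun t k => k < b.1 t ∧ P t (g.1 t) k)
      ((hb.and (mk_lt.1 hm)).mono fun t ht => ht.1 _ ht.2)
    rw [Filter.eventually_and] at hk
    exact ⟨mk U k, mk_lt.2 hk.1, (hL.upd2 F x y g k).2 hk.2⟩
  · obtain ⟨R, hR, hR'⟩ := sig_nf C (P := fun t m => ∃ k, P t m k)
    have i5 : Fn1 C fun t => f.1 t + 1 := ⟨inferInstance⟩
    have i6 : Rec3 C fun t m w => B t → m < f.1 t ∧ ¬ R t m w := ⟨inferInstance⟩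
    obtain ⟨g, hg, hg'⟩ := hC _ _ i5 i6 fun t => by
      by_cases ht : B t
      · have := hD t ht
        push Not at this
        obtain ⟨m, hm, hn⟩ := this
        exact ⟨m, lt_trans hm (lt_add_one _), fun w _ =>
          ⟨hm, fun hw => ((hR' t m).2 ⟨w, hw⟩).elim hn⟩⟩
      · exact ⟨0, lt_succ.2 zero_le, fun w h => absurd h ht⟩
    obtain ⟨k, hk⟩ := h (mk U ⟨g, hg⟩) (mk_lt.2 (hBU.mono fun t ht => ((hg' t).2 0 ht).1))
    obtain ⟨k, rfl⟩ := exists_mk k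
    obtain ⟨t, ht, ht'⟩ := (((hL.upd2 F x y ⟨g, hg⟩ k).1 hk).and hBU).exists
    obtain ⟨w, hw⟩ := (hR' t (g t)).1 ⟨_, ht⟩
    exact absurd hw ((hg' t).2 w ht').2

variable (C U) in
/-- The embedding by constant functions. -/
noncomputable def cstEmb : Emb (toStr M) (uStr C U) where
  j a := mk U (cst a)
  inj a b h := (mk_eq.1 h).exists.choose_spec
  zero := rfl
  one := rfl
  add a b := rfl
  mul a b := rfl
  lt_iff a b := ⟨fun h => mk_lt.2 (Filter.Eventually.of_forall fun _ => h),
    fun h => (mk_lt.1 h).exists.choose_spec⟩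

theorem cstEmb_proper (hU : Generic C U) : IsProper (cstEmb C U) := by
  intro h
  obtain ⟨a, ha⟩ := h (mk U ⟨fun x => x, ⟨inferInstance⟩⟩)
  obtain ⟨x, hx, hx'⟩ := ((mk_eq.1 ha).and (hU.tail (a + 1))).exists
  have : a = x := hx
  exact absurd hx' (not_le.2 (this ▸ lt_add_one a))

theorem cstEmb_end (hU : Generic C U) : IsEndExt (cstEmb C U) := by
  intro b hb a
  obtain ⟨f, rfl⟩ := exists_mk b
  refine mk_lt.2 ?_
  by_contra h
  rw [← Ultrafilter.eventually_not] at h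
  obtain ⟨c, hc⟩ := hU.const f.1 f.2 (a + 1) (h.mono fun x hx => lt_succ.2 (not_lt.1 hx))
  exact hb ⟨c, mk_eq.2 (hc.mono fun x hx => hx.symm)⟩

theorem Los.cst {φ : Fml} (h : Los C U φ) (v : ℕ → M) :
    Sat0 (uStr C U) (fun i => (cstEmb C U).j (v i)) φ ↔ sat v φ :=
  (h fun i => PaperArith.cst (v i)).trans
    (Filter.eventually_const (f := (U : Filter M)) (p := sat v φ))

theorem IsSigma.up {n : ℕ} (hS : ∀ k ≤ n, ∀ φ, IsSigma k φ → Los C U φ)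
    (hP : ∀ k ≤ n, ∀ φ, IsPi k φ → Los C U φ) {k : ℕ} (hk : k ≤ n + 1) {φ : Fml}
    (h : IsSigma k φ) (v : ℕ → M) (hv : sat v φ) :
    Sat0 (uStr C U) (fun i => (cstEmb C U).j (v i)) φ := by
  match h with
  | .delta0 h => exact ((hS 0 (Nat.zero_le _) _ (.delta0 h)).cst v).2 hv
  | .ofPi h => exact ((hP _ (by omega) _ h).cst v).2 hv
  | .ex x h =>
    obtain ⟨m, hm⟩ := hv
    refine ⟨(cstEmb C U).j m, ?_⟩
    have h1 := IsSigma.up hS hP hk h _ hm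
    have h2 : (fun i => (cstEmb C U).j (upd v x m i)) =
        upd (fun i => (cstEmb C U).j (v i)) x ((cstEmb C U).j m) := by
      funext i; unfold upd; split_ifs <;> rfl
    rw [h2] at h1
    exact h1

theorem IsSigma.down {n : ℕ} (hS : ∀ k ≤ n, ∀ φ, IsSigma k φ → Los C U φ)
    (hP : ∀ k ≤ n, ∀ φ, IsPi k φ → Los C U φ) {k : ℕ} (hk : k ≤ n + 1) {φ : Fml}
    (h : IsSigma k φ) (F : ℕ → Fun C) (hv : Sat0 (uStr C U) (fun i => mk U (F i)) φ) :
    ∀ᶠ x in (U : Filter M), sat (fun i => (F i).1 x) φ := by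
  match h with
  | .delta0 h => exact (hS 0 (Nat.zero_le _) _ (.delta0 h) F).1 hv
  | .ofPi h => exact (hP _ (by omega) _ h F).1 hv
  | .ex x h =>
    obtain ⟨a, ha⟩ := hv
    obtain ⟨g, rfl⟩ := exists_mk a
    have ha : Sat0 (uStr C U) (upd (fun i => mk U (F i)) x (mk U g)) _ := ha
    rw [mk_upd] at ha
    refine (IsSigma.down hS hP hk h _ ha).mono fun t ht => ⟨g.1 t, ?_⟩
    rw [← upd_apply] at ht
    exact ht

theorem Arith.exists_extension [Countable M] {n : ℕ} (h : BSigma (toStr M) (n + 2)) :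
    ∃ (K : Str) (e : Emb (toStr M) K),
      IsProper e ∧ IsEndExt e ∧ SigmaElem e (n + 2) ∧ BSigma K (n + 1) := by
  obtain ⟨⟨-, hI⟩, hColl⟩ := h
  have hB : ∀ Q : (ℕ → M) → Prop, Hs (n + 1) Q → B2 Q := fun Q hQ => Hs.b2 hColl hQ
  obtain ⟨W, hW⟩ := Hs.exists_univ hI hB n le_rfl
  obtain ⟨C, hsub, hsol, hcount⟩ := hW.exists_closed
  obtain ⟨U, hU⟩ := exists_ultrafilter hcount
  have hS : ∀ k ≤ n + 1, ∀ φ, IsSigma k φ → C.mem fun v => sat v φ := fun k hk φ hφ =>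
    hsub _ (Hs.le hk (IsSigma.hs hB hφ (by omega)))
  have hP : ∀ k ≤ n + 1, ∀ φ, IsPi k φ → C.mem fun v => ¬ sat v φ := fun k hk φ hφ =>
    hsub _ (Hs.le hk (IsPi.hs hB hφ (by omega)))
  have hLS : ∀ k ≤ n + 1, ∀ φ, IsSigma k φ → Los C U φ := fun k hk φ hφ => hφ.los hU hS hP hk
  have hLP : ∀ k ≤ n + 1, ∀ φ, IsPi k φ → Los C U φ := fun k hk φ hφ => hφ.los hU hS hP hk
  refine ⟨uStr C U, cstEmb C U, cstEmb_proper hU, cstEmb_end hU, fun φ hφ v => ⟨?_, fun hv => ?_⟩,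
    ⟨uStr_paminus hU, uStr_ind hU (fun φ hφ => hS 0 (Nat.zero_le _) φ (.delta0 hφ)) hI⟩, ?_⟩
  · exact hφ.up hLS hLP le_rfl v
  · exact (hφ.down hLS hLP le_rfl (fun i => cst (v i)) hv).exists.choose_spec
  · intro φ hφ v x y _ a ha
    obtain ⟨N, hN⟩ := hφ.fin (M := M)
    exact uStr_coll hU hsol (hS _ le_rfl _ hφ) (hLS _ le_rfl _ hφ) hN v x y a ha

end

/-- The algebraic structure on a model of `PA⁻`. -/
@[reducible]
noncomputable def arithOfPAminus {S : Str} (h : PAminus S) : Arith S.M := by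
  classical
  letI : Zero S.M := ⟨S.zero⟩
  letI : One S.M := ⟨S.one⟩
  letI : Add S.M := ⟨S.add⟩
  letI : Mul S.M := ⟨S.mul⟩
  letI iR : CommSemiring S.M :=
    { add_assoc := h.add_assoc
      zero_add := fun a => (h.add_comm _ _).trans (h.add_zero a)
      add_zero := h.add_zero
      add_comm := h.add_comm
      mul_assoc := h.mul_assoc
      mul_comm := h.mul_comm
      mul_one := h.mul_one
      one_mul := fun a => (h.mul_comm _ _).trans (h.mul_one a)
      left_distrib := h.distrib
      right_distrib := fun a b c => by
        change S.mul (S.add a b) c = S.add (S.mul a c) (S.mul b c)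
        rw [h.mul_comm, h.distrib, h.mul_comm c a, h.mul_comm c b]
      zero_mul := fun a => (h.mul_comm _ _).trans (h.mul_zero a)
      mul_zero := h.mul_zero
      nsmul := nsmulRec
      npow := npowRec }
  letI iL : LinearOrder S.M :=
    { le := fun a b => a = b ∨ S.lt a b
      lt := S.lt
      le_refl := fun a => Or.inl rfl
      le_trans := by
        rintro a b c (rfl | h1) (rfl | h2)
        · exact Or.inl rfl
        · exact Or.inr h2
        · exact Or.inr h1
        · exact Or.inr (h.lt_trans _ _ _ h1 h2)
      le_antisymm := by
        rintro a b (rfl | h1) (h2 | h2)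
        · rfl
        · rfl
        · exact h2.symm
        · exact absurd (h.lt_trans _ _ _ h1 h2) (h.lt_irrefl _)
      le_total := fun a b => by
        rcases h.lt_total a b with h1 | h1 | h1
        · exact Or.inl (Or.inr h1)
        · exact Or.inl (Or.inl h1)
        · exact Or.inr (Or.inr h1)
      lt_iff_le_not_ge := fun a b => by
        constructor
        · refine fun h1 => ⟨Or.inr h1, ?_⟩
          rintro (rfl | h2)
          · exact h.lt_irrefl _ h1
          · exact h.lt_irrefl _ (h.lt_trans _ _ _ h1 h2)
        · rintro ⟨rfl | h1, h2⟩
          · exact absurd (Or.inl rfl) h2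
          · exact h1
      toDecidableLE := fun _ _ => Classical.propDecidable _ }
  have hadd : ∀ a b c : S.M, a < b → a + c < b + c := h.add_lt_add
  have hle : ∀ a b c : S.M, a ≤ b → a + c ≤ b + c := fun a b c h1 => by
    rcases h1 with rfl | h1
    · exact le_rfl
    · exact (hadd _ _ c h1).le
  have hzero : ∀ a : S.M, 0 ≤ a := fun a => (h.zero_le a).imp Eq.symm id
  letI : IsStrictOrderedRing S.M :=
    { add_le_add_left := fun a b h1 c => hle a b c h1
      le_of_add_le_add_left := fun a b c h1 => by
        by_contra h2
        have h3 := hadd _ _ a (not_le.1 h2)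
        rw [add_comm c, add_comm b] at h3
        exact absurd h1 (not_le.2 h3)
      zero_le_one := hzero 1
      exists_pair_ne := ⟨0, 1, fun h1 => h.lt_irrefl S.zero (by
        have := h.zero_lt_one
        rwa [show S.one = S.zero from h1.symm] at this)⟩
      mul_lt_mul_of_pos_left := fun a ha b c hbc => by
        change a * b < a * c
        rw [mul_comm a, mul_comm a]
        exact h.mul_lt_mul _ _ _ hbc ha
      mul_lt_mul_of_pos_right := fun a ha b c hbc => h.mul_lt_mul _ _ _ hbc ha }
  exact
    { iR, iL, ‹IsStrictOrderedRing S.M› with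
      exists_add_of_le := fun {a b} h1 => by
        rcases h1 with rfl | h1
        · exact ⟨0, (add_zero a).symm⟩
        · obtain ⟨c, hc⟩ := h.sub _ _ h1
          exact ⟨c, hc.symm⟩
      le_add_self := fun a b => by
        have := hle 0 b a (hzero b)
        rwa [zero_add] at this
      le_self_add := fun a b => by
        have := hle 0 b a (hzero b)
        rwa [zero_add, add_comm] at this
      succ_le := fun {a b} h1 => (h.discrete _ _ h1) }

end PaperArith

namespace PaperArith

/-- Theorem `thm:kaufmann-clote`, answering the
Kaufmann–Clote question.
For each `n ∈ ℕ` and every countable model `M ⊨ BΣₙ₊₂` there is a proper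
`Σₙ₊₂`-elementary end extension `M ≼_{e,Σₙ₊₂} K` with `K ⊨ BΣₙ₊₁`. -/
theorem statement_7 (n : ℕ) (S : Str) (hc : Countable S.M)
    (h : BSigma S (n + 2)) :
    ∃ (K : Str) (e : Emb S K),
      IsProper e ∧ IsEndExt e ∧ SigmaElem e (n + 2) ∧ BSigma K (n + 1) := by
  let _ := arithOfPAminus h.1.1
  exact Arith.exists_extension (M := S.M) h

end PaperArith
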